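/- Let Ω ⊊ ℂ be a (possibly unbounded) simply connected domain. Then Ω is a QH-visibility domain if and only if ∂^∞Ω = ∂Ω ∪ {∞} is a locally connected subset of the Riemann sphere ℂ̂. -/

import Mathlib

open Metric Set Filter Topology MeasureTheory
open scoped NNReal ENNReal

noncomputable section

variable {E : Type*} [NormedAddCommGroup E] [NormedSpace ℝ E]

/-- The quasihyperbolic length of a path `γ : [a, b] → Ω`, i.e. `∫ ‖γ'(t)‖ / δ_Ω(γ t) dt`. -/
def qhLength (Ω : Set E) (γ : ℝ → E) (a b : ℝ) : ℝ :=
  ∫ t in a..b, ‖deriv γ t‖ / infDist (γ t) Ωᶜ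

/-- Admissible (Lipschitz, i.e. rectifiable) paths joining `x` to `y` inside `Ω`. -/
def qhAdmissible (Ω : Set E) (x y : E) (γ : ℝ → E) (a b : ℝ) : Prop :=
  a ≤ b ∧ γ a = x ∧ γ b = y ∧ (∀ t ∈ Icc a b, γ t ∈ Ω) ∧
    ∃ K : ℝ≥0, LipschitzOnWith K γ (Icc a b)

/-- The quasihyperbolic distance `k_Ω` on a domain `Ω`. -/
def qhDist (Ω : Set E) (x y : E) : ℝ :=
  sInf { L : ℝ | ∃ γ a b, qhAdmissible Ω x y γ a b ∧ L = qhLength Ω γ a b }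

/-- `γ` is a (unit-speed) quasihyperbolic geodesic on the parameter set `s`. -/
def IsQHGeodesicOn (Ω : Set E) (γ : ℝ → E) (s : Set ℝ) : Prop :=
  (∀ t ∈ s, γ t ∈ Ω) ∧ ∀ a ∈ s, ∀ b ∈ s, qhDist Ω (γ a) (γ b) = |a - b|

/-- `Ω` is a QH-visibility domain: any two distinct Euclidean boundary points have
neighbourhoods with disjoint closures together with a compact subset of `Ω` which is met by
every quasihyperbolic geodesic joining the two neighbourhoods. -/
def QHVisibilityDomain (Ω : Set E) : Prop :=
  ∀ p ∈ frontier Ω, ∀ q ∈ frontier Ω, p ≠ q →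
    ∃ U V : Set E, IsOpen U ∧ IsOpen V ∧ p ∈ U ∧ q ∈ V ∧
      closure U ∩ closure V = ∅ ∧
      ∃ K : Set E, IsCompact K ∧ K ⊆ Ω ∧
        ∀ (γ : ℝ → E) (T : ℝ), 0 ≤ T → IsQHGeodesicOn Ω γ (Icc 0 T) →
          γ 0 ∈ U → γ T ∈ V → ∃ t ∈ Icc 0 T, γ t ∈ K

theorem exists_zero_of_tendstoLocallyUniformlyOn {ι : Type*} {φ : Filter ι}
    {H : ι → ℂ → ℂ} {h : ℂ → ℂ} {U S : Set ℂ} {b : ℂ} [φ.NeBot] (hU : IsOpen U)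
    (hc : IsPreconnected U) (hH : ∀ᶠ n in φ, DifferentiableOn ℂ (H n) U)
    (hl : TendstoLocallyUniformlyOn H h φ U) (hb : b ∈ U) (hb0 : h b = 0)
    (hne : ∃ c ∈ U, h c ≠ 0) (hS : S ∈ 𝓝 b) :
    ∀ᶠ n in φ, ∃ z ∈ S, H n z = 0 := by
  have hd : DifferentiableOn ℂ h U := hl.differentiableOn hH hU
  have han : AnalyticOnNhd ℂ h U := hd.analyticOnNhd hU
  have hpunct : ∀ᶠ z in 𝓝[≠] b, h z ≠ 0 := by
    rcases (han b hb).eventually_eq_zero_or_eventually_ne_zero with h0 | h0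
    · obtain ⟨c, hcU, hc0⟩ := hne
      exact absurd (han.eqOn_zero_of_preconnected_of_eventuallyEq_zero hc hb h0 hcU) hc0
    · exact h0
  rw [eventually_nhdsWithin_iff] at hpunct
  obtain ⟨r, hr, hrs⟩ := nhds_basis_closedBall.mem_iff.1
    (inter_mem (inter_mem (hU.mem_nhds hb) hS) hpunct)
  have hsph : IsCompact (sphere b r) := isCompact_sphere b r
  have hcb : closedBall b r ⊆ U := fun z hz => (hrs hz).1.1
  have hsU : sphere b r ⊆ U := sphere_subset_closedBall.trans hcb
  obtain ⟨z₀, hz₀, hmin⟩ := hsph.exists_isMinOn (NormedSpace.sphere_nonempty.2 hr.le)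
    ((hd.continuousOn.mono hsU).norm)
  set m := ‖h z₀‖ with hm
  have hmpos : 0 < m := by
    rw [hm, norm_pos_iff]
    exact (hrs (sphere_subset_closedBall hz₀)).2 (ne_of_mem_sphere hz₀ hr.ne')
  have hunif := (tendstoLocallyUniformlyOn_iff_forall_isCompact hU).1 hl _ hcb
    (isCompact_closedBall b r)
  rw [Metric.tendstoUniformlyOn_iff] at hunif
  filter_upwards [hunif (m / 4) (by positivity), hH] with n hn hdn
  have hnb : ‖H n b‖ < m / 4 := by
    simpa [hb0, dist_eq_norm] using hn b (mem_closedBall_self hr.le)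
  have hsphere : ∀ z ∈ sphere b r, m / 2 ≤ ‖H n z - H n b‖ := by
    intro z hz
    have h1 := hn z (sphere_subset_closedBall hz)
    rw [dist_eq_norm] at h1
    have h2 : m ≤ ‖h z‖ := hmin hz
    have h3 : h z = (h z - H n z) + (H n z - H n b) + H n b := by ring
    have h4 : ‖h z‖ ≤ ‖h z - H n z‖ + ‖H n z - H n b‖ + ‖H n b‖ := by
      conv_lhs => rw [h3]
      exact norm_add₃_le
    linarith
  have hfreq : ∃ᶠ z in 𝓝 b, H n z ≠ H n b := by
    intro hcon
    have hcon' : H n =ᶠ[𝓝 b] fun _ => H n b := by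
      filter_upwards [hcon] with z hz using not_not.1 hz
    have := (hdn.analyticOnNhd hU).eqOn_of_preconnected_of_eventuallyEq
      analyticOnNhd_const hc hb hcon' (hsU hz₀)
    have h5 := hsphere z₀ hz₀
    simp only at this
    rw [this, sub_self, norm_zero] at h5
    linarith
  have hdcl : DiffContOnCl ℂ (H n) (ball b r) :=
    (hdn.mono (closure_ball_subset_closedBall.trans hcb)).diffContOnCl
  have := hdcl.ball_subset_image_closedBall hr hsphere hfreq
  obtain ⟨z, hz, hz0⟩ := this (show (0 : ℂ) ∈ ball (H n b) (m / 2 / 2) by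
    rw [mem_ball, dist_comm, dist_zero_right]; linarith)
  exact ⟨z, (hrs hz).1.2, hz0⟩

/-- Pointwise limits of uniformly bounded holomorphic functions are locally uniform. -/
theorem tendstoLocallyUniformlyOn_of_bounded {ι : Type*} {φ : Filter ι}
    {H : ι → ℂ → ℂ} {h : ℂ → ℂ} {U : Set ℂ} (hU : IsOpen U)
    (hH : ∀ n, DifferentiableOn ℂ (H n) U) (hb : ∀ n, MapsTo (H n) U (closedBall 0 1))
    (hl : ∀ z ∈ U, Tendsto (fun n => H n z) φ (𝓝 (h z))) :
    TendstoLocallyUniformlyOn H h φ U := by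
  rw [Metric.tendstoLocallyUniformlyOn_iff]
  intro ε hε x hx
  obtain ⟨r, hr, hrU⟩ := Metric.isOpen_iff.1 hU x hx
  have key : ∀ n, ∀ z ∈ ball x r, dist (H n z) (H n x) ≤ 2 / r * dist z x := by
    intro n z hz
    refine Complex.dist_le_div_mul_dist_of_mapsTo_ball ((hH n).mono hrU) ?_ hz
    intro w hw
    have h1 := hb n (hrU hw)
    have h2 := hb n hx
    rw [mem_closedBall, dist_zero_right] at h1 h2
    rw [mem_closedBall, dist_eq_norm]
    exact (norm_sub_le _ _).trans (by linarith)
  rcases φ.eq_or_neBot with rfl | hne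
  · exact ⟨U, self_mem_nhdsWithin, by simp⟩
  have keyh : ∀ z ∈ ball x r, dist (h z) (h x) ≤ 2 / r * dist z x := by
    intro z hz
    exact le_of_tendsto ((hl z (hrU hz)).dist (hl x hx)) (Eventually.of_forall fun n => key n z hz)
  set s := min r (r * ε / 8) with hs
  have hspos : 0 < s := by positivity
  refine ⟨ball x s, mem_nhdsWithin_of_mem_nhds (ball_mem_nhds _ hspos), ?_⟩
  have h3 := (Metric.tendsto_nhds.1 (hl x hx)) (ε / 4) (by positivity)
  filter_upwards [h3] with n hn z hz
  have hzr : z ∈ ball x r := ball_subset_ball (min_le_left _ _) hz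
  have hb2 : 2 / r * dist z x ≤ ε / 4 := by
    have : dist z x ≤ r * ε / 8 := (mem_ball.1 hz).le.trans (min_le_right _ _)
    calc 2 / r * dist z x ≤ 2 / r * (r * ε / 8) := by gcongr
      _ = ε / 4 := by field_simp; ring
  calc dist (h z) (H n z) ≤ dist (h z) (h x) + dist (h x) (H n x) + dist (H n x) (H n z) :=
        dist_triangle4 _ _ _ _
    _ ≤ ε / 4 + ε / 4 + ε / 4 := by
        gcongr
        · exact (keyh z hzr).trans hb2
        · rw [dist_comm]; exact hn.le
        · rw [dist_comm]; exact (key n z hzr).trans hb2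
    _ < ε := by linarith

/-- The disc automorphism sending `a` to `0`. -/
noncomputable def discMoebius (a z : ℂ) : ℂ := (z - a) / (1 - (starRingEnd ℂ) a * z)

theorem one_sub_conj_mul_ne_zero {a z : ℂ} (ha : ‖a‖ < 1) (hz : ‖z‖ < 1) :
    1 - (starRingEnd ℂ) a * z ≠ 0 := by
  intro h
  have h1 : ‖(starRingEnd ℂ) a * z‖ = 1 := by rw [← sub_eq_zero.1 h, norm_one]
  rw [norm_mul, RCLike.norm_conj] at h1
  nlinarith [norm_nonneg a, norm_nonneg z]

theorem hasDerivAt_discMoebius {a z : ℂ} (ha : ‖a‖ < 1) (hz : ‖z‖ < 1) :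
    HasDerivAt (discMoebius a)
      ((1 - (‖a‖ : ℂ) ^ 2) / (1 - (starRingEnd ℂ) a * z) ^ 2) z := by
  have hne := one_sub_conj_mul_ne_zero ha hz
  have h1 : HasDerivAt (fun z : ℂ => z - a) 1 z := (hasDerivAt_id z).sub_const a
  have h2 : HasDerivAt (fun z : ℂ => 1 - (starRingEnd ℂ) a * z) (-((starRingEnd ℂ) a)) z := by
    simpa using ((hasDerivAt_id z).const_mul ((starRingEnd ℂ) a)).const_sub 1
  refine (h1.div h2 hne).congr_deriv ?_
  rw [← Complex.mul_conj']
  ring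

theorem norm_discMoebius_sq {a z : ℂ} (ha : ‖a‖ < 1) (hz : ‖z‖ < 1) :
    (1 - ‖discMoebius a z‖ ^ 2) * ‖1 - (starRingEnd ℂ) a * z‖ ^ 2
      = (1 - ‖a‖ ^ 2) * (1 - ‖z‖ ^ 2) := by
  have hne : ‖1 - (starRingEnd ℂ) a * z‖ ≠ 0 := norm_ne_zero_iff.2 (one_sub_conj_mul_ne_zero ha hz)
  rw [discMoebius, norm_div, div_pow, sub_mul, div_mul_cancel₀ _ (pow_ne_zero 2 hne), one_mul]
  simp only [← Complex.normSq_eq_norm_sq, Complex.normSq_apply, Complex.sub_re, Complex.sub_im,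
    Complex.mul_re, Complex.mul_im, Complex.conj_re, Complex.conj_im, Complex.one_re,
    Complex.one_im]
  ring

theorem norm_discMoebius_lt_one {a z : ℂ} (ha : ‖a‖ < 1) (hz : ‖z‖ < 1) :
    ‖discMoebius a z‖ < 1 := by
  have h := norm_discMoebius_sq ha hz
  have hne : 0 < ‖1 - (starRingEnd ℂ) a * z‖ := norm_pos_iff.2 (one_sub_conj_mul_ne_zero ha hz)
  have h1 : 0 < (1 - ‖a‖ ^ 2) * (1 - ‖z‖ ^ 2) := by
    apply mul_pos <;> nlinarith [norm_nonneg a, norm_nonneg z]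
  rw [← h] at h1
  have h2 := pos_of_mul_pos_left h1 (by positivity)
  nlinarith [norm_nonneg (discMoebius a z)]

theorem discMoebius_injOn {a : ℂ} (ha : ‖a‖ < 1) : InjOn (discMoebius a) (ball 0 1) := by
  intro z hz w hw h
  rw [mem_ball_zero_iff] at hz hw
  have h1 := one_sub_conj_mul_ne_zero ha hz
  have h2 := one_sub_conj_mul_ne_zero ha hw
  rw [discMoebius, discMoebius, div_eq_div_iff h1 h2] at h
  have h3 : (z - w) * (1 - (starRingEnd ℂ) a * a) = 0 := by linear_combination h
  rcases mul_eq_zero.1 h3 with h4 | h4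
  · exact sub_eq_zero.1 h4
  · exact absurd h4 (one_sub_conj_mul_ne_zero ha ha)

@[simp] theorem discMoebius_self (a : ℂ) : discMoebius a a = 0 := by simp [discMoebius]

/-- The competitors in the extremal problem defining the Riemann map. -/
structure IsRiemannCompetitor (Ω : Set ℂ) (o : ℂ) (g : ℂ → ℂ) : Prop where
  differentiableOn : DifferentiableOn ℂ g Ω
  mapsTo : MapsTo g Ω (ball 0 1)
  injOn : InjOn g Ω
  deriv_ne_zero : ∀ z ∈ Ω, deriv g z ≠ 0
  map_base : g o = 0

section
variable {Ω : Set ℂ}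

theorem discMoebius_comp_competitor (hΩ : IsOpen Ω) {o : ℂ} (ho : o ∈ Ω) {q : ℂ → ℂ}
    (hd : DifferentiableOn ℂ q Ω) (hm : MapsTo q Ω (ball 0 1)) (hi : InjOn q Ω)
    (hd0 : ∀ z ∈ Ω, deriv q z ≠ 0) :
    IsRiemannCompetitor Ω o (discMoebius (q o) ∘ q) ∧
      ‖deriv (discMoebius (q o) ∘ q) o‖ = ‖deriv q o‖ / (1 - ‖q o‖ ^ 2) := by
  have hb : ‖q o‖ < 1 := mem_ball_zero_iff.1 (hm ho)
  have hder : ∀ z ∈ Ω, HasDerivAt (discMoebius (q o) ∘ q)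
      ((1 - (‖q o‖ : ℂ) ^ 2) / (1 - (starRingEnd ℂ) (q o) * q z) ^ 2 * deriv q z) z := by
    intro z hz
    exact (hasDerivAt_discMoebius hb (mem_ball_zero_iff.1 (hm hz))).comp z
      (hd.differentiableAt (hΩ.mem_nhds hz)).hasDerivAt
  have hpos : 0 < 1 - ‖q o‖ ^ 2 := by nlinarith [norm_nonneg (q o)]
  have hc : (1 - (‖q o‖ : ℂ) ^ 2) = ((1 - ‖q o‖ ^ 2 : ℝ) : ℂ) := by push_cast; ring
  refine ⟨⟨fun z hz => (hder z hz).differentiableAt.differentiableWithinAt, ?_, ?_, ?_, ?_⟩, ?_⟩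
  · intro z hz
    exact mem_ball_zero_iff.2 (norm_discMoebius_lt_one hb (mem_ball_zero_iff.1 (hm hz)))
  · exact (discMoebius_injOn hb).comp hi hm
  · intro z hz
    rw [(hder z hz).deriv, hc]
    refine mul_ne_zero (div_ne_zero ?_ ?_) (hd0 z hz)
    · exact_mod_cast hpos.ne'
    · exact pow_ne_zero 2 (one_sub_conj_mul_ne_zero hb (mem_ball_zero_iff.1 (hm hz)))
  · simp
  · rw [(hder o ho).deriv, Complex.conj_mul', hc, norm_mul, norm_div, norm_pow, Complex.norm_real,
      Real.norm_of_nonneg hpos.le]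
    field_simp

theorem exists_sqrt (hΩ : IsOpen Ω) (hs : IsSimplyConnected Ω) {p : ℂ → ℂ}
    (hd : DifferentiableOn ℂ p Ω) (hp0 : ∀ z ∈ Ω, p z ≠ 0) :
    ∃ q : ℂ → ℂ, (∀ z, q z ^ 2 = p z) ∧ ∀ z ∈ Ω, HasDerivAt q (deriv p z / (2 * q z)) z := by
  obtain ⟨q, hqc, hq⟩ := Complex.exists_continuousOn_pow_eq hs hΩ hd.continuousOn
    (by rintro ⟨z, hz, h⟩; exact hp0 z hz h) two_ne_zero
  refine ⟨q, hq, fun z hz => ?_⟩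
  have hq0 : q z ≠ 0 := by
    intro h
    have := hq z
    rw [h] at this
    exact hp0 z hz (by rw [← this]; simp)
  have hqz : ContinuousAt q z := hqc.continuousAt (hΩ.mem_nhds hz)
  have hpd := (hd.differentiableAt (hΩ.mem_nhds hz)).hasDerivAt
  rw [hasDerivAt_iff_tendsto_slope] at hpd ⊢
  have hsum : Tendsto (fun w => q w + q z) (𝓝[≠] z) (𝓝 (2 * q z)) := by
    rw [two_mul]
    exact (hqz.tendsto.mono_left nhdsWithin_le_nhds).add_const _
  have hne : (2 * q z) ≠ 0 := mul_ne_zero two_ne_zero hq0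
  refine (hpd.div hsum hne).congr' ?_
  filter_upwards [hsum.eventually_ne hne] with w hw
  simp only [Pi.div_apply, slope_def_field, ← hq]
  rw [div_div, sq_sub_sq, mul_comm (q w + q z), mul_div_mul_right _ _ hw]

theorem exists_riemannCompetitor (hΩ : IsOpen Ω) (hs : IsSimplyConnected Ω) (hne : Ω ≠ univ)
    {o : ℂ} (ho : o ∈ Ω) : ∃ g, IsRiemannCompetitor Ω o g := by
  obtain ⟨a, ha⟩ := (ne_univ_iff_exists_notMem Ω).1 hne
  have hpd : ∀ z, HasDerivAt (fun z : ℂ => z - a) 1 z := fun z => (hasDerivAt_id z).sub_const a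
  obtain ⟨q, hq, hqd⟩ := exists_sqrt hΩ hs (p := fun z => z - a)
    (fun z _ => (hpd z).differentiableAt.differentiableWithinAt)
    (fun z hz h => ha (by rw [← sub_eq_zero.1 h]; exact hz))
  have hq0 : ∀ z ∈ Ω, q z ≠ 0 := by
    intro z hz h
    have := hq z
    rw [h] at this
    exact ha (by rw [← sub_eq_zero.1 (show z - a = 0 by rw [← this]; simp)]; exact hz)
  have hqd' : ∀ z ∈ Ω, deriv q z ≠ 0 := by
    intro z hz
    rw [(hqd z hz).deriv, (hpd z).deriv]
    simp [hq0 z hz]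
  have hqdiff : DifferentiableOn ℂ q Ω :=
    fun z hz => (hqd z hz).differentiableAt.differentiableWithinAt
  have hnhds : q '' Ω ∈ 𝓝 (q o) := by
    have hsd : HasStrictDerivAt q (deriv q o) o :=
      ((hqdiff.analyticOnNhd hΩ) o ho).hasStrictDerivAt
    rw [← hsd.map_nhds_eq (hqd' o ho)]
    exact image_mem_map (hΩ.mem_nhds ho)
  obtain ⟨ε, hε, hball⟩ := Metric.mem_nhds_iff.1 hnhds
  have hfar : ∀ z ∈ Ω, ε ≤ ‖q z + q o‖ := by
    intro z hz
    by_contra! hlt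
    have hmem : -q z ∈ ball (q o) ε := by
      rw [mem_ball, dist_eq_norm, ← norm_neg]
      simpa [sub_eq_add_neg, add_comm] using hlt
    obtain ⟨w, hw, hwz⟩ := hball hmem
    have hzw : z = w := by
      have h1 := hq z
      have h2 := hq w
      rw [hwz, neg_sq, h1] at h2
      simpa using h2
    rw [← hzw] at hwz
    exact hq0 z hz (by linear_combination hwz / 2)
  have hne0 : ∀ z ∈ Ω, q z + q o ≠ 0 := fun z hz h => by
    have := hfar z hz
    rw [h, norm_zero] at this
    linarith
  have hrd : ∀ z ∈ Ω, HasDerivAt (fun z => ((ε / 2 : ℝ) : ℂ) / (q z + q o))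
      (-((ε / 2 : ℝ) : ℂ) * deriv q z / (q z + q o) ^ 2) z := by
    intro z hz
    have h1 := (hqd z hz).differentiableAt.hasDerivAt.add_const (q o)
    refine ((hasDerivAt_const z ((ε / 2 : ℝ) : ℂ)).div h1 (hne0 z hz)).congr_deriv ?_
    ring
  refine ⟨_, (discMoebius_comp_competitor hΩ ho
    (q := fun z => ((ε / 2 : ℝ) : ℂ) / (q z + q o)) ?_ ?_ ?_ ?_).1⟩
  · exact fun z hz => (hrd z hz).differentiableAt.differentiableWithinAt
  · intro z hz
    rw [mem_ball_zero_iff, norm_div, Complex.norm_real, Real.norm_of_nonneg (by positivity),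
      div_lt_one (by linarith [hfar z hz])]
    linarith [hfar z hz]
  · intro z hz w hw h
    have hε' : ((ε / 2 : ℝ) : ℂ) ≠ 0 := by exact_mod_cast (by positivity : ε / 2 ≠ 0)
    simp only at h
    rw [div_eq_div_iff (hne0 z hz) (hne0 w hw)] at h
    have h1 := mul_left_cancel₀ hε' h
    have h2 : q z = q w := by linear_combination -h1
    have h3 := hq z
    rw [h2, hq w] at h3
    linear_combination -h3
  · intro z hz
    rw [(hrd z hz).deriv]
    refine div_ne_zero (mul_ne_zero (neg_ne_zero.2 ?_) (hqd' z hz)) (pow_ne_zero 2 (hne0 z hz))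
    exact_mod_cast (by positivity : ε / 2 ≠ 0)

end

section
variable {Ω : Set ℂ}

theorem IsRiemannCompetitor.norm_deriv_le {o : ℂ} {ρ : ℝ} (hρ : 0 < ρ) (hb : ball o ρ ⊆ Ω)
    {g : ℂ → ℂ} (hg : IsRiemannCompetitor Ω o g) : ‖deriv g o‖ ≤ 1 / ρ := by
  refine Complex.norm_deriv_le_div_of_mapsTo_ball (hg.differentiableOn.mono hb) ?_ hρ
  intro z hz
  rw [hg.map_base]
  exact ball_subset_closedBall (hg.mapsTo (hb hz))

/-- An extremal competitor exists. -/
theorem exists_extremal_competitor (hΩ : IsOpen Ω) (hc : IsPreconnected Ω)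
    {o : ℂ} (ho : o ∈ Ω) (hex : ∃ g, IsRiemannCompetitor Ω o g) :
    ∃ h, IsRiemannCompetitor Ω o h ∧
      ∀ g, IsRiemannCompetitor Ω o g → ‖deriv g o‖ ≤ ‖deriv h o‖ := by
  obtain ⟨ρ, hρ, hball⟩ := Metric.isOpen_iff.1 hΩ o ho
  obtain ⟨g₀, hg₀⟩ := hex
  set A : Set ℝ := {m | ∃ g, IsRiemannCompetitor Ω o g ∧ m = ‖deriv g o‖} with hA
  have hAb : BddAbove A := by
    refine ⟨1 / ρ, ?_⟩
    rintro m ⟨g, hg, rfl⟩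
    exact hg.norm_deriv_le hρ hball
  have hAn : A.Nonempty := ⟨_, g₀, hg₀, rfl⟩
  obtain ⟨u, -, hu, huA⟩ := exists_seq_tendsto_sSup hAn hAb
  choose G hG hGu using huA
  set φ := hyperfilter ℕ
  have hlim : ∀ z, ∃ w, z ∈ Ω → Tendsto (fun n => G n z) φ (𝓝 w) := by
    intro z
    by_cases hz : z ∈ Ω
    · obtain ⟨w, -, hw⟩ := (isCompact_closedBall (0 : ℂ) 1).ultrafilter_le_nhds
        (φ.map fun n => G n z) (by
          rw [le_principal_iff]
          exact Filter.mem_map.2 (univ_mem' fun n => ball_subset_closedBall ((hG n).mapsTo hz)))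
      exact ⟨w, fun _ => hw⟩
    · exact ⟨0, fun h => absurd h hz⟩
  choose h hh using hlim
  have hl : TendstoLocallyUniformlyOn G h φ Ω :=
    tendstoLocallyUniformlyOn_of_bounded hΩ (fun n => (hG n).differentiableOn)
      (fun n z hz => ball_subset_closedBall ((hG n).mapsTo hz)) hh
  have hev : ∀ᶠ n in (φ : Filter ℕ), DifferentiableOn ℂ (G n) Ω :=
    Eventually.of_forall fun n => (hG n).differentiableOn
  have hd : DifferentiableOn ℂ h Ω := hl.differentiableOn hev hΩ
  have hl' := hl.deriv hev hΩ
  have hM : ‖deriv h o‖ = sSup A := by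
    have h1 : Tendsto (fun n => ‖deriv (G n) o‖) φ (𝓝 ‖deriv h o‖) := (hl'.tendsto_at ho).norm
    have h2 : Tendsto (fun n => ‖deriv (G n) o‖) φ (𝓝 (sSup A)) := by
      simp only [← hGu]
      exact hu.mono_left Nat.hyperfilter_le_atTop
    exact tendsto_nhds_unique h1 h2
  have hmax : ∀ g, IsRiemannCompetitor Ω o g → ‖deriv g o‖ ≤ ‖deriv h o‖ := by
    intro g hg
    rw [hM]
    exact le_csSup hAb ⟨g, hg, rfl⟩
  have hpos : deriv h o ≠ 0 := by
    have := hmax g₀ hg₀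
    intro h0
    rw [h0, norm_zero] at this
    exact hg₀.deriv_ne_zero o ho (norm_le_zero_iff.1 this)
  have hd0 : ∀ z ∈ Ω, deriv h z ≠ 0 := by
    intro z hz h0
    obtain ⟨n, w, hw, hw0⟩ := (exists_zero_of_tendstoLocallyUniformlyOn hΩ hc
      (hev.mono fun n hn => hn.deriv hΩ) hl' hz h0 ⟨o, ho, hpos⟩ (hΩ.mem_nhds hz)).exists
    exact (hG n).deriv_ne_zero w hw hw0
  have hinj : InjOn h Ω := by
    intro z hz w hw hzw
    by_contra hne
    have hl2 : TendstoLocallyUniformlyOn (fun n v => G n v - G n z) (fun v => h v - h z) φ Ω := by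
      refine hl.fun_sub ?_
      have := (hh z hz).tendstoUniformlyOn_const Ω
      exact this.tendstoLocallyUniformlyOn
    have hnc : ∃ c ∈ Ω, h c - h z ≠ 0 := by
      by_contra! hcon
      refine hpos ?_
      have : h =ᶠ[𝓝 o] fun _ => h z := by
        filter_upwards [hΩ.mem_nhds ho] with v hv
        exact sub_eq_zero.1 (hcon v hv)
      rw [this.deriv_eq, deriv_const]
    obtain ⟨n, v, hv, hv0⟩ := (exists_zero_of_tendstoLocallyUniformlyOn hΩ hc
      (hev.mono fun n hn => hn.sub_const _) hl2 hw (sub_eq_zero.2 hzw.symm) hnc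
      (S := Ω ∩ {z}ᶜ)
      (inter_mem (hΩ.mem_nhds hw) (isOpen_compl_singleton.mem_nhds (Ne.symm hne)))).exists
    exact hv.2 ((hG n).injOn hv.1 hz (sub_eq_zero.1 hv0))
  refine ⟨h, ⟨hd, ?_, hinj, hd0, ?_⟩, hmax⟩
  · intro z hz
    have hmaps : MapsTo h Ω (closedBall 0 1) := fun z hz =>
      isClosed_closedBall.mem_of_tendsto (hh z hz)
        (Eventually.of_forall fun n => ball_subset_closedBall ((hG n).mapsTo hz))
    have hsd : HasStrictDerivAt h (deriv h z) z :=
      ((hd.analyticOnNhd hΩ) z hz).hasStrictDerivAt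
    have hmem : closedBall (0 : ℂ) 1 ∈ 𝓝 (h z) := by
      rw [← hsd.map_nhds_eq (hd0 z hz)]
      exact mem_of_superset (image_mem_map (hΩ.mem_nhds hz)) (image_subset_iff.2 hmaps)
    rw [← interior_closedBall (0 : ℂ) one_ne_zero]
    exact mem_interior_iff_mem_nhds.2 hmem
  · refine tendsto_nhds_unique (hh o ho) ?_
    simp only [fun n => (hG n).map_base]
    exact tendsto_const_nhds

/-- An extremal competitor is surjective. -/
theorem extremal_competitor_surjOn (hΩ : IsOpen Ω) (hs : IsSimplyConnected Ω)
    {o : ℂ} (ho : o ∈ Ω) {h : ℂ → ℂ} (hh : IsRiemannCompetitor Ω o h)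
    (hmax : ∀ g, IsRiemannCompetitor Ω o g → ‖deriv g o‖ ≤ ‖deriv h o‖) :
    SurjOn h Ω (ball 0 1) := by
  intro a ha
  by_contra hna
  have ha1 : ‖a‖ < 1 := mem_ball_zero_iff.1 ha
  have hh1 : ∀ z ∈ Ω, ‖h z‖ < 1 := fun z hz => mem_ball_zero_iff.1 (hh.mapsTo hz)
  have hpd : ∀ z ∈ Ω, HasDerivAt (discMoebius a ∘ h)
      ((1 - (‖a‖ : ℂ) ^ 2) / (1 - (starRingEnd ℂ) a * h z) ^ 2 * deriv h z) z := fun z hz =>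
    (hasDerivAt_discMoebius ha1 (hh1 z hz)).comp z
      (hh.differentiableOn.differentiableAt (hΩ.mem_nhds hz)).hasDerivAt
  have hp0 : ∀ z ∈ Ω, (discMoebius a ∘ h) z ≠ 0 := by
    intro z hz h0
    refine hna ⟨z, hz, discMoebius_injOn ha1 (hh.mapsTo hz) ha ?_⟩
    simpa using h0
  have hpos : 0 < 1 - ‖a‖ ^ 2 := by nlinarith [norm_nonneg a]
  have hc : (1 - (‖a‖ : ℂ) ^ 2) = ((1 - ‖a‖ ^ 2 : ℝ) : ℂ) := by push_cast; ring
  have hpd0 : ∀ z ∈ Ω, deriv (discMoebius a ∘ h) z ≠ 0 := by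
    intro z hz
    rw [(hpd z hz).deriv, hc]
    refine mul_ne_zero (div_ne_zero ?_ ?_) (hh.deriv_ne_zero z hz)
    · exact_mod_cast hpos.ne'
    · exact pow_ne_zero 2 (one_sub_conj_mul_ne_zero ha1 (hh1 z hz))
  obtain ⟨q, hq, hqd⟩ := exists_sqrt hΩ hs
    (fun z hz => (hpd z hz).differentiableAt.differentiableWithinAt) hp0
  have hq0 : ∀ z ∈ Ω, q z ≠ 0 := by
    intro z hz h0
    have := hq z
    rw [h0] at this
    exact hp0 z hz (by rw [← this]; simp)
  have hqn : ∀ z, ‖q z‖ ^ 2 = ‖(discMoebius a ∘ h) z‖ := fun z => by rw [← hq z, norm_pow]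
  have hq1 : ∀ z ∈ Ω, ‖q z‖ < 1 := by
    intro z hz
    have h1 : ‖q z‖ ^ 2 < 1 := by
      rw [hqn]; exact norm_discMoebius_lt_one ha1 (hh1 z hz)
    nlinarith [norm_nonneg (q z)]
  obtain ⟨hcomp, hval⟩ := discMoebius_comp_competitor hΩ ho (q := q)
    (fun z hz => (hqd z hz).differentiableAt.differentiableWithinAt)
    (fun z hz => mem_ball_zero_iff.2 (hq1 z hz))
    (by
      intro z hz w hw hzw
      have h1 : (discMoebius a ∘ h) z = (discMoebius a ∘ h) w := by rw [← hq, ← hq, hzw]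
      exact hh.injOn hz hw (discMoebius_injOn ha1 (hh.mapsTo hz) (hh.mapsTo hw) h1))
    (by
      intro z hz
      rw [(hqd z hz).deriv]
      exact div_ne_zero (hpd0 z hz) (mul_ne_zero two_ne_zero (hq0 z hz)))
  have hle := hmax _ hcomp
  have hDpos : 0 < ‖deriv h o‖ := norm_pos_iff.2 (hh.deriv_ne_zero o ho)
  have hb : 0 < ‖q o‖ := norm_pos_iff.2 (hq0 o ho)
  have hb1 := hq1 o ho
  have hba : ‖q o‖ ^ 2 = ‖a‖ := by
    rw [hqn]; simp [discMoebius, hh.map_base]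
  have hdq : ‖deriv q o‖ = (1 - ‖q o‖ ^ 4) * ‖deriv h o‖ / (2 * ‖q o‖) := by
    rw [(hqd o ho).deriv, (hpd o ho).deriv, hc, hh.map_base, norm_div, norm_mul, norm_div,
      Complex.norm_real, Real.norm_of_nonneg hpos.le, ← hba]
    simp
    ring
  rw [hval, hdq] at hle
  have hq2 : 0 < 1 - ‖q o‖ ^ 2 := by nlinarith
  rw [div_div, div_le_iff₀ (by positivity)] at hle
  have h3 : (1 - ‖q o‖ ^ 2) * ‖deriv h o‖ * (1 - ‖q o‖) ^ 2 ≤ 0 := by nlinarith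
  have h4 : 0 < (1 - ‖q o‖ ^ 2) * ‖deriv h o‖ * (1 - ‖q o‖) ^ 2 := by
    have : 0 < 1 - ‖q o‖ := by linarith
    positivity
  linarith

/-- The Riemann mapping theorem, with the map and its inverse both holomorphic. -/
theorem riemann_mapping (hΩ : IsOpen Ω) (hs : IsSimplyConnected Ω) (hne : Ω ≠ univ)
    (hc : IsPreconnected Ω) {o : ℂ} (ho : o ∈ Ω) :
    ∃ f g : ℂ → ℂ, DifferentiableOn ℂ f (ball 0 1) ∧ DifferentiableOn ℂ g Ω ∧
      MapsTo f (ball 0 1) Ω ∧ MapsTo g Ω (ball 0 1) ∧ LeftInvOn g f (ball 0 1) ∧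
      LeftInvOn f g Ω ∧ f 0 = o := by
  obtain ⟨g, hg, hmax⟩ := exists_extremal_competitor hΩ hc ho
    (exists_riemannCompetitor hΩ hs hne ho)
  have hsurj := extremal_competitor_surjOn hΩ hs ho hg hmax
  set f := Function.invFunOn g Ω with hf
  have hgf : LeftInvOn g f (ball 0 1) := hsurj.rightInvOn_invFunOn
  have hfg : LeftInvOn f g Ω := hg.injOn.leftInvOn_invFunOn
  have hfm : MapsTo f (ball 0 1) Ω := hsurj.mapsTo_invFunOn
  refine ⟨f, g, ?_, hg.differentiableOn, hfm, hg.mapsTo, hgf, hfg, ?_⟩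
  · intro z hz
    have hfz := hfm hz
    have hsd : HasStrictDerivAt g (deriv g (f z)) (f z) :=
      ((hg.differentiableOn.analyticOnNhd hΩ) _ hfz).hasStrictDerivAt
    have hn := hg.deriv_ne_zero _ hfz
    have hloc := hsd.to_localInverse hn
    rw [hgf hz] at hloc
    have hcont : Tendsto f (𝓝 z) (𝓝 (f z)) := by
      intro s hs
      have : g '' (s ∩ Ω) ∈ 𝓝 z := by
        rw [← hgf hz, ← hsd.map_nhds_eq hn]
        exact image_mem_map (inter_mem hs (hΩ.mem_nhds hfz))
      change f ⁻¹' s ∈ 𝓝 z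
      filter_upwards [this]
      rintro _ ⟨w, hw, rfl⟩
      rw [mem_preimage, hfg hw.2]
      exact hw.1
    refine (HasDerivAt.of_local_left_inverse (f' := deriv g (f z)) hcont hsd.hasDerivAt hn
      ?_).differentiableAt.differentiableWithinAt
    filter_upwards [isOpen_ball.mem_nhds hz] with w hw
    exact hgf hw
  · rw [← hg.map_base]
    exact hfg ho

end

/-- A Bloch-type theorem (with a non-optimal constant). -/
theorem exists_ball_subset_image {h : ℂ → ℂ} {z : ℂ} {R : ℝ} (hR : 0 < R)
    (hd : DifferentiableOn ℂ h (ball z R)) (h0 : deriv h z ≠ 0) :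
    ∃ c, ball c (‖deriv h z‖ * R / 96) ⊆ h '' ball z R := by
  set r := R / 2 with hr
  have hr0 : 0 < r := by positivity
  have hsub : closedBall z r ⊆ ball z R := closedBall_subset_ball (by rw [hr]; linarith)
  have hdc : DifferentiableOn ℂ (deriv h) (ball z R) := hd.deriv isOpen_ball
  have hcont : ContinuousOn (fun w => ‖deriv h w‖ * (r - dist w z)) (closedBall z r) := by
    refine ((hdc.continuousOn.mono hsub).norm).mul ?_
    fun_prop
  obtain ⟨w₀, hw₀, hmax⟩ := (isCompact_closedBall z r).exists_isMaxOn
    (nonempty_closedBall.2 hr0.le) hcont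
  have hmax' : ∀ w ∈ closedBall z r,
      ‖deriv h w‖ * (r - dist w z) ≤ ‖deriv h w₀‖ * (r - dist w₀ z) := fun w hw => hmax hw
  have hz0 : 0 < ‖deriv h z‖ := norm_pos_iff.2 h0
  have hzr := hmax' z (mem_closedBall_self hr0.le)
  rw [dist_self, sub_zero] at hzr
  have hpos : 0 < ‖deriv h w₀‖ * (r - dist w₀ z) := lt_of_lt_of_le (by positivity) hzr
  have hD : 0 < ‖deriv h w₀‖ := by
    rcases (norm_nonneg (deriv h w₀)).eq_or_lt with h1 | h1
    · rw [← h1] at hpos; simp at hpos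
    · exact h1
  set D := ‖deriv h w₀‖ with hDdef
  set d := (r - dist w₀ z) / 2 with hd'
  have hd0 : 0 < d := by
    have := pos_of_mul_pos_right hpos hD.le
    positivity
  have hin : ∀ w ∈ ball w₀ d, w ∈ closedBall z r ∧ ‖deriv h w‖ ≤ 2 * D := by
    intro w hw
    rw [mem_ball] at hw
    have h1 : dist w z ≤ r - d := by
      have := dist_triangle w w₀ z
      have : 2 * d = r - dist w₀ z := by rw [hd']; ring
      linarith
    have h2 : w ∈ closedBall z r := by rw [mem_closedBall]; linarith
    refine ⟨h2, ?_⟩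
    have h3 := hmax' w h2
    have h4 : ‖deriv h w‖ * d ≤ ‖deriv h w‖ * (r - dist w z) :=
      mul_le_mul_of_nonneg_left (by linarith) (norm_nonneg _)
    have h5 : D * (r - dist w₀ z) = (2 * D) * d := by rw [hd']; ring
    exact le_of_mul_le_mul_right (by linarith) hd0
  have hsub2 : ball w₀ d ⊆ ball z R := fun w hw => hsub (hin w hw).1
  have hschw : ∀ w ∈ ball w₀ d, dist (deriv h w) (deriv h w₀) ≤ 3 * D / d * dist w w₀ := by
    intro w hw
    refine Complex.dist_le_div_mul_dist_of_mapsTo_ball (hdc.mono hsub2) ?_ hw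
    intro v hv
    rw [mem_closedBall, dist_eq_norm]
    calc _ ≤ ‖deriv h v‖ + ‖deriv h w₀‖ := norm_sub_le _ _
      _ ≤ 2 * D + D := add_le_add (hin v hv).2 le_rfl
      _ = _ := by ring
  have hsub3 : closedBall w₀ (d / 6) ⊆ ball w₀ d := closedBall_subset_ball (by linarith)
  have hlow : ∀ w ∈ closedBall w₀ (d / 6), D / 2 * ‖w - w₀‖ ≤ ‖h w - h w₀‖ := by
    intro w hw
    have hmv := (convex_closedBall w₀ (d / 6)).norm_image_sub_le_of_norm_hasDerivWithin_le
      (f := fun v => h v - deriv h w₀ * v) (f' := fun v => deriv h v - deriv h w₀) (C := D / 2)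
      (x := w₀) (y := w) (by
        intro v hv
        have h1 := (hd.differentiableAt (isOpen_ball.mem_nhds (hsub2 (hsub3 hv)))).hasDerivAt
        simpa using (h1.fun_sub ((hasDerivAt_id v).const_mul (deriv h w₀))).hasDerivWithinAt) (by
        intro v hv
        have h1 := hschw v (hsub3 hv)
        rw [dist_eq_norm] at h1
        have h2 : dist v w₀ ≤ d / 6 := hv
        calc _ ≤ 3 * D / d * dist v w₀ := h1
          _ ≤ 3 * D / d * (d / 6) := by gcongr
          _ = D / 2 := by field_simp; norm_num) (mem_closedBall_self (by positivity)) hw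
    have h1 : ‖deriv h w₀ * (w - w₀)‖ = D * ‖w - w₀‖ := by rw [norm_mul]
    have h2 : ‖deriv h w₀ * (w - w₀)‖ ≤ ‖h w - h w₀‖ +
        ‖(h w - deriv h w₀ * w) - (h w₀ - deriv h w₀ * w₀)‖ := by
      have h3 : deriv h w₀ * (w - w₀) = (h w - h w₀) -
        ((h w - deriv h w₀ * w) - (h w₀ - deriv h w₀ * w₀)) := by ring
      conv_lhs => rw [h3]
      exact norm_sub_le _ _
    linarith
  refine ⟨h w₀, ?_⟩
  have key := DiffContOnCl.ball_subset_image_closedBall (f := h) (z₀ := w₀) (r := d / 6)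
    (ε := D / 2 * (d / 6)) ?_ (by positivity) ?_ ?_
  · refine (ball_subset_ball ?_).trans (key.trans (image_mono (hsub3.trans hsub2)))
    have h5 : D * (r - dist w₀ z) = (2 * D) * d := by rw [hd']; ring
    rw [h5, hr] at hzr
    linarith
  · exact (hd.mono (hsub3.trans hsub2)).diffContOnCl_ball subset_rfl
  · intro w hw
    have := hlow w (sphere_subset_closedBall hw)
    rw [mem_sphere_iff_norm.1 hw] at this
    exact this
  · have : ∀ᶠ w in 𝓝[≠] w₀, h w ≠ h w₀ := by
      filter_upwards [self_mem_nhdsWithin,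
        mem_nhdsWithin_of_mem_nhds (closedBall_mem_nhds w₀ (by positivity : 0 < d / 6))] with w h1 h2
      intro heq
      have h3 := hlow w h2
      rw [heq, sub_self, norm_zero] at h3
      have h4 : 0 < ‖w - w₀‖ := norm_pos_iff.2 (sub_ne_zero.2 h1)
      have : 0 < D / 2 * ‖w - w₀‖ := by positivity
      linarith
    exact (this.frequently).filter_mono nhdsWithin_le_nhds

/-- A holomorphic logarithm on a disc. -/
theorem exists_log_on_ball {f : ℂ → ℂ} {z : ℂ} {R : ℝ}
    (hd : DifferentiableOn ℂ f (ball z R)) (h0 : ∀ w ∈ ball z R, f w ≠ 0) :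
    ∃ H : ℂ → ℂ, ∀ w ∈ ball z R, HasDerivAt H (deriv f w / f w) w ∧ Complex.exp (H w) = f w := by
  rcases le_or_gt R 0 with hR | hR
  · exact ⟨0, by simp [ball_eq_empty.2 hR]⟩
  obtain ⟨H, hH⟩ := DifferentiableOn.isExactOn_ball (c := z) (r := R)
    (((hd.deriv isOpen_ball).div hd h0) : DifferentiableOn ℂ (fun w => deriv f w / f w) (ball z R))
  have hz := mem_ball_self (x := z) hR
  have hconst : ∀ w ∈ ball z R, Complex.exp (-H w) * f w = Complex.exp (-H z) * f z := by
    have hder : ∀ w ∈ ball z R, HasDerivAt (fun w => Complex.exp (-H w) * f w) 0 w := by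
      intro w hw
      have h1 := (hd.differentiableAt (isOpen_ball.mem_nhds hw)).hasDerivAt
      refine ((hH w hw).neg.cexp.mul h1).congr_deriv ?_
      have := h0 w hw
      simp only [Pi.neg_apply, Pi.div_apply]
      field_simp
      ring
    intro w hw
    exact isOpen_ball.is_const_of_deriv_eq_zero (convex_ball z R).isPreconnected
      (fun v hv => (hder v hv).differentiableAt.differentiableWithinAt)
      (fun v hv => (hder v hv).deriv) hw hz
  have hc0 : f z * Complex.exp (-H z) ≠ 0 := mul_ne_zero (h0 z hz) (Complex.exp_ne_zero _)
  refine ⟨fun w => H w + Complex.log (f z * Complex.exp (-H z)), fun w hw => ⟨?_, ?_⟩⟩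
  · exact (hH w hw).add_const _
  · rw [Complex.exp_add, Complex.exp_log hc0, mul_comm (f z), ← hconst w hw, ← mul_assoc,
      ← Complex.exp_add]
    simp

/-- A weak form of the Koebe one-quarter theorem. -/
theorem norm_deriv_mul_le_infDist {Ω : Set ℂ} {f : ℂ → ℂ} {z : ℂ} {R : ℝ} (hR : 0 < R)
    (hΩ : IsOpen Ω) (hne : Ω ≠ univ) (hd : DifferentiableOn ℂ f (ball z R))
    (hm : MapsTo f (ball z R) Ω) (hi : InjOn f (ball z R)) :
    ‖deriv f z‖ * R ≤ 640 * infDist (f z) Ωᶜ := by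
  obtain ⟨w₀, hw₀, hdist⟩ := hΩ.isClosed_compl.exists_infDist_eq_dist
    (nonempty_compl.2 hne) (f z)
  rw [hdist, dist_eq_norm]
  by_cases hD : deriv f z = 0
  · rw [hD]; simp
  have hnz : ∀ w ∈ ball z R, f w - w₀ ≠ 0 := fun w hw h =>
    hw₀ (by rw [← sub_eq_zero.1 h]; exact hm hw)
  have hz := mem_ball_self (x := z) hR
  obtain ⟨H, hH⟩ := exists_log_on_ball (f := fun w => f w - w₀) (hd.sub_const _) hnz
  have hHz : deriv H z = deriv f z / (f z - w₀) := by
    rw [(hH z hz).1.deriv, deriv_sub_const]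
  have hn : 0 < ‖f z - w₀‖ := norm_pos_iff.2 (hnz z hz)
  obtain ⟨c, hc⟩ := exists_ball_subset_image hR
    (fun w hw => (hH w hw).1.differentiableAt.differentiableWithinAt)
    (by rw [hHz]; exact div_ne_zero hD (hnz z hz))
  have hle : ‖deriv H z‖ * R / 96 ≤ 2 * Real.pi := by
    by_contra! hlt
    obtain ⟨a, ha, hac⟩ := hc (mem_ball_self (by linarith [Real.pi_pos]))
    have hmem : c + 2 * Real.pi * Complex.I ∈ ball c (‖deriv H z‖ * R / 96) := by
      rw [mem_ball, dist_eq_norm, add_sub_cancel_left]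
      simpa [abs_of_pos Real.pi_pos] using hlt
    obtain ⟨b, hb, hbc⟩ := hc hmem
    have h1 := (hH a ha).2
    have h2 := (hH b hb).2
    rw [hbc, Complex.exp_periodic c, ← hac, h1] at h2
    have h3 : a = b := hi ha hb (by linear_combination h2)
    rw [← h3, hac] at hbc
    have : (2 * Real.pi * Complex.I : ℂ) = 0 := by linear_combination -hbc
    simp [Real.pi_ne_zero] at this
  rw [hHz, norm_div] at hle
  have hpi := Real.pi_lt_d2
  rw [div_mul_eq_mul_div, div_div, div_le_iff₀ (by positivity)] at hle
  nlinarith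

section
variable {Ω : Set ℂ} {x y z : ℂ} {γ : ℝ → ℂ} {a b : ℝ}

theorem infDist_compl_pos (hΩ : IsOpen Ω) (hne : Ω ≠ univ) (hx : x ∈ Ω) : 0 < infDist x Ωᶜ :=
  (hΩ.isClosed_compl.notMem_iff_infDist_pos (nonempty_compl.2 hne)).1 (by simpa using hx)

theorem abs_infDist_sub_le (x y : ℂ) : |infDist x Ωᶜ - infDist y Ωᶜ| ≤ ‖x - y‖ := by
  rw [← dist_eq_norm, abs_sub_le_iff]
  constructor
  · linarith [infDist_le_infDist_add_dist (s := Ωᶜ) (x := x) (y := y)]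
  · linarith [infDist_le_infDist_add_dist (s := Ωᶜ) (x := y) (y := x), dist_comm x y]

theorem mem_of_norm_sub_lt_infDist (h : ‖x - y‖ < infDist x Ωᶜ) : y ∈ Ω := by
  by_contra hy
  have := infDist_le_dist_of_mem (x := x) (mem_compl hy)
  rw [dist_eq_norm] at this
  linarith

theorem qhAdmissible.mono (h : qhAdmissible Ω x y γ a b) {s t : ℝ} (hs : s ∈ Icc a b)
    (ht : t ∈ Icc a b) (hst : s ≤ t) : qhAdmissible Ω (γ s) (γ t) γ s t := by
  obtain ⟨-, -, -, hm, K, hK⟩ := h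
  have hsub : Icc s t ⊆ Icc a b := Icc_subset_Icc hs.1 ht.2
  exact ⟨hst, rfl, rfl, fun u hu => hm u (hsub hu), K, hK.mono hsub⟩

theorem qhAdmissible.integrableOn (hΩ : IsOpen Ω) (hne : Ω ≠ univ)
    (h : qhAdmissible Ω x y γ a b) :
    IntegrableOn (fun t => ‖deriv γ t‖ / infDist (γ t) Ωᶜ) (Icc a b) := by
  obtain ⟨hab, -, -, hm, K, hK⟩ := h
  have hcont : ContinuousOn (fun t => infDist (γ t) Ωᶜ) (Icc a b) :=
    (continuous_infDist_pt _).comp_continuousOn hK.continuousOn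
  obtain ⟨t₀, ht₀, hmin⟩ := isCompact_Icc.exists_isMinOn (nonempty_Icc.2 hab) hcont
  have hδ := infDist_compl_pos hΩ hne (hm t₀ ht₀)
  rw [integrableOn_Icc_iff_integrableOn_Ioo]
  refine Integrable.of_bound (C := K / infDist (γ t₀) Ωᶜ) ?_ ?_
  · refine AEMeasurable.aestronglyMeasurable (AEMeasurable.div ?_ ?_)
    · exact (measurable_deriv γ).norm.aemeasurable
    · exact (hcont.mono Ioo_subset_Icc_self).aemeasurable measurableSet_Ioo
  · refine (ae_restrict_iff' measurableSet_Ioo).2 (Eventually.of_forall fun t ht => ?_)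
    rw [Real.norm_of_nonneg (div_nonneg (norm_nonneg _) infDist_nonneg)]
    have h1 := norm_deriv_le_of_lipschitzOn (Icc_mem_nhds ht.1 ht.2) hK
    have h2 : infDist (γ t₀) Ωᶜ ≤ infDist (γ t) Ωᶜ := hmin (Ioo_subset_Icc_self ht)
    gcongr

theorem qhAdmissible.intervalIntegrable (hΩ : IsOpen Ω) (hne : Ω ≠ univ)
    (h : qhAdmissible Ω x y γ a b) :
    IntervalIntegrable (fun t => ‖deriv γ t‖ / infDist (γ t) Ωᶜ) volume a b :=
  (intervalIntegrable_iff_integrableOn_Icc_of_le h.1).2 (h.integrableOn hΩ hne)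

theorem qhLength_nonneg (hab : a ≤ b) : 0 ≤ qhLength Ω γ a b :=
  intervalIntegral.integral_nonneg hab fun _ _ => div_nonneg (norm_nonneg _) infDist_nonneg

theorem qhDist_nonneg : 0 ≤ qhDist Ω x y := by
  refine Real.sInf_nonneg ?_
  rintro L ⟨γ, a, b, h, rfl⟩
  exact qhLength_nonneg h.1

theorem qhDist_le (h : qhAdmissible Ω x y γ a b) : qhDist Ω x y ≤ qhLength Ω γ a b := by
  refine csInf_le ⟨0, ?_⟩ ⟨γ, a, b, h, rfl⟩
  rintro L ⟨γ, a, b, h, rfl⟩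
  exact qhLength_nonneg h.1

theorem qhLength_add (hΩ : IsOpen Ω) (hne : Ω ≠ univ)
    (h : qhAdmissible Ω x y γ a b) {t : ℝ} (ht : t ∈ Icc a b) :
    qhLength Ω γ a t + qhLength Ω γ t b = qhLength Ω γ a b :=
  intervalIntegral.integral_add_adjacent_intervals
    ((h.mono (left_mem_Icc.2 h.1) ht ht.1).intervalIntegrable hΩ hne)
    ((h.mono ht (right_mem_Icc.2 h.1) ht.2).intervalIntegrable hΩ hne)

theorem qhAdmissible.symm (h : qhAdmissible Ω x y γ a b) :
    qhAdmissible Ω y x (fun t => γ (-t)) (-b) (-a) ∧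
      qhLength Ω (fun t => γ (-t)) (-b) (-a) = qhLength Ω γ a b := by
  obtain ⟨hab, hx, hy, hm, K, hK⟩ := h
  refine ⟨⟨neg_le_neg hab, by simpa using hy, by simpa using hx, fun t ht => ?_, K, ?_⟩, ?_⟩
  · exact hm _ ⟨by linarith [ht.2], by linarith [ht.1]⟩
  · have h1 : LipschitzWith 1 (fun t : ℝ => -t) := LipschitzWith.of_dist_le_mul (by simp)
    have := hK.comp (h1.lipschitzOnWith (s := Icc (-b) (-a)))
      (fun t ht => ⟨by linarith [ht.2], by linarith [ht.1]⟩)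
    simpa [Function.comp_def] using this
  · unfold qhLength
    simp only [deriv_comp_neg, norm_neg]
    rw [intervalIntegral.integral_comp_neg (fun t => ‖deriv γ t‖ / infDist (γ t) Ωᶜ)]
    simp

theorem qhAdmissible.shift (h : qhAdmissible Ω x y γ a b) (c : ℝ) :
    qhAdmissible Ω x y (fun t => γ (t - c)) (a + c) (b + c) ∧
      qhLength Ω (fun t => γ (t - c)) (a + c) (b + c) = qhLength Ω γ a b := by
  obtain ⟨hab, hx, hy, hm, K, hK⟩ := h
  refine ⟨⟨by linarith, by simpa using hx, by simpa using hy, fun t ht => ?_, K, ?_⟩, ?_⟩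
  · exact hm _ ⟨by linarith [ht.1], by linarith [ht.2]⟩
  · have h1 : LipschitzWith 1 (fun t : ℝ => t - c) := LipschitzWith.of_dist_le_mul (by simp)
    have := hK.comp (h1.lipschitzOnWith (s := Icc (a + c) (b + c)))
      (fun t ht => ⟨by linarith [ht.1], by linarith [ht.2]⟩)
    simpa [Function.comp_def] using this
  · unfold qhLength
    simp only [deriv_comp_sub_const]
    rw [intervalIntegral.integral_comp_sub_right (fun t => ‖deriv γ t‖ / infDist (γ t) Ωᶜ)]
    simp

theorem qhAdmissible.trans (hΩ : IsOpen Ω) (hne : Ω ≠ univ) {γ' : ℝ → ℂ} {c d : ℝ}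
    (h : qhAdmissible Ω x y γ a b) (h' : qhAdmissible Ω y z γ' c d) :
    ∃ σ, qhAdmissible Ω x z σ a (b + (d - c)) ∧
      qhLength Ω σ a (b + (d - c)) = qhLength Ω γ a b + qhLength Ω γ' c d := by
  obtain ⟨h2, hl⟩ := h'.shift (b - c)
  generalize (fun t => γ' (t - (b - c))) = τ at h2 hl
  rw [add_sub_cancel, show d + (b - c) = b + (d - c) by ring] at h2 hl
  rw [← hl]
  generalize b + (d - c) = e at h2 hl
  obtain ⟨hab, hx, hy, hm, K, hK⟩ := h
  obtain ⟨hbe, hy', hz, hm', K', hK'⟩ := h2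
  set σ : ℝ → ℂ := fun t => if t ≤ b then γ t else τ t with hσ
  have hσ1 : ∀ t, t ≤ b → σ t = γ t := fun t ht => if_pos ht
  have hσ2 : ∀ t, b ≤ t → σ t = τ t := by
    intro t ht
    rcases ht.eq_or_lt with rfl | h3
    · rw [hσ1 _ le_rfl, hy, hy']
    · exact if_neg (not_le.2 h3)
  have hL1 : ∀ s ∈ Icc a b, ∀ t ∈ Icc a b, dist (σ s) (σ t) ≤ K * dist s t := by
    intro s hs t ht
    rw [hσ1 s hs.2, hσ1 t ht.2]
    exact hK.dist_le_mul s hs t ht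
  have hL2 : ∀ s ∈ Icc b e, ∀ t ∈ Icc b e, dist (σ s) (σ t) ≤ K' * dist s t := by
    intro s hs t ht
    rw [hσ2 s hs.1, hσ2 t ht.1]
    exact hK'.dist_le_mul s hs t ht
  have hkey : ∀ s ∈ Icc a e, ∀ t ∈ Icc a e, s ≤ t →
      dist (σ s) (σ t) ≤ (K + K' : ℝ≥0) * dist s t := by
    intro s hs t ht hst
    have hK0 := K.coe_nonneg
    have hK0' := K'.coe_nonneg
    rw [NNReal.coe_add]
    rcases le_total t b with h3 | h3
    · refine (hL1 s ⟨hs.1, hst.trans h3⟩ t ⟨ht.1, h3⟩).trans ?_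
      gcongr; linarith
    rcases le_total b s with h4 | h4
    · refine (hL2 s ⟨h4, hs.2⟩ t ⟨h3, ht.2⟩).trans ?_
      gcongr; linarith
    have h5 := hL1 s ⟨hs.1, h4⟩ b ⟨hab, le_rfl⟩
    have h6 := hL2 b ⟨le_rfl, hbe⟩ t ⟨h3, ht.2⟩
    have h7 := dist_triangle (σ s) (σ b) (σ t)
    rw [Real.dist_eq, abs_sub_comm, abs_of_nonneg (by linarith)] at h5 h6 ⊢
    nlinarith
  have hadm : qhAdmissible Ω x z σ a e := by
    refine ⟨hab.trans hbe, by rw [hσ1 a hab, hx], by rw [hσ2 e hbe, hz], fun t ht => ?_,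
      K + K', LipschitzOnWith.of_dist_le_mul fun s hs t ht => ?_⟩
    · rcases le_total t b with h3 | h3
      · rw [hσ1 t h3]; exact hm t ⟨ht.1, h3⟩
      · rw [hσ2 t h3]; exact hm' t ⟨h3, ht.2⟩
    · rcases le_total s t with h3 | h3
      · exact hkey s hs t ht h3
      · rw [dist_comm, dist_comm s]
        exact hkey t ht s hs h3
  refine ⟨σ, hadm, ?_⟩
  rw [← qhLength_add hΩ hne hadm ⟨hab, hbe⟩]
  congr 1
  · refine intervalIntegral.integral_congr_Ioo_of_le hab fun t ht => ?_
    have h8 : σ =ᶠ[𝓝 t] γ := by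
      filter_upwards [Iio_mem_nhds ht.2] with s hs
      exact hσ1 s (le_of_lt hs)
    simp only [h8.deriv_eq, h8.eq_of_nhds]
  · refine intervalIntegral.integral_congr_Ioo_of_le hbe fun t ht => ?_
    have h8 : σ =ᶠ[𝓝 t] τ := by
      filter_upwards [Ioi_mem_nhds ht.1] with s hs
      exact hσ2 s (le_of_lt hs)
    simp only [h8.deriv_eq, h8.eq_of_nhds]

theorem qhAdmissible.lower_bound (hΩ : IsOpen Ω) (hne : Ω ≠ univ)
    (h : qhAdmissible Ω x y γ a b) :
    Real.log (1 + ‖x - y‖ / infDist x Ωᶜ) ≤ qhLength Ω γ a b := by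
  have hLi := h.intervalIntegrable hΩ hne
  obtain ⟨hab, hx, hy, hm, K, hK⟩ := h
  have hxΩ : x ∈ Ω := hx ▸ hm a (left_mem_Icc.2 hab)
  set δ := infDist x Ωᶜ with hδ
  have hδ0 : 0 < δ := infDist_compl_pos hΩ hne hxΩ
  set v : ℝ → ℝ := fun t => ‖γ t - x‖ with hv
  have hvv : ∀ s t, |v s - v t| ≤ ‖γ s - γ t‖ := by
    intro s t
    have := abs_norm_sub_norm_le (γ s - x) (γ t - x)
    simpa using this
  have hvL : LipschitzOnWith K v (Icc a b) := LipschitzOnWith.of_dist_le_mul fun s hs t ht => by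
    rw [Real.dist_eq]
    refine (hvv s t).trans ?_
    rw [← dist_eq_norm]
    exact hK.dist_le_mul s hs t ht
  have hv0 : ∀ t, 0 ≤ v t := fun t => norm_nonneg _
  set u : ℝ → ℝ := fun t => Real.log (δ + v t) with hu
  have huL : LipschitzOnWith (K / δ.toNNReal) u (uIcc a b) := by
    rw [uIcc_of_le hab]
    refine LipschitzOnWith.of_dist_le_mul fun s hs t ht => ?_
    have hkey : ∀ s t, u s - u t ≤ |v s - v t| / δ := by
      intro s t
      have h1 : 0 < δ + v s := by linarith [hv0 s]
      have h2 : 0 < δ + v t := by linarith [hv0 t]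
      rw [hu]; simp only
      rw [← Real.log_div h1.ne' h2.ne']
      refine (Real.log_le_sub_one_of_pos (by positivity)).trans ?_
      rw [div_sub_one h2.ne']
      have h3 : δ + v s - (δ + v t) ≤ |v s - v t| := by
        rw [add_sub_add_left_eq_sub]; exact le_abs_self _
      calc _ ≤ |v s - v t| / (δ + v t) := by gcongr
        _ ≤ _ := by gcongr; linarith [hv0 t]
    have h4 := hvL.dist_le_mul s hs t ht
    rw [Real.dist_eq] at h4
    have hcoe : ((K / δ.toNNReal : ℝ≥0) : ℝ) = K / δ := by
      rw [NNReal.coe_div, Real.coe_toNNReal _ hδ0.le]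
    rw [hcoe, div_mul_eq_mul_div, Real.dist_eq, abs_sub_le_iff]
    constructor
    · exact (hkey s t).trans (by gcongr)
    · exact (hkey t s).trans (by rw [abs_sub_comm]; gcongr)
  have hac := huL.absolutelyContinuousOnInterval
  have hdu : ∀ᵐ t ∂volume.restrict (Icc a b), deriv u t ≤ ‖deriv γ t‖ / infDist (γ t) Ωᶜ := by
    have e1 := hK.ae_differentiableWithinAt_real measurableSet_Icc
    have e2 := hvL.ae_differentiableWithinAt_real measurableSet_Icc
    rw [restrict_Ioo_eq_restrict_Icc.symm] at e1 e2 ⊢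
    filter_upwards [e1, e2, ae_restrict_mem measurableSet_Ioo] with t h1 h2 ht
    have hn : Icc a b ∈ 𝓝 t := Icc_mem_nhds ht.1 ht.2
    have h1' := (h1.differentiableAt hn).hasDerivAt
    have h2' := (h2.differentiableAt hn).hasDerivAt
    have h3 : deriv v t ≤ ‖deriv γ t‖ := by
      have l1 := (hasDerivAt_iff_tendsto_slope.1 h1').norm
      have l2 := (hasDerivAt_iff_tendsto_slope.1 h2').norm
      refine (le_abs_self _).trans (le_of_tendsto_of_tendsto l2 l1 (Eventually.of_forall ?_))
      intro s
      simp only [slope, vsub_eq_sub, norm_smul]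
      gcongr
      exact hvv s t
    have hpos : 0 < δ + v t := by linarith [hv0 t]
    have h4 : HasDerivAt u (deriv v t / (δ + v t)) t := (h2'.const_add δ).log hpos.ne'
    rw [h4.deriv]
    have hδt := infDist_compl_pos hΩ hne (hm t (Ioo_subset_Icc_self ht))
    have h5 : infDist (γ t) Ωᶜ ≤ δ + v t := by
      have := (abs_sub_le_iff.1 (abs_infDist_sub_le (Ω := Ω) (γ t) x)).1
      linarith
    calc _ ≤ ‖deriv γ t‖ / (δ + v t) := by gcongr
      _ ≤ _ := by gcongr
  have hmono := intervalIntegral.integral_mono_ae_restrict hab hac.intervalIntegrable_deriv hLi hdu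
  rw [hac.integral_deriv_eq_sub] at hmono
  refine le_trans (le_of_eq ?_) hmono
  simp only [hu, hv, hx, hy]
  rw [sub_self, norm_zero, add_zero, ← Real.log_div (by positivity) (by positivity), add_div,
    div_self hδ0.ne', norm_sub_rev]

end

/-- Proper open planar sets in which any two points are joined by an admissible path. -/
structure IsQHDomain (Ω : Set ℂ) : Prop where
  isOpen : IsOpen Ω
  ne_univ : Ω ≠ univ
  joined : ∀ x ∈ Ω, ∀ y ∈ Ω, ∃ γ a b, qhAdmissible Ω x y γ a b

section
variable {Ω : Set ℂ} {x y z : ℂ} {γ : ℝ → ℂ} {a b : ℝ}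

theorem qhAdmissible_segment (h : ‖x - y‖ < infDist x Ωᶜ) :
    qhAdmissible Ω x y (fun t => x + t * (y - x)) 0 1 ∧
      qhLength Ω (fun t => x + t * (y - x)) 0 1 ≤ ‖x - y‖ / (infDist x Ωᶜ - ‖x - y‖) := by
  have hmem : ∀ t ∈ Icc (0 : ℝ) 1, ‖x - (x + t * (y - x))‖ ≤ ‖x - y‖ := by
    intro t ht
    have : x - (x + t * (y - x)) = t * (x - y) := by ring
    rw [this, norm_mul, Complex.norm_real, Real.norm_of_nonneg ht.1]
    nlinarith [ht.2, norm_nonneg (x - y)]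
  have hder : ∀ t : ℝ, HasDerivAt (fun t : ℝ => x + t * (y - x)) (y - x) t := by
    intro t
    simpa using ((Complex.ofRealCLM.hasDerivAt (x := t)).mul_const (y - x)).const_add x
  refine ⟨⟨zero_le_one, by simp, by simp, fun t ht =>
    mem_of_norm_sub_lt_infDist ((hmem t ht).trans_lt h), ‖y - x‖₊, ?_⟩, ?_⟩
  · refine LipschitzOnWith.of_dist_le_mul fun s _ t _ => ?_
    rw [dist_eq_norm, Real.dist_eq]
    have : x + s * (y - x) - (x + t * (y - x)) = ((s - t : ℝ) : ℂ) * (y - x) := by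
      push_cast; ring
    rw [this, norm_mul, Complex.norm_real, Real.norm_eq_abs, coe_nnnorm, mul_comm]
  · have hb := intervalIntegral.norm_integral_le_of_norm_le_const (a := 0) (b := 1)
      (f := fun t : ℝ => ‖deriv (fun t : ℝ => x + t * (y - x)) t‖ /
        infDist (x + t * (y - x)) Ωᶜ) (C := ‖x - y‖ / (infDist x Ωᶜ - ‖x - y‖)) (by
      intro t ht
      rw [uIoc_of_le zero_le_one] at ht
      rw [(hder t).deriv, Real.norm_of_nonneg (div_nonneg (norm_nonneg _) infDist_nonneg),
        norm_sub_rev y x]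
      have h1 := hmem t ⟨ht.1.le, ht.2⟩
      have h2 := (abs_sub_le_iff.1 (abs_infDist_sub_le (Ω := Ω) x (x + t * (y - x)))).1
      have h3 : 0 < infDist x Ωᶜ - ‖x - y‖ := by linarith
      gcongr
      linarith)
    have h4 : qhLength Ω (fun t => x + t * (y - x)) 0 1 ≤
      ‖x - y‖ / (infDist x Ωᶜ - ‖x - y‖) * |(1 : ℝ) - 0| := (le_abs_self _).trans hb
    simpa using h4

theorem IsPreconnected.isQHDomain (hc : IsPreconnected Ω) (hΩ : IsOpen Ω) (hne : Ω ≠ univ) :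
    IsQHDomain Ω := by
  refine ⟨hΩ, hne, fun x hx y hy => ?_⟩
  refine hc.induction₂ (fun x y => ∃ γ a b, qhAdmissible Ω x y γ a b) ?_ ?_ ?_ hx hy
  · intro x hx
    refine mem_nhdsWithin_of_mem_nhds ?_
    filter_upwards [ball_mem_nhds x (infDist_compl_pos hΩ hne hx)] with y hy
    rw [mem_ball, dist_comm, dist_eq_norm] at hy
    exact ⟨_, _, _, (qhAdmissible_segment hy).1⟩
  · rintro x y z - - - ⟨γ, a, b, h⟩ ⟨γ', c, d, h'⟩
    obtain ⟨σ, hσ, -⟩ := h.trans hΩ hne h'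
    exact ⟨_, _, _, hσ⟩
  · rintro x y - - ⟨γ, a, b, h⟩
    exact ⟨_, _, _, h.symm.1⟩

theorem qhDist_comm (x y : ℂ) : qhDist Ω x y = qhDist Ω y x := by
  unfold qhDist
  congr 1
  ext L
  constructor <;>
  · rintro ⟨γ, a, b, h, rfl⟩
    exact ⟨_, _, _, h.symm.1, h.symm.2.symm⟩

namespace IsQHDomain

theorem infDist_pos (hΩ : IsQHDomain Ω) (hx : x ∈ Ω) : 0 < infDist x Ωᶜ :=
  infDist_compl_pos hΩ.isOpen hΩ.ne_univ hx

theorem exists_lt (hΩ : IsQHDomain Ω) (hx : x ∈ Ω) (hy : y ∈ Ω) {c : ℝ} (h : qhDist Ω x y < c) :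
    ∃ γ a b, qhAdmissible Ω x y γ a b ∧ qhLength Ω γ a b < c := by
  obtain ⟨γ, a, b, hadm⟩ := hΩ.joined x hx y hy
  obtain ⟨L, ⟨γ, a, b, h1, rfl⟩, h2⟩ := exists_lt_of_csInf_lt
    (s := { L : ℝ | ∃ γ a b, qhAdmissible Ω x y γ a b ∧ L = qhLength Ω γ a b })
    ⟨_, γ, a, b, hadm, rfl⟩ h
  exact ⟨γ, a, b, h1, h2⟩

theorem triangle (hΩ : IsQHDomain Ω) (hx : x ∈ Ω) (hy : y ∈ Ω) (hz : z ∈ Ω) :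
    qhDist Ω x z ≤ qhDist Ω x y + qhDist Ω y z := by
  refine le_of_forall_pos_le_add fun ε hε => ?_
  obtain ⟨γ, a, b, h1, h2⟩ := hΩ.exists_lt hx hy (lt_add_of_pos_right _ (half_pos hε))
  obtain ⟨γ', c, d, h1', h2'⟩ := hΩ.exists_lt hy hz (lt_add_of_pos_right _ (half_pos hε))
  obtain ⟨σ, h3, h4⟩ := h1.trans hΩ.isOpen hΩ.ne_univ h1'
  have := qhDist_le h3
  linarith

theorem log_le (hΩ : IsQHDomain Ω) (hx : x ∈ Ω) (hy : y ∈ Ω) :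
    Real.log (1 + ‖x - y‖ / infDist x Ωᶜ) ≤ qhDist Ω x y := by
  refine le_of_forall_gt fun c hc => ?_
  obtain ⟨γ, a, b, h1, h2⟩ := hΩ.exists_lt hx hy hc
  exact (h1.lower_bound hΩ.isOpen hΩ.ne_univ).trans_lt h2

theorem norm_sub_le (hΩ : IsQHDomain Ω) (hx : x ∈ Ω) (hy : y ∈ Ω) :
    ‖x - y‖ ≤ infDist x Ωᶜ * (Real.exp (qhDist Ω x y) - 1) := by
  have hδ := hΩ.infDist_pos hx
  have h := hΩ.log_le hx hy
  rw [Real.log_le_iff_le_exp (by positivity)] at h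
  have h1 : ‖x - y‖ / infDist x Ωᶜ ≤ Real.exp (qhDist Ω x y) - 1 := by linarith
  rwa [div_le_iff₀ hδ, mul_comm] at h1

theorem infDist_le (hΩ : IsQHDomain Ω) (hx : x ∈ Ω) (hy : y ∈ Ω) :
    infDist x Ωᶜ ≤ infDist y Ωᶜ * Real.exp (qhDist Ω x y) := by
  have h := hΩ.norm_sub_le hy hx
  rw [qhDist_comm] at h
  have h2 := (abs_sub_le_iff.1 (abs_infDist_sub_le (Ω := Ω) x y)).1
  rw [norm_sub_rev] at h2
  linarith

theorem eq_of_qhDist_le_zero (hΩ : IsQHDomain Ω) (hx : x ∈ Ω) (hy : y ∈ Ω)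
    (h : qhDist Ω x y ≤ 0) : x = y := by
  have h1 := hΩ.norm_sub_le hx hy
  rw [le_antisymm h qhDist_nonneg, Real.exp_zero, sub_self, mul_zero] at h1
  exact sub_eq_zero.1 (norm_le_zero_iff.1 h1)

theorem qhDist_le_of_norm_sub_lt (h : ‖x - y‖ < infDist x Ωᶜ) :
    qhDist Ω x y ≤ ‖x - y‖ / (infDist x Ωᶜ - ‖x - y‖) :=
  (qhDist_le (qhAdmissible_segment h).1).trans (qhAdmissible_segment h).2

theorem qhDist_self (hΩ : IsQHDomain Ω) (hx : x ∈ Ω) : qhDist Ω x x = 0 := by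
  refine le_antisymm ?_ qhDist_nonneg
  simpa using qhDist_le_of_norm_sub_lt (x := x) (y := x) (by simpa using hΩ.infDist_pos hx)

theorem tendsto_qhDist_self (hΩ : IsQHDomain Ω) (hx : x ∈ Ω) :
    Tendsto (fun y => qhDist Ω x y) (𝓝 x) (𝓝 0) := by
  have hδ := hΩ.infDist_pos hx
  have hc : Tendsto (fun y => ‖x - y‖ / (infDist x Ωᶜ - ‖x - y‖)) (𝓝 x) (𝓝 0) := by
    have h1 : ContinuousAt (fun y => ‖x - y‖ / (infDist x Ωᶜ - ‖x - y‖)) x := by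
      refine ContinuousAt.div (by fun_prop) (by fun_prop) ?_
      simpa using hδ.ne'
    simpa using h1.tendsto
  refine tendsto_of_tendsto_of_tendsto_of_le_of_le' tendsto_const_nhds hc
    (Eventually.of_forall fun _ => qhDist_nonneg) ?_
  filter_upwards [ball_mem_nhds x hδ] with y hy
  rw [mem_ball, dist_comm, dist_eq_norm] at hy
  exact qhDist_le_of_norm_sub_lt hy

theorem abs_sub_le (hΩ : IsQHDomain Ω) {x' y' : ℂ} (hx : x ∈ Ω) (hy : y ∈ Ω) (hx' : x' ∈ Ω)
    (hy' : y' ∈ Ω) : |qhDist Ω x' y' - qhDist Ω x y| ≤ qhDist Ω x x' + qhDist Ω y y' := by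
  have h1 := hΩ.triangle hx' hx hy'
  have h2 := hΩ.triangle hx hy hy'
  have h3 := hΩ.triangle hx hx' hy
  have h4 := hΩ.triangle hx' hy' hy
  rw [abs_sub_le_iff]
  have := qhDist_comm (Ω := Ω) x x'
  have := qhDist_comm (Ω := Ω) y y'
  constructor <;> linarith

theorem tendsto_qhDist (hΩ : IsQHDomain Ω) {ι : Type*} {φ : Filter ι} {u v : ι → ℂ}
    (hx : x ∈ Ω) (hy : y ∈ Ω) (hu : Tendsto u φ (𝓝 x)) (hv : Tendsto v φ (𝓝 y)) :
    Tendsto (fun i => qhDist Ω (u i) (v i)) φ (𝓝 (qhDist Ω x y)) := by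
  rw [tendsto_iff_dist_tendsto_zero]
  have h0 : Tendsto (fun i => qhDist Ω x (u i) + qhDist Ω y (v i)) φ (𝓝 0) := by
    simpa using ((hΩ.tendsto_qhDist_self hx).comp hu).add ((hΩ.tendsto_qhDist_self hy).comp hv)
  refine tendsto_of_tendsto_of_tendsto_of_le_of_le' tendsto_const_nhds h0
    (Eventually.of_forall fun _ => dist_nonneg) ?_
  filter_upwards [hu (hΩ.isOpen.mem_nhds hx), hv (hΩ.isOpen.mem_nhds hy)] with i h1 h2
  exact hΩ.abs_sub_le hx hy h1 h2

theorem continuousOn_qhDist (hΩ : IsQHDomain Ω) (hx : x ∈ Ω) :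
    ContinuousOn (fun y => qhDist Ω x y) Ω := fun _ hy =>
  (hΩ.tendsto_qhDist hx hy tendsto_const_nhds tendsto_id).mono_left nhdsWithin_le_nhds

theorem isCompact_closedBall (hΩ : IsQHDomain Ω) (hx : x ∈ Ω) (R : ℝ) :
    IsCompact {y | y ∈ Ω ∧ qhDist Ω x y ≤ R} := by
  have hδ := hΩ.infDist_pos hx
  set A : Set ℂ := closedBall x (infDist x Ωᶜ * (Real.exp R - 1)) ∩
    {y | infDist x Ωᶜ * Real.exp (-R) ≤ infDist y Ωᶜ} with hA
  have hAc : IsCompact A := (ProperSpace.isCompact_closedBall x _).inter_right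
    (isClosed_le continuous_const (continuous_infDist_pt _))
  have hAΩ : A ⊆ Ω := by
    rintro y ⟨-, hy⟩
    by_contra hyn
    rw [mem_ofPred_eq, infDist_zero_of_mem (mem_compl hyn)] at hy
    have : 0 < infDist x Ωᶜ * Real.exp (-R) := by positivity
    linarith
  have heq : {y | y ∈ Ω ∧ qhDist Ω x y ≤ R} = A ∩ (fun y => qhDist Ω x y) ⁻¹' Iic R := by
    ext y
    constructor
    · rintro ⟨hy, hyR⟩
      refine ⟨⟨?_, ?_⟩, hyR⟩
      · rw [mem_closedBall, dist_comm, dist_eq_norm]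
        refine (hΩ.norm_sub_le hx hy).trans ?_
        gcongr
      · have h1 := hΩ.infDist_le hx hy
        rw [mem_ofPred_eq, Real.exp_neg, ← div_eq_mul_inv, div_le_iff₀ (Real.exp_pos _)]
        refine h1.trans ?_
        have := infDist_nonneg (x := y) (s := Ωᶜ)
        gcongr
    · rintro ⟨hy, hyR⟩
      exact ⟨hAΩ hy, hyR⟩
  rw [heq]
  exact hAc.of_isClosed_subset (((hΩ.continuousOn_qhDist hx).mono hAΩ).preimage_isClosed_of_isClosed
    hAc.isClosed isClosed_Iic) inter_subset_left

/-- Almost geodesic parametrizations. -/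
theorem exists_almost_geodesic (hΩ : IsQHDomain Ω) (hx : x ∈ Ω) (hy : y ∈ Ω)
    {ε : ℝ} (hε : 0 < ε) :
    ∃ γ : ℝ → ℂ, γ 0 = x ∧ γ (qhDist Ω x y) = y ∧
      ∀ s ∈ Icc 0 (qhDist Ω x y), γ s ∈ Ω ∧ ∀ t ∈ Icc 0 (qhDist Ω x y),
        |qhDist Ω (γ s) (γ t) - (|s - t|)| ≤ ε := by
  set L := qhDist Ω x y with hL
  rcases (qhDist_nonneg : 0 ≤ L).eq_or_lt with hL0 | hL0
  · have hxy : x = y := hΩ.eq_of_qhDist_le_zero hx hy hL0.ge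
    refine ⟨fun _ => x, rfl, hxy, fun s hs => ⟨hx, fun t ht => ?_⟩⟩
    rw [hL, ← hL0, Icc_self, mem_singleton_iff] at hs ht
    simp [hs, ht, hΩ.qhDist_self hx, hε.le]
  obtain ⟨σ, a, b, hadm, hlen⟩ := hΩ.exists_lt hx hy (lt_add_of_pos_right L hε)
  have hLle := qhDist_le hadm
  set ℓ := qhLength Ω σ a b with hℓ
  have hab := hadm.1
  have hψc : ContinuousOn (fun t => qhLength Ω σ a t) (Icc a b) := by
    have := intervalIntegral.continuousOn_primitive_interval (μ := volume) (a := a) (b := b)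
      (f := fun t => ‖deriv σ t‖ / infDist (σ t) Ωᶜ)
      (by rw [uIcc_of_le hab]; exact hadm.integrableOn hΩ.isOpen hΩ.ne_univ)
    rwa [uIcc_of_le hab] at this
  have hψa : qhLength Ω σ a a = 0 := by simp [qhLength]
  have hivt : ∀ s, ∃ t, s ∈ Icc 0 L → t ∈ Icc a b ∧ qhLength Ω σ a t = s * (ℓ / L) := by
    intro s
    by_cases hs : s ∈ Icc 0 L
    · have hmem : s * (ℓ / L) ∈ Icc (qhLength Ω σ a a) (qhLength Ω σ a b) := by
        have h1 : 0 ≤ ℓ := hL0.le.trans hLle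
        rw [hψa]
        refine ⟨mul_nonneg hs.1 (by positivity), ?_⟩
        calc s * (ℓ / L) ≤ L * (ℓ / L) := by gcongr; exact hs.2
          _ = ℓ := mul_div_cancel₀ _ hL0.ne'
      obtain ⟨t, ht, hts⟩ := intermediate_value_Icc hab hψc hmem
      exact ⟨t, fun _ => ⟨ht, hts⟩⟩
    · exact ⟨0, fun h => absurd h hs⟩
  choose τ hτ using hivt
  have hψd : ∀ s ∈ Icc a b, ∀ t ∈ Icc a b,
      qhDist Ω (σ s) (σ t) ≤ |qhLength Ω σ a s - qhLength Ω σ a t| := by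
    have key : ∀ s ∈ Icc a b, ∀ t ∈ Icc a b, s ≤ t →
      qhDist Ω (σ s) (σ t) ≤ |qhLength Ω σ a s - qhLength Ω σ a t| := by
      intro s hs t ht hst
      have h1 := hadm.mono (left_mem_Icc.2 hab) ht ht.1
      have h2 := qhLength_add hΩ.isOpen hΩ.ne_univ h1 ⟨hs.1, hst⟩
      refine (qhDist_le (hadm.mono hs ht hst)).trans ?_
      rw [← h2, abs_sub_comm]
      simpa using le_abs_self _
    intro s hs t ht
    rcases le_total s t with h | h
    · exact key s hs t ht h
    · rw [qhDist_comm, abs_sub_comm]; exact key t ht s hs h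
  have hr : 1 ≤ ℓ / L := (one_le_div hL0).2 hLle
  have hLr : L * (ℓ / L) = ℓ := mul_div_cancel₀ _ hL0.ne'
  have hm := hadm.2.2.2.1
  have hup : ∀ s ∈ Icc 0 L, ∀ t ∈ Icc 0 L, qhDist Ω (σ (τ s)) (σ (τ t)) ≤ |s - t| * (ℓ / L) := by
    intro s hs t ht
    refine (hψd _ (hτ s hs).1 _ (hτ t ht).1).trans ?_
    rw [(hτ s hs).2, (hτ t ht).2, ← sub_mul, abs_mul, abs_of_pos (by linarith : 0 < ℓ / L)]
  have h0 : σ (τ 0) = x := by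
    have h0m : (0 : ℝ) ∈ Icc 0 L := ⟨le_rfl, hL0.le⟩
    have h1 := hψd _ (left_mem_Icc.2 hab) _ (hτ 0 h0m).1
    rw [(hτ 0 h0m).2, hψa, hadm.2.1, zero_mul, sub_self, abs_zero] at h1
    exact (hΩ.eq_of_qhDist_le_zero hx (hm _ (hτ 0 h0m).1) h1).symm
  have h1 : σ (τ L) = y := by
    have hLm : L ∈ Icc 0 L := ⟨hL0.le, le_rfl⟩
    have h1 := hψd _ (right_mem_Icc.2 hab) _ (hτ L hLm).1
    rw [(hτ L hLm).2, hLr, hadm.2.2.1, hℓ, sub_self, abs_zero] at h1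
    exact (hΩ.eq_of_qhDist_le_zero hy (hm _ (hτ L hLm).1) h1).symm
  refine ⟨fun s => σ (τ s), h0, h1, fun s hs => ⟨hm _ (hτ s hs).1, ?_⟩⟩
  have hmain : ∀ s ∈ Icc 0 L, ∀ t ∈ Icc 0 L, s ≤ t →
      |qhDist Ω (σ (τ s)) (σ (τ t)) - (|s - t|)| ≤ ε := by
    intro s hs t ht hst
    have hLm : L ∈ Icc 0 L := ⟨hL0.le, le_rfl⟩
    have h0m : (0 : ℝ) ∈ Icc 0 L := ⟨le_rfl, hL0.le⟩
    have u1 := hup s hs t ht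
    have u2 := hup 0 h0m s hs
    have u3 := hup t ht L hLm
    rw [h0] at u2
    rw [h1] at u3
    have hsΩ := hm _ (hτ s hs).1
    have htΩ := hm _ (hτ t ht).1
    have t1 := hΩ.triangle hx hsΩ hy
    have t2 := hΩ.triangle hsΩ htΩ hy
    have a1 : |s - t| = t - s := by rw [abs_sub_comm, abs_of_nonneg (by linarith)]
    have a2 : |0 - s| = s := by rw [abs_sub_comm, abs_of_nonneg (by linarith [hs.1])]; ring
    have a3 : |t - L| = L - t := by rw [abs_sub_comm, abs_of_nonneg (by linarith [ht.2])]
    rw [a1] at u1 ⊢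
    rw [a2] at u2
    rw [a3] at u3
    have hr' : L * (ℓ / L - 1) ≤ ε := by rw [mul_sub, hLr]; linarith
    have hb1 : (t - s) * (ℓ / L - 1) ≤ L * (ℓ / L - 1) := by
      have := hs.1; have := ht.2
      gcongr
      linarith
    have hb2 : (s + (L - t)) * (ℓ / L - 1) ≤ L * (ℓ / L - 1) := by
      gcongr
      linarith
    rw [abs_sub_le_iff]
    constructor <;> nlinarith
  intro t ht
  rcases le_total s t with h | h
  · exact hmain s hs t ht h
  · have := hmain t ht s hs h
    rwa [qhDist_comm, abs_sub_comm t s] at this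

/-- Any two points are joined by a quasihyperbolic geodesic. -/
theorem exists_geodesic (hΩ : IsQHDomain Ω) (hx : x ∈ Ω) (hy : y ∈ Ω) :
    ∃ γ : ℝ → ℂ, IsQHGeodesicOn Ω γ (Icc 0 (qhDist Ω x y)) ∧ γ 0 = x ∧
      γ (qhDist Ω x y) = y := by
  set L := qhDist Ω x y with hL
  have hL0 : 0 ≤ L := qhDist_nonneg
  choose Γ hΓ0 hΓL hΓ using fun n : ℕ =>
    hΩ.exists_almost_geodesic hx hy (Nat.one_div_pos_of_nat (α := ℝ) (n := n))
  have h0m : (0 : ℝ) ∈ Icc 0 L := ⟨le_rfl, hL0⟩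
  have hLm : L ∈ Icc 0 L := ⟨hL0, le_rfl⟩
  have hlim : ∀ s, ∃ w, s ∈ Icc 0 L → w ∈ Ω ∧
      Tendsto (fun n => Γ n s) (hyperfilter ℕ : Filter ℕ) (𝓝 w) := by
    intro s
    by_cases hs : s ∈ Icc 0 L
    · obtain ⟨w, hw, hw'⟩ := (hΩ.isCompact_closedBall hx (L + 1)).ultrafilter_le_nhds
        ((hyperfilter ℕ).map fun n => Γ n s) (by
          rw [le_principal_iff]
          refine Filter.mem_map.2 (univ_mem' fun n => ?_)
          refine ⟨(hΓ n s hs).1, ?_⟩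
          have h1 := (abs_sub_le_iff.1 ((hΓ n 0 h0m).2 s hs)).1
          rw [hΓ0, abs_sub_comm, sub_zero, abs_of_nonneg hs.1] at h1
          have h2 : (1 : ℝ) / (n + 1) ≤ 1 := by
            rw [div_le_one (by positivity)]; linarith [Nat.cast_nonneg (α := ℝ) n]
          linarith [hs.2])
      exact ⟨w, fun _ => ⟨hw.1, hw'⟩⟩
    · exact ⟨0, fun h => absurd h hs⟩
  choose γ hγ using hlim
  refine ⟨γ, ⟨fun t ht => (hγ t ht).1, fun s hs t ht => ?_⟩, ?_, ?_⟩
  · have h1 := hΩ.tendsto_qhDist (hγ s hs).1 (hγ t ht).1 (hγ s hs).2 (hγ t ht).2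
    refine tendsto_nhds_unique h1 ?_
    rw [tendsto_iff_dist_tendsto_zero]
    refine tendsto_of_tendsto_of_tendsto_of_le_of_le tendsto_const_nhds
      (tendsto_one_div_add_atTop_nhds_zero_nat.mono_left Nat.hyperfilter_le_atTop)
      (fun _ => dist_nonneg) fun n => (hΓ n s hs).2 t ht
  · have := (hγ 0 h0m).2
    simp only [hΓ0] at this
    exact tendsto_nhds_unique tendsto_const_nhds this |>.symm
  · have := (hγ L hLm).2
    have hΓL' : ∀ n, Γ n L = y := hΓL
    simp only [hΓL'] at this
    exact tendsto_nhds_unique tendsto_const_nhds this |>.symm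

theorem continuousOn_geodesic (hΩ : IsQHDomain Ω) {S : Set ℝ} (hγ : IsQHGeodesicOn Ω γ S) :
    ContinuousOn γ S := by
  intro t ht
  have hδ := hΩ.infDist_pos (hγ.1 t ht)
  rw [ContinuousWithinAt, tendsto_iff_dist_tendsto_zero]
  have h1 : Tendsto (fun s => infDist (γ t) Ωᶜ * (Real.exp |t - s| - 1)) (𝓝[S] t) (𝓝 0) := by
    have : ContinuousAt (fun s => infDist (γ t) Ωᶜ * (Real.exp |t - s| - 1)) t := by fun_prop
    have h2 := this.tendsto
    simp only [sub_self, abs_zero, Real.exp_zero, mul_zero] at h2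
    exact h2.mono_left nhdsWithin_le_nhds
  refine tendsto_of_tendsto_of_tendsto_of_le_of_le' tendsto_const_nhds h1
    (Eventually.of_forall fun _ => dist_nonneg) ?_
  filter_upwards [self_mem_nhdsWithin] with s hs
  rw [dist_comm, dist_eq_norm]
  refine (hΩ.norm_sub_le (hγ.1 t ht) (hγ.1 s hs)).trans_eq ?_
  rw [hγ.2 t ht s hs]

end IsQHDomain

theorem IsQHGeodesicOn.mono {S T : Set ℝ} (h : IsQHGeodesicOn Ω γ T) (hST : S ⊆ T) :
    IsQHGeodesicOn Ω γ S :=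
  ⟨fun t ht => h.1 t (hST ht), fun s hs t ht => h.2 s (hST hs) t (hST ht)⟩

theorem IsQHGeodesicOn.shift (h : IsQHGeodesicOn Ω γ (Icc a b)) :
    IsQHGeodesicOn Ω (fun t => γ (t + a)) (Icc 0 (b - a)) := by
  have hm : ∀ t ∈ Icc 0 (b - a), t + a ∈ Icc a b := fun t ht =>
    ⟨by linarith [ht.1], by linarith [ht.2]⟩
  refine ⟨fun t ht => h.1 _ (hm t ht), fun s hs t ht => ?_⟩
  rw [h.2 _ (hm s hs) _ (hm t ht)]
  congr 1; ring

theorem IsQHGeodesicOn.reverse (h : IsQHGeodesicOn Ω γ (Icc a b)) :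
    IsQHGeodesicOn Ω (fun t => γ (b - t)) (Icc 0 (b - a)) := by
  have hm : ∀ t ∈ Icc 0 (b - a), b - t ∈ Icc a b := fun t ht =>
    ⟨by linarith [ht.2], by linarith [ht.1]⟩
  refine ⟨fun t ht => h.1 _ (hm t ht), fun s hs t ht => ?_⟩
  rw [h.2 _ (hm s hs) _ (hm t ht), abs_sub_comm]
  congr 1; ring

end

/-- A domain together with a biholomorphism `f` from the unit disc with inverse `g`. -/
structure IsRiemannPair (Ω : Set ℂ) (f g : ℂ → ℂ) : Prop extends IsQHDomain Ω where
  diff_f : DifferentiableOn ℂ f (ball 0 1)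
  diff_g : DifferentiableOn ℂ g Ω
  maps_f : MapsTo f (ball 0 1) Ω
  maps_g : MapsTo g Ω (ball 0 1)
  left_inv : LeftInvOn g f (ball 0 1)
  right_inv : LeftInvOn f g Ω

section
variable {Ω : Set ℂ} {f g : ℂ → ℂ} {x y z : ℂ}

theorem IsRiemannPair.qhDist_zero_le (h : IsRiemannPair Ω f g) (hz : ‖z‖ < 1) :
    qhDist Ω (f 0) (f z) ≤ 640 * -Real.log (1 - ‖z‖) := by
  have hmem : ∀ t ∈ Icc (0 : ℝ) 1, ‖(t : ℂ) * z‖ ≤ ‖z‖ ∧ ‖(t : ℂ) * z‖ = t * ‖z‖ := by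
    intro t ht
    have : ‖(t : ℂ) * z‖ = t * ‖z‖ := by
      rw [norm_mul, Complex.norm_real, Real.norm_of_nonneg ht.1]
    exact ⟨by rw [this]; nlinarith [ht.2, norm_nonneg z], this⟩
  have hb : ∀ t ∈ Icc (0 : ℝ) 1, (t : ℂ) * z ∈ ball (0 : ℂ) 1 := fun t ht =>
    mem_ball_zero_iff.2 ((hmem t ht).1.trans_lt hz)
  have hder : ∀ t ∈ Icc (0 : ℝ) 1,
      HasDerivAt (fun t : ℝ => f (t * z)) (deriv f (t * z) * z) t := by
    intro t ht
    have h1 := (h.diff_f.differentiableAt (isOpen_ball.mem_nhds (hb t ht))).hasDerivAt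
    have h2 : HasDerivAt (fun t : ℝ => (t : ℂ) * z) z t := by
      simpa using (Complex.ofRealCLM.hasDerivAt (x := t)).mul_const z
    exact h1.comp t h2
  have hadm : qhAdmissible Ω (f 0) (f z) (fun t : ℝ => f (t * z)) 0 1 := by
    refine ⟨zero_le_one, by simp, by simp, fun t ht => h.maps_f (hb t ht), ?_⟩
    have hcont : ContinuousOn (fun w => ‖deriv f w‖₊) (closedBall 0 ‖z‖) :=
      ((h.diff_f.deriv isOpen_ball).continuousOn.mono (closedBall_subset_ball hz)).nnnorm
    obtain ⟨w, -, hw⟩ := (isCompact_closedBall (0 : ℂ) ‖z‖).exists_isMaxOn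
      (nonempty_closedBall.2 (norm_nonneg z)) hcont
    refine ⟨‖deriv f w‖₊ * ‖z‖₊, (convex_Icc 0 1).lipschitzOnWith_of_nnnorm_deriv_le
      (fun t ht => (hder t ht).differentiableAt) fun t ht => ?_⟩
    rw [(hder t ht).deriv, nnnorm_mul]
    gcongr
    exact hw (mem_closedBall_zero_iff.2 (hmem t ht).1)
  refine (qhDist_le hadm).trans ?_
  have hpos : ∀ t ∈ Icc (0 : ℝ) 1, 0 < 1 - t * ‖z‖ := by
    intro t ht
    have := (hmem t ht).1
    rw [(hmem t ht).2] at this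
    linarith
  have hprim : ∀ t ∈ Icc (0 : ℝ) 1, HasDerivAt (fun t => 640 * -Real.log (1 - t * ‖z‖))
      (640 * (‖z‖ / (1 - t * ‖z‖))) t := by
    intro t ht
    have h1 : HasDerivAt (fun t => 1 - t * ‖z‖) (-‖z‖) t := by
      simpa using ((hasDerivAt_id t).mul_const ‖z‖).const_sub 1
    refine ((h1.log (hpos t ht).ne').neg.const_mul 640).congr_deriv ?_
    ring
  have hci : IntervalIntegrable (fun t => 640 * (‖z‖ / (1 - t * ‖z‖))) volume 0 1 := by
    refine ContinuousOn.intervalIntegrable_of_Icc zero_le_one ?_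
    exact continuousOn_const.mul (continuousOn_const.div (by fun_prop) fun t ht => (hpos t ht).ne')
  have hle : qhLength Ω (fun t : ℝ => f (t * z)) 0 1 ≤
      ∫ t in (0 : ℝ)..1, 640 * (‖z‖ / (1 - t * ‖z‖)) := by
    refine intervalIntegral.integral_mono_on zero_le_one
      (hadm.intervalIntegrable h.isOpen h.ne_univ) hci fun t ht => ?_
    have hδ := h.infDist_pos (h.maps_f (hb t ht))
    have hK := norm_deriv_mul_le_infDist (f := f) (R := 1 - t * ‖z‖) (z := t * z) (hpos t ht) h.isOpen
      h.ne_univ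
    have hsub : ball (t * z) (1 - t * ‖z‖) ⊆ ball (0 : ℂ) 1 := by
      refine ball_subset_ball' ?_
      rw [dist_zero_right, (hmem t ht).2]
      linarith
    have hK' := hK (h.diff_f.mono hsub) (h.maps_f.mono_left hsub) (h.left_inv.injOn.mono hsub)
    rw [(hder t ht).deriv, norm_mul, div_le_iff₀ hδ]
    have h3 := hpos t ht
    have h4 : ‖deriv f (t * z)‖ ≤ 640 * infDist (f (t * z)) Ωᶜ / (1 - t * ‖z‖) := by
      rw [le_div_iff₀ h3]; exact hK'
    calc _ ≤ 640 * infDist (f (t * z)) Ωᶜ / (1 - t * ‖z‖) * ‖z‖ := by gcongr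
      _ = _ := by ring
  refine hle.trans (le_of_eq ?_)
  rw [intervalIntegral.integral_eq_sub_of_hasDerivAt (fun t ht => hprim t (by
    rwa [uIcc_of_le zero_le_one] at ht)) hci]
  simp

theorem IsRiemannPair.one_sub_norm_le (h : IsRiemannPair Ω f g) (hx : x ∈ Ω) :
    1 - ‖g x‖ ≤ Real.exp (-(qhDist Ω (f 0) x / 640)) := by
  have h1 := mem_ball_zero_iff.1 (h.maps_g hx)
  have h2 := h.qhDist_zero_le h1
  rw [h.right_inv hx] at h2
  rw [← Real.log_le_iff_le_exp (by linarith)]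
  linarith

theorem IsRiemannPair.norm_sub_le_of_qhDist_le (h : IsRiemannPair Ω f g) (hx : x ∈ Ω) (hy : y ∈ Ω)
    (hxy : qhDist Ω x y ≤ 1 / 4) : ‖g x - g y‖ ≤ 2 * (1 - ‖g x‖) := by
  have hδ := h.infDist_pos hx
  have hexp : Real.exp (1 / 4) ≤ 3 / 2 := by
    have h1 := Real.exp_bound_div_one_sub_of_interval (x := 1 / 4) (by norm_num) (by norm_num)
    linarith
  have hd : ‖x - y‖ ≤ infDist x Ωᶜ / 2 := by
    refine (h.norm_sub_le hx hy).trans ?_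
    have : Real.exp (qhDist Ω x y) ≤ 3 / 2 := (Real.exp_le_exp.2 hxy).trans hexp
    nlinarith
  have ha := mem_ball_zero_iff.1 (h.maps_g hx)
  have hb := mem_ball_zero_iff.1 (h.maps_g hy)
  have hsub : ball x (infDist x Ωᶜ) ⊆ Ω := fun w hw => by
    rw [mem_ball, dist_comm, dist_eq_norm] at hw
    exact mem_of_norm_sub_lt_infDist hw
  have hS := Complex.dist_le_div_mul_dist_of_mapsTo_ball (f := discMoebius (g x) ∘ g) (c := x)
    (z := y) (R₁ := infDist x Ωᶜ) (R₂ := 1) (by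
      intro w hw
      exact ((hasDerivAt_discMoebius ha (mem_ball_zero_iff.1 (h.maps_g (hsub hw)))).comp w
        (h.diff_g.differentiableAt
          (h.isOpen.mem_nhds (hsub hw))).hasDerivAt).differentiableAt.differentiableWithinAt) (by
      intro w hw
      rw [Function.comp_apply, discMoebius_self]
      exact mem_closedBall_zero_iff.2
        (norm_discMoebius_lt_one ha (mem_ball_zero_iff.1 (h.maps_g (hsub hw)))).le) (by
      rw [mem_ball, dist_comm, dist_eq_norm]; linarith)
  rw [Function.comp_apply, Function.comp_apply, discMoebius_self, dist_zero_right, dist_comm,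
    dist_eq_norm, discMoebius, norm_div, one_div, inv_mul_eq_div] at hS
  have h2 : ‖x - y‖ / infDist x Ωᶜ ≤ 1 / 2 := by rw [div_le_iff₀ hδ]; linarith
  have h3 := hS.trans h2
  rw [div_le_iff₀ (norm_pos_iff.2 (one_sub_conj_mul_ne_zero ha hb))] at h3
  have h4 : 1 - (starRingEnd ℂ) (g x) * g y =
      ((1 - ‖g x‖ ^ 2 : ℝ) : ℂ) - (starRingEnd ℂ) (g x) * (g y - g x) := by
    push_cast
    rw [← Complex.conj_mul']
    ring
  have h5 : ‖1 - (starRingEnd ℂ) (g x) * g y‖ ≤ (1 - ‖g x‖ ^ 2) + ‖g y - g x‖ := by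
    rw [h4]
    refine (norm_sub_le _ _).trans ?_
    rw [Complex.norm_real, Real.norm_of_nonneg (by nlinarith [norm_nonneg (g x)]), norm_mul,
      RCLike.norm_conj]
    nlinarith [norm_nonneg (g y - g x)]
  rw [norm_sub_rev]
  nlinarith [norm_nonneg (g x)]

theorem norm_sub_le_of_exp_decay {σ : ℝ → ℂ} {A c L : ℝ} (hA : 0 ≤ A) (hc : 0 < c) (hL : 0 ≤ L)
    (h : ∀ s ∈ Icc 0 L, ∀ t ∈ Icc 0 L, s ≤ t → t ≤ s + 1 / 4 →
      ‖σ s - σ t‖ ≤ A * Real.exp (-(c * s))) :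
    ‖σ 0 - σ L‖ ≤ A / (1 - Real.exp (-(c / 4))) := by
  set q := Real.exp (-(c / 4)) with hq
  have hq0 : 0 < q := Real.exp_pos _
  have hq1 : 0 < 1 - q := by
    have : q < 1 := by
      rw [hq, ← Real.exp_zero]; exact Real.exp_lt_exp.2 (by linarith)
    linarith
  have key : ∀ n : ℕ, ∀ s ∈ Icc 0 L, L - s ≤ n / 4 →
      ‖σ s - σ L‖ ≤ A * Real.exp (-(c * s)) / (1 - q) := by
    intro n
    induction n with
    | zero =>
      intro s hs hn
      have : s = L := le_antisymm hs.2 (by simpa using hn)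
      rw [this, sub_self, norm_zero]
      positivity
    | succ n ih =>
      intro s hs hn
      rcases le_total L (s + 1 / 4) with h1 | h1
      · refine (h s hs L ⟨hL, le_rfl⟩ hs.2 h1).trans ?_
        rw [le_div_iff₀ hq1]
        exact mul_le_of_le_one_right (by positivity) (by linarith)
      · have hs' : s + 1 / 4 ∈ Icc 0 L := ⟨by linarith [hs.1], h1⟩
        have i1 := ih (s + 1 / 4) hs' (by push_cast at hn; linarith)
        have i2 := h s hs _ hs' (by linarith) le_rfl
        have i3 : Real.exp (-(c * (s + 1 / 4))) = Real.exp (-(c * s)) * q := by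
          rw [hq, ← Real.exp_add]; congr 1; ring
        rw [i3] at i1
        calc _ ≤ ‖σ s - σ (s + 1 / 4)‖ + ‖σ (s + 1 / 4) - σ L‖ := norm_sub_le_norm_sub_add_norm_sub _ _ _
          _ ≤ _ := add_le_add i2 i1
          _ = _ := by field_simp; ring
  obtain ⟨n, hn⟩ := exists_nat_ge (4 * L)
  have := key n 0 ⟨le_rfl, hL⟩ (by linarith)
  simpa using this

/-- Geodesics which stay far from the base point have preimages with close endpoints. -/
theorem IsRiemannPair.exists_shape_bound (h : IsRiemannPair Ω f g) :
    ∃ C : ℝ, ∀ (R T : ℝ) (γ : ℝ → ℂ), 0 ≤ T → IsQHGeodesicOn Ω γ (Icc 0 T) →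
      (∀ t ∈ Icc 0 T, R ≤ qhDist Ω (f 0) (γ t)) →
      ‖g (γ 0) - g (γ T)‖ ≤ C * Real.exp (-(R / 1280)) := by
  refine ⟨2 * (2 / (1 - Real.exp (-(1 / 2560 / 4)))), fun R T γ hT hγ hR => ?_⟩
  have ho : f 0 ∈ Ω := h.maps_f (mem_ball_self one_pos)
  have hcont : ContinuousOn (fun t => qhDist Ω (f 0) (γ t)) (Icc 0 T) :=
    (h.continuousOn_qhDist ho).comp (h.continuousOn_geodesic hγ) hγ.1
  obtain ⟨t₀, ht₀, hmin⟩ := isCompact_Icc.exists_isMinOn (nonempty_Icc.2 hT) hcont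
  have hρ : ∀ t ∈ Icc 0 T, R / 2 + |t - t₀| / 4 ≤ qhDist Ω (f 0) (γ t) := by
    intro t ht
    have h1 : qhDist Ω (f 0) (γ t₀) ≤ qhDist Ω (f 0) (γ t) := hmin ht
    have h2 := h.triangle (hγ.1 t ht) ho (hγ.1 t₀ ht₀)
    rw [hγ.2 t ht t₀ ht₀, qhDist_comm (γ t)] at h2
    linarith [hR t ht]
  have hstep : ∀ s ∈ Icc 0 T, ∀ t ∈ Icc 0 T, |s - t| ≤ 1 / 4 →
      ‖g (γ s) - g (γ t)‖ ≤ 2 * Real.exp (-(R / 1280)) * Real.exp (-(1 / 2560 * |s - t₀|)) := by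
    intro s hs t ht hst
    refine (h.norm_sub_le_of_qhDist_le (hγ.1 s hs) (hγ.1 t ht)
      (by rw [hγ.2 s hs t ht]; exact hst)).trans ?_
    rw [mul_assoc, ← Real.exp_add]
    refine mul_le_mul_of_nonneg_left ((h.one_sub_norm_le (hγ.1 s hs)).trans ?_) two_pos.le
    rw [Real.exp_le_exp]
    linarith [hρ s hs]
  have e1 := norm_sub_le_of_exp_decay (σ := fun t => g (γ (t₀ + t)))
    (A := 2 * Real.exp (-(R / 1280))) (c := 1 / 2560) (L := T - t₀) (by positivity) (by norm_num)
    (by linarith [ht₀.2]) (by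
      intro s hs t ht hst hst'
      have := hstep (t₀ + s) ⟨by linarith [hs.1, ht₀.1], by linarith [hs.2]⟩
        (t₀ + t) ⟨by linarith [ht.1, ht₀.1], by linarith [ht.2]⟩
        (by rw [abs_sub_comm, abs_of_nonneg] <;> linarith)
      rwa [add_sub_cancel_left, abs_of_nonneg hs.1] at this)
  have e2 := norm_sub_le_of_exp_decay (σ := fun t => g (γ (t₀ - t)))
    (A := 2 * Real.exp (-(R / 1280))) (c := 1 / 2560) (L := t₀) (by positivity) (by norm_num)
    ht₀.1 (by
      intro s hs t ht hst hst'
      have := hstep (t₀ - s) ⟨by linarith [hs.2], by linarith [hs.1, ht₀.2]⟩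
        (t₀ - t) ⟨by linarith [ht.2], by linarith [ht.1, ht₀.2]⟩
        (by rw [abs_of_nonneg] <;> linarith)
      rwa [sub_sub_cancel_left, abs_neg, abs_of_nonneg hs.1] at this)
  simp only [add_zero, add_sub_cancel, sub_zero, sub_self] at e1 e2
  rw [norm_sub_rev] at e2
  calc _ ≤ ‖g (γ 0) - g (γ t₀)‖ + ‖g (γ t₀) - g (γ T)‖ := norm_sub_le_norm_sub_add_norm_sub _ _ _
    _ ≤ _ := add_le_add e2 e1
    _ = _ := by ring

end

section
variable {Ω : Set ℂ} {f g : ℂ → ℂ}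

theorem IsRiemannPair.tendsto_norm {ι : Type*} {l : Filter ι} (h : IsRiemannPair Ω f g)
    {x : ι → ℂ} (hx : ∀ i, x i ∈ Ω) (hl : Tendsto (fun i => qhDist Ω (f 0) (x i)) l atTop) :
    Tendsto (fun i => ‖g (x i)‖) l (𝓝 1) := by
  have h1 : Tendsto (fun i => 1 - Real.exp (-(qhDist Ω (f 0) (x i) / 640))) l (𝓝 (1 - 0)) := by
    refine Tendsto.const_sub 1 (Real.tendsto_exp_neg_atTop_nhds_zero.comp ?_)
    exact hl.atTop_div_const (by norm_num)
  rw [sub_zero] at h1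
  refine tendsto_of_tendsto_of_tendsto_of_le_of_le h1 tendsto_const_nhds (fun i => ?_) fun i => ?_
  · have := h.one_sub_norm_le (hx i)
    simp only; linarith
  · exact (mem_ball_zero_iff.1 (h.maps_g (hx i))).le

/-- If the Riemann map has boundary limits in the sphere then the domain is visible. -/
theorem IsRiemannPair.qhVisibilityDomain (h : IsRiemannPair Ω f g)
    (hlim : ∀ ξ : ℂ, ‖ξ‖ = 1 → ∃ P : OnePoint ℂ,
      Tendsto (fun z => (f z : OnePoint ℂ)) (𝓝[ball 0 1] ξ) (𝓝 P)) :
    QHVisibilityDomain Ω := by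
  intro p _ q _ hpq
  by_contra hcon
  push Not at hcon
  have h0 : f 0 ∈ Ω := h.maps_f (mem_ball_self one_pos)
  have hd : 0 < dist p q := dist_pos.2 hpq
  have hex : ∀ n : ℕ, ∃ (γ : ℝ → ℂ) (T : ℝ), 0 ≤ T ∧ IsQHGeodesicOn Ω γ (Icc 0 T) ∧
      dist (γ 0) p < dist p q / 4 / (n + 1) ∧ dist (γ T) q < dist p q / 4 / (n + 1) ∧
      ∀ t ∈ Icc 0 T, (n : ℝ) ≤ qhDist Ω (f 0) (γ t) := by
    intro n
    have hr : 0 < dist p q / 4 / (n + 1) := by positivity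
    have hr' : dist p q / 4 / (n + 1) ≤ dist p q / 4 := div_le_self (by positivity) (by
      have : (0 : ℝ) ≤ n := n.cast_nonneg
      linarith)
    obtain ⟨γ, T, hT, hγ, hU, hV, hK⟩ := hcon (ball p (dist p q / 4 / (n + 1)))
      (ball q (dist p q / 4 / (n + 1))) isOpen_ball isOpen_ball (mem_ball_self hr)
      (mem_ball_self hr) (by
        refine Disjoint.inter_eq ?_
        refine Disjoint.mono closure_ball_subset_closedBall closure_ball_subset_closedBall ?_
        exact closedBall_disjoint_closedBall (by linarith))
      _ (h.isCompact_closedBall h0 n) (fun y hy => hy.1)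
    refine ⟨γ, T, hT, hγ, hU, hV, fun t ht => ?_⟩
    by_contra hlt
    exact hK t ht ⟨hγ.1 t ht, (not_le.1 hlt).le⟩
  choose γ T hT hγ hU hV hK using hex
  obtain ⟨C, hC⟩ := h.exists_shape_bound
  have hmem0 : ∀ n, (0 : ℝ) ∈ Icc 0 (T n) := fun n => left_mem_Icc.2 (hT n)
  have hmemT : ∀ n, T n ∈ Icc 0 (T n) := fun n => right_mem_Icc.2 (hT n)
  have hto : Tendsto (fun n : ℕ => dist p q / 4 / ((n : ℝ) + 1)) atTop (𝓝 0) :=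
    Tendsto.div_atTop tendsto_const_nhds
      (tendsto_atTop_add_const_right _ _ tendsto_natCast_atTop_atTop)
  have hp : Tendsto (fun n => γ n 0) atTop (𝓝 p) :=
    tendsto_iff_dist_tendsto_zero.2 (squeeze_zero (fun _ => dist_nonneg) (fun n => (hU n).le) hto)
  have hq : Tendsto (fun n => γ n (T n)) atTop (𝓝 q) :=
    tendsto_iff_dist_tendsto_zero.2 (squeeze_zero (fun _ => dist_nonneg) (fun n => (hV n).le) hto)
  have hinf : Tendsto (fun n => qhDist Ω (f 0) (γ n 0)) atTop atTop :=
    tendsto_atTop_mono (fun n => hK n 0 (hmem0 n)) tendsto_natCast_atTop_atTop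
  have hnorm := h.tendsto_norm (fun n => (hγ n).1 0 (hmem0 n)) hinf
  have hdist : Tendsto (fun n => g (γ n 0) - g (γ n (T n))) atTop (𝓝 0) := by
    refine squeeze_zero_norm (fun n => hC n (T n) (γ n) (hT n) (hγ n) (hK n)) ?_
    have : Tendsto (fun n : ℕ => C * Real.exp (-((n : ℝ) / 1280))) atTop (𝓝 (C * 0)) :=
      (Real.tendsto_exp_neg_atTop_nhds_zero.comp
        (tendsto_natCast_atTop_atTop.atTop_div_const (by norm_num))).const_mul C
    simpa using this
  obtain ⟨ξ, -, φ, hφ, hξ⟩ := (isCompact_closedBall (0 : ℂ) 1).tendsto_subseq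
    (x := fun n => g (γ n 0)) fun n => ball_subset_closedBall (h.maps_g ((hγ n).1 0 (hmem0 n)))
  have hξ1 : ‖ξ‖ = 1 := tendsto_nhds_unique hξ.norm (hnorm.comp hφ.tendsto_atTop)
  have hξ' : Tendsto (fun n => g (γ (φ n) (T (φ n)))) atTop (𝓝 ξ) := by
    have := hξ.sub (hdist.comp hφ.tendsto_atTop)
    simpa [Function.comp_def] using this
  obtain ⟨P, hP⟩ := hlim ξ hξ1
  have key : ∀ (u : ℕ → ℂ) (a : ℂ), (∀ n, u n ∈ Ω) → Tendsto u atTop (𝓝 a) →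
      Tendsto (fun n => g (u n)) atTop (𝓝 ξ) → (a : OnePoint ℂ) = P := by
    intro u a hu ha hg
    refine tendsto_nhds_unique (OnePoint.continuous_coe.continuousAt.tendsto.comp ha) ?_
    have := hP.comp (tendsto_nhdsWithin_iff.2 ⟨hg, Eventually.of_forall fun n => h.maps_g (hu n)⟩)
    refine this.congr fun n => ?_
    simp [h.right_inv (hu n)]
  have e1 := key (fun n => γ (φ n) 0) p (fun n => (hγ _).1 0 (hmem0 _))
    (hp.comp hφ.tendsto_atTop) hξ
  have e2 := key (fun n => γ (φ n) (T (φ n))) q (fun n => (hγ _).1 _ (hmemT _))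
    (hq.comp hφ.tendsto_atTop) hξ'
  exact hpq (OnePoint.coe_injective (e1.trans e2.symm))

end

section
variable {Ω : Set ℂ} {f g : ℂ → ℂ}

theorem lintegral_norm_deriv_sq_le {S : Set ℂ} {H : ℂ → ℂ} {R : ℝ} (hS : IsOpen S)
    (hd : DifferentiableOn ℂ H S) (hi : InjOn H S) (hb : ∀ z ∈ S, ‖H z‖ ≤ R) :
    ∫⁻ z in S, ENNReal.ofReal (‖deriv H z‖ ^ 2) ≤ volume (closedBall (0 : ℂ) R) := by
  have hder : ∀ z ∈ S, HasFDerivWithinAt H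
      ((ContinuousLinearMap.toSpanSingleton ℂ (deriv H z)).restrictScalars ℝ) S z := by
    intro z hz
    have := (hd.differentiableAt (hS.mem_nhds hz)).hasDerivAt.hasFDerivAt
    exact (this.restrictScalars ℝ).hasFDerivWithinAt
  have := lintegral_abs_det_fderiv_eq_addHaar_image volume hS.measurableSet hder hi
  have hdet : ∀ c : ℂ,
      |((ContinuousLinearMap.toSpanSingleton ℂ c).restrictScalars ℝ).det| = ‖c‖ ^ 2 := by
    intro c
    simp [ContinuousLinearMap.det, LinearMap.det_restrictScalars, Algebra.norm_complex_apply,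
      Complex.normSq_eq_norm_sq]
  simp only [hdet] at this
  rw [this]
  refine measure_mono ?_
  rintro _ ⟨z, hz, rfl⟩
  exact mem_closedBall_zero_iff.2 (hb z hz)

/-- The strip `|Im ζ| < π / 2`. -/
def strip : Set ℂ := {ζ | |ζ.im| < Real.pi / 2}

theorem isOpen_strip : IsOpen strip :=
  isOpen_lt (Complex.continuous_im.abs) continuous_const

theorem mem_strip_iff {s θ : ℝ} :
    (s + θ * Complex.I : ℂ) ∈ strip ↔ θ ∈ Ioo (-(Real.pi / 2)) (Real.pi / 2) := by
  simp [strip, abs_lt]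

/-- The length-area principle: an injective bounded holomorphic function on a strip maps some
arbitrarily far vertical segment into a small disc. -/
theorem exists_short_crosscut {H : ℂ → ℂ} {R : ℝ} (hd : DifferentiableOn ℂ H strip)
    (hi : InjOn H strip) (hb : ∀ z ∈ strip, ‖H z‖ ≤ R) {ε : ℝ} (hε : 0 < ε) (s₀ : ℝ) :
    ∃ s < s₀, ∀ θ ∈ Ioo (-(Real.pi / 2)) (Real.pi / 2),
      ‖H (s + θ * Complex.I) - H (s : ℂ)‖ ≤ ε := by
  have hpi := Real.pi_pos
  set J := Ioo (-(Real.pi / 2)) (Real.pi / 2) with hJ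
  set F : ℂ → ℝ≥0∞ := strip.indicator fun z => ENNReal.ofReal (‖deriv H z‖ ^ 2) with hF
  have hdc : ContinuousOn (deriv H) strip := (hd.deriv isOpen_strip).continuousOn
  have hFm : Measurable F := by
    have : Measurable fun z => ENNReal.ofReal (‖deriv H z‖ ^ 2) :=
      ((measurable_deriv H).norm.pow_const 2).ennreal_ofReal
    exact this.indicator isOpen_strip.measurableSet
  have hFfin : ∫⁻ z, F z < ∞ := by
    rw [hF, lintegral_indicator isOpen_strip.measurableSet]
    exact (lintegral_norm_deriv_sq_le isOpen_strip hd hi hb).trans_lt measure_closedBall_lt_top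
  have hfub : ∫⁻ z, F z = ∫⁻ s : ℝ, ∫⁻ θ : ℝ, F (s + θ * Complex.I) := by
    rw [← (Complex.volume_preserving_equiv_real_prod.symm).lintegral_comp_emb
      Complex.measurableEquivRealProd.symm.measurableEmbedding, Measure.volume_eq_prod,
      lintegral_prod (fun p => F (Complex.measurableEquivRealProd.symm p))
        (hFm.comp Complex.measurableEquivRealProd.symm.measurable).aemeasurable]
    simp [Complex.measurableEquivRealProd_symm_apply, Complex.mk_eq_add_mul_I]
  set η := ε / (Real.pi + 1) with hη
  have hη0 : 0 < η := by positivity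
  obtain ⟨s, hs, hsA⟩ : ∃ s < s₀, ∫⁻ θ : ℝ, F (s + θ * Complex.I) < ENNReal.ofReal (η ^ 2) := by
    by_contra! hcon
    have h1 : ∫⁻ s in Iio s₀, ENNReal.ofReal (η ^ 2) ≤ ∫⁻ z, F z := by
      rw [hfub]
      refine le_trans ?_ (setLIntegral_le_lintegral (Iio s₀) _)
      exact setLIntegral_mono' measurableSet_Iio fun s hs => hcon s hs
    rw [setLIntegral_const, Real.volume_Iio, ENNReal.mul_top
      (by rw [Ne, ENNReal.ofReal_eq_zero, not_le]; positivity), top_le_iff] at h1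
    exact hFfin.ne h1
  refine ⟨s, hs, fun θ hθ => ?_⟩
  have hder : ∀ t ∈ J, HasDerivAt (fun t : ℝ => H (s + t * Complex.I))
      (deriv H (s + t * Complex.I) * Complex.I) t := by
    intro t ht
    have h1 := (hd.differentiableAt (isOpen_strip.mem_nhds
      (mem_strip_iff (s := s).2 ht))).hasDerivAt
    have h2 : HasDerivAt (fun t : ℝ => (s : ℂ) + t * Complex.I) Complex.I t := by
      simpa using ((Complex.ofRealCLM.hasDerivAt (x := t)).mul_const Complex.I).const_add (s : ℂ)
    exact h1.comp t h2
  have h0J : (0 : ℝ) ∈ J := ⟨by linarith, by linarith⟩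
  have hsub : uIcc 0 θ ⊆ J := ordConnected_Ioo.uIcc_subset h0J hθ
  have hline : ContinuousOn (fun t : ℝ => deriv H (s + t * Complex.I)) J := by
    refine hdc.comp (by fun_prop) fun t ht => mem_strip_iff.2 ht
  have hcont : ContinuousOn (fun t : ℝ => deriv H (s + t * Complex.I) * Complex.I) (uIcc 0 θ) :=
    (hline.mono hsub).mul continuousOn_const
  have hFTC := intervalIntegral.integral_eq_sub_of_hasDerivAt (fun t ht => hder t (hsub ht))
    hcont.intervalIntegrable
  simp only [Complex.ofReal_zero, zero_mul, add_zero] at hFTC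
  rw [← hFTC]
  refine (intervalIntegral.norm_integral_le_integral_norm_uIoc).trans ?_
  have huJ : uIoc 0 θ ⊆ J := uIoc_subset_uIcc.trans hsub
  have hint1 : IntegrableOn (fun t : ℝ => ‖deriv H (s + t * Complex.I) * Complex.I‖) (uIoc 0 θ) :=
    (hcont.norm.integrableOn_compact isCompact_uIcc).mono_set uIoc_subset_uIcc
  have hint2 : IntegrableOn (fun t : ℝ => ‖deriv H (s + t * Complex.I)‖ ^ 2) (uIoc 0 θ) :=
    (((hline.mono hsub).norm.pow 2).integrableOn_compact isCompact_uIcc).mono_set uIoc_subset_uIcc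
  have hvol : volume.real (uIoc 0 θ) ≤ Real.pi := by
    rw [measureReal_def, Real.volume_uIoc, sub_zero, ENNReal.toReal_ofReal (abs_nonneg _)]
    have := abs_lt.2 hθ
    linarith
  have hA : ∫ t in uIoc 0 θ, ‖deriv H (s + t * Complex.I)‖ ^ 2 ≤ η ^ 2 := by
    rw [integral_eq_lintegral_of_nonneg_ae (Eventually.of_forall fun t => by positivity)
      hint2.aestronglyMeasurable]
    refine ENNReal.toReal_le_of_le_ofReal (by positivity) (le_trans ?_ hsA.le)
    refine le_trans ?_ (setLIntegral_le_lintegral (uIoc 0 θ) _)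
    refine setLIntegral_mono' measurableSet_uIoc fun t ht => ?_
    rw [hF, indicator_of_mem (mem_strip_iff.2 (huJ ht))]
  have hconst : IntegrableOn (fun _ : ℝ => η) (uIoc 0 θ) :=
    integrableOn_const (by rw [Real.volume_uIoc]; exact ENNReal.ofReal_ne_top)
  calc ∫ t in uIoc 0 θ, ‖deriv H (s + t * Complex.I) * Complex.I‖
      ≤ ∫ t in uIoc 0 θ, (η + 1 / η * ‖deriv H (s + t * Complex.I)‖ ^ 2) := by
        refine setIntegral_mono hint1 (hconst.add (hint2.const_mul _)) fun t => ?_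
        simp only [norm_mul, Complex.norm_I, mul_one]
        set a := ‖deriv H (s + t * Complex.I)‖
        have : η + 1 / η * a ^ 2 - a = ((η - a) ^ 2 + η * a) / η := by field_simp; ring
        have h2 : 0 ≤ ((η - a) ^ 2 + η * a) / η := by
          have : 0 ≤ a := norm_nonneg _
          positivity
        linarith
    _ = volume.real (uIoc 0 θ) * η + 1 / η * ∫ t in uIoc 0 θ, ‖deriv H (s + t * Complex.I)‖ ^ 2 := by
        rw [integral_add hconst (hint2.const_mul _), setIntegral_const, integral_const_mul,
          smul_eq_mul]
    _ ≤ Real.pi * η + 1 / η * η ^ 2 := by gcongr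
    _ = ε := by rw [hη]; field_simp

/-- A Riemann map factors as a bounded holomorphic function followed by a continuous map to the
sphere. -/
theorem IsRiemannPair.exists_bounded_model (h : IsRiemannPair Ω f g) :
    ∃ (H : ℂ → ℂ) (Φ : ℂ → OnePoint ℂ) (R : ℝ), DifferentiableOn ℂ H (ball 0 1) ∧
      (∀ z ∈ ball (0 : ℂ) 1, ‖H z‖ ≤ R) ∧ Continuous Φ ∧
      ∀ z ∈ ball (0 : ℂ) 1, Φ (H z) = f z := by
  obtain ⟨a, ha⟩ := (ne_univ_iff_exists_notMem Ω).1 h.ne_univ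
  have hfa : ∀ z ∈ ball (0 : ℂ) 1, f z - a ≠ 0 := fun z hz h0 =>
    ha (by rw [← sub_eq_zero.1 h0]; exact h.maps_f hz)
  obtain ⟨L, hL⟩ := exists_log_on_ball (h.diff_f.sub_const a) hfa
  have hLd : DifferentiableOn ℂ L (ball 0 1) :=
    fun z hz => (hL z hz).1.differentiableAt.differentiableWithinAt
  set q : ℂ → ℂ := fun z => Complex.exp (L z / 2) with hq
  have hqd : DifferentiableOn ℂ q (ball 0 1) := (hLd.div_const 2).cexp
  have hq2 : ∀ z ∈ ball (0 : ℂ) 1, q z ^ 2 = f z - a := by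
    intro z hz
    rw [hq, ← (hL z hz).2, ← Complex.exp_nat_mul]
    congr 1
    push_cast
    ring
  have h0 : (0 : ℂ) ∈ ball (0 : ℂ) 1 := mem_ball_self one_pos
  have hb0 : q 0 ≠ 0 := Complex.exp_ne_zero _
  have hbpos : 0 < ‖q 0‖ := norm_pos_iff.2 hb0
  have hf0 : f 0 ∈ Ω := h.maps_f h0
  have hc1 : ContinuousAt (fun w => q (g w)) (f 0) := by
    have := hqd.continuousOn.comp h.diff_g.continuousOn h.maps_g
    exact this.continuousAt (h.isOpen.mem_nhds hf0)
  have hev : ∀ᶠ u in 𝓝 (-q 0), ‖q (g (u ^ 2 + a)) - q 0‖ < ‖q 0‖ := by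
    have h2 : Tendsto (fun u : ℂ => u ^ 2 + a) (𝓝 (-q 0)) (𝓝 (f 0)) := by
      have : (-q 0) ^ 2 + a = f 0 := by rw [neg_sq, hq2 0 h0]; ring
      rw [← this]
      exact (by fun_prop : Continuous fun u : ℂ => u ^ 2 + a).tendsto _
    have h3 := (hc1.tendsto.comp h2).sub_const (q 0)
    rw [h.left_inv h0, sub_self] at h3
    have h4 := h3.norm
    rw [norm_zero] at h4
    exact h4.eventually_lt_const hbpos
  obtain ⟨ε, hε, hball⟩ := Metric.eventually_nhds_iff.1 hev
  have hfar : ∀ z ∈ ball (0 : ℂ) 1, min ε ‖q 0‖ ≤ ‖q z + q 0‖ := by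
    intro z hz
    by_contra! hlt
    rw [lt_min_iff] at hlt
    have h1 := hball (y := q z) (by rw [dist_eq_norm, sub_neg_eq_add]; exact hlt.1)
    rw [hq2 z hz, sub_add_cancel, h.left_inv hz] at h1
    have h2 : ‖(q z + q 0) - (q z - q 0)‖ ≤ ‖q z + q 0‖ + ‖q z - q 0‖ := norm_sub_le _ _
    rw [show (q z + q 0) - (q z - q 0) = 2 * q 0 by ring, norm_mul, Complex.norm_ofNat] at h2
    linarith [hlt.2]
  have hmin : 0 < min ε ‖q 0‖ := lt_min hε hbpos
  have hne : ∀ z ∈ ball (0 : ℂ) 1, q z + q 0 ≠ 0 := fun z hz =>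
    norm_pos_iff.1 (hmin.trans_le (hfar z hz))
  classical
  refine ⟨fun z => (q z + q 0)⁻¹,
    fun w => if w = 0 then OnePoint.infty else (((w⁻¹ - q 0) ^ 2 + a : ℂ) : OnePoint ℂ),
    (min ε ‖q 0‖)⁻¹, (hqd.add_const _).inv hne, fun z hz => ?_, ?_, fun z hz => ?_⟩
  · rw [norm_inv]
    exact inv_anti₀ hmin (hfar z hz)
  · rw [continuous_iff_continuousAt]
    intro w
    rcases eq_or_ne w 0 with rfl | hw
    · rw [continuousAt_iff_punctured_nhds, if_pos rfl]
      have h1 : Tendsto (fun w : ℂ => (w⁻¹ - q 0) ^ 2 + a) (𝓝[≠] 0) (Bornology.cobounded ℂ) := by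
        have h2 : Tendsto (fun w : ℂ => w⁻¹) (𝓝[≠] 0) (Bornology.cobounded ℂ) :=
          tendsto_inv₀_nhdsNE_zero
        have hsub : Tendsto (fun w : ℂ => w⁻¹ - q 0) (𝓝[≠] 0) (Bornology.cobounded ℂ) := by
          refine tendsto_norm_atTop_iff_cobounded.1 ?_
          refine tendsto_atTop_mono (fun w => norm_sub_norm_le _ _) ?_
          exact tendsto_atTop_add_const_right _ _ (tendsto_norm_atTop_iff_cobounded.2 h2)
        refine tendsto_norm_atTop_iff_cobounded.1 ?_
        refine tendsto_atTop_mono (f := fun w : ℂ => ‖w⁻¹ - q 0‖ ^ 2 - ‖a‖) (fun w => ?_) ?_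
        · have := norm_sub_le ((w⁻¹ - q 0) ^ 2 + a) a
          rw [add_sub_cancel_right, norm_pow] at this
          linarith
        · refine tendsto_atTop_add_const_right _ _ ?_
          exact (tendsto_pow_atTop two_ne_zero).comp (tendsto_norm_atTop_iff_cobounded.2 hsub)
      have h3 : Tendsto (fun w : ℂ => (((w⁻¹ - q 0) ^ 2 + a : ℂ) : OnePoint ℂ)) (𝓝[≠] 0)
          (𝓝 OnePoint.infty) := by
        refine (OnePoint.tendsto_coe_infty (X := ℂ)).comp ?_
        rw [coclosedCompact_eq_cocompact, ← Metric.cobounded_eq_cocompact]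
        exact h1
      refine h3.congr' ?_
      filter_upwards [self_mem_nhdsWithin] with w hw
      rw [if_neg (by simpa using hw)]
    · have h1 : ContinuousAt (fun w : ℂ => (((w⁻¹ - q 0) ^ 2 + a : ℂ) : OnePoint ℂ)) w := by
        refine OnePoint.continuous_coe.continuousAt.comp (f := fun w : ℂ => (w⁻¹ - q 0) ^ 2 + a) ?_
        exact (((continuousAt_inv₀ hw).sub continuousAt_const).pow 2).add continuousAt_const
      refine h1.congr ?_
      filter_upwards [isOpen_ne.mem_nhds hw] with v hv
      rw [if_neg hv]
  · simp only [inv_eq_zero, if_neg (hne z hz), inv_inv, add_sub_cancel_right, hq2 z hz,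
      sub_add_cancel]

end

/-- The open right half-plane. -/
def rightHalfPlane : Set ℂ := {w | 0 < w.re}

theorem isOpen_rightHalfPlane : IsOpen rightHalfPlane :=
  isOpen_lt continuous_const Complex.continuous_re

/-- A domain together with a biholomorphism `F` from the right half-plane with inverse `G`. -/
structure IsHalfPlanePair (Ω : Set ℂ) (F G : ℂ → ℂ) : Prop extends IsQHDomain Ω where
  diff_F : DifferentiableOn ℂ F rightHalfPlane
  diff_G : DifferentiableOn ℂ G Ω
  maps_F : MapsTo F rightHalfPlane Ω
  maps_G : MapsTo G Ω rightHalfPlane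
  left_inv : LeftInvOn G F rightHalfPlane
  right_inv : LeftInvOn F G Ω

/-- The Cayley transform taking the right half-plane to the unit disc and `0` to `ξ`. -/
noncomputable def cayley (ξ w : ℂ) : ℂ := ξ * ((1 - w) / (1 + w))

/-- The inverse of `cayley`. -/
noncomputable def cayleyInv (ξ z : ℂ) : ℂ := (ξ - z) / (ξ + z)

section
variable {Ω : Set ℂ} {f g F G : ℂ → ℂ} {ξ w z : ℂ}

theorem one_add_ne_zero_of_mem (hw : w ∈ rightHalfPlane) : 1 + w ≠ 0 := by
  intro h
  have h1 := congrArg Complex.re h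
  have h2 : 0 < w.re := hw
  simp at h1
  linarith

theorem cayley_mem_ball (hξ : ‖ξ‖ = 1) (hw : w ∈ rightHalfPlane) : cayley ξ w ∈ ball (0 : ℂ) 1 := by
  have h0 := one_add_ne_zero_of_mem hw
  have h2 : 0 < w.re := hw
  rw [mem_ball_zero_iff, cayley, norm_mul, hξ, one_mul, norm_div,
    div_lt_one (norm_pos_iff.2 h0)]
  refine lt_of_pow_lt_pow_left₀ 2 (norm_nonneg _) ?_
  rw [← Complex.normSq_eq_norm_sq, ← Complex.normSq_eq_norm_sq, Complex.normSq_apply,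
    Complex.normSq_apply]
  simp
  nlinarith

theorem differentiableOn_cayley : DifferentiableOn ℂ (cayley ξ) rightHalfPlane := by
  refine (differentiableOn_const ξ).mul (DifferentiableOn.div (by fun_prop) (by fun_prop) ?_)
  exact fun w hw => one_add_ne_zero_of_mem hw

theorem add_ne_zero_of_mem_ball (hξ : ‖ξ‖ = 1) (hz : z ∈ ball (0 : ℂ) 1) : ξ + z ≠ 0 := by
  intro h
  rw [mem_ball_zero_iff, ← neg_eq_of_add_eq_zero_right h, norm_neg, hξ] at hz
  exact lt_irrefl _ hz

theorem cayleyInv_mem (hξ : ‖ξ‖ = 1) (hz : z ∈ ball (0 : ℂ) 1) :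
    cayleyInv ξ z ∈ rightHalfPlane := by
  have h0 := add_ne_zero_of_mem_ball hξ hz
  have hz' : ‖z‖ < 1 := mem_ball_zero_iff.1 hz
  change 0 < ((ξ - z) / (ξ + z)).re
  rw [Complex.div_re, ← add_div]
  refine div_pos ?_ (Complex.normSq_pos.2 h0)
  have h1 : Complex.normSq ξ = 1 := by rw [Complex.normSq_eq_norm_sq, hξ, one_pow]
  have h2 : Complex.normSq z < 1 := by
    rw [Complex.normSq_eq_norm_sq]
    exact pow_lt_one₀ (norm_nonneg _) hz' two_ne_zero
  rw [Complex.normSq_apply] at h1 h2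
  simp
  nlinarith

theorem cayley_cayleyInv (hξ : ‖ξ‖ = 1) (hz : z ∈ ball (0 : ℂ) 1) :
    cayley ξ (cayleyInv ξ z) = z := by
  have h0 := add_ne_zero_of_mem_ball hξ hz
  have h1 := one_add_ne_zero_of_mem (cayleyInv_mem hξ hz)
  have hξ0 : ξ ≠ 0 := by rw [← norm_pos_iff, hξ]; exact one_pos
  rw [cayleyInv] at h1
  rw [cayley, cayleyInv, mul_div_assoc', div_eq_iff h1]
  field_simp
  ring

theorem cayleyInv_cayley (hξ : ‖ξ‖ = 1) (hw : w ∈ rightHalfPlane) :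
    cayleyInv ξ (cayley ξ w) = w := by
  have h0 := one_add_ne_zero_of_mem hw
  have h1 := add_ne_zero_of_mem_ball hξ (cayley_mem_ball hξ hw)
  rw [cayleyInv, div_eq_iff h1, cayley]
  field_simp
  ring

theorem differentiableOn_cayleyInv (hξ : ‖ξ‖ = 1) :
    DifferentiableOn ℂ (cayleyInv ξ) (ball 0 1) := by
  refine DifferentiableOn.div (by fun_prop) (by fun_prop) ?_
  exact fun w hw => add_ne_zero_of_mem_ball hξ hw

theorem tendsto_cayleyInv (hξ : ‖ξ‖ = 1) :
    Tendsto (cayleyInv ξ) (𝓝[ball 0 1] ξ) (𝓝[rightHalfPlane] 0) := by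
  refine tendsto_nhdsWithin_iff.2 ⟨?_, ?_⟩
  · have hξ0 : ξ ≠ 0 := by rw [← norm_pos_iff, hξ]; exact one_pos
    have h1 : ContinuousAt (cayleyInv ξ) ξ := by
      refine ContinuousAt.div (by fun_prop) (by fun_prop) ?_
      rw [← two_mul]
      exact mul_ne_zero two_ne_zero hξ0
    have := h1.tendsto
    rw [cayleyInv, sub_self, zero_div] at this
    exact this.mono_left nhdsWithin_le_nhds
  · filter_upwards [self_mem_nhdsWithin] with z hz using cayleyInv_mem hξ hz

theorem tendsto_cayley : Tendsto (cayley ξ) (𝓝 0) (𝓝 ξ) := by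
  have h1 : ContinuousAt (cayley ξ) 0 := by
    refine continuousAt_const.mul (ContinuousAt.div (by fun_prop) (by fun_prop) (by simp))
  have := h1.tendsto
  simpa [cayley] using this

theorem IsRiemannPair.isHalfPlanePair (h : IsRiemannPair Ω f g) (hξ : ‖ξ‖ = 1) :
    IsHalfPlanePair Ω (fun w => f (cayley ξ w)) (fun z => cayleyInv ξ (g z)) where
  toIsQHDomain := h.toIsQHDomain
  diff_F := h.diff_f.comp differentiableOn_cayley fun w hw => cayley_mem_ball hξ hw
  diff_G := (differentiableOn_cayleyInv hξ).comp h.diff_g h.maps_g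
  maps_F := fun w hw => h.maps_f (cayley_mem_ball hξ hw)
  maps_G := fun z hz => cayleyInv_mem hξ (h.maps_g hz)
  left_inv := fun w hw => by
    simp only
    rw [h.left_inv (cayley_mem_ball hξ hw), cayleyInv_cayley hξ hw]
  right_inv := fun z hz => by
    simp only
    rw [cayley_cayleyInv hξ (h.maps_g hz), h.right_inv hz]

theorem exp_mem_rightHalfPlane (hw : w ∈ strip) : Complex.exp w ∈ rightHalfPlane := by
  change 0 < (Complex.exp w).re
  rw [Complex.exp_re]
  exact mul_pos (Real.exp_pos _) (Real.cos_pos_of_mem_Ioo (abs_lt.1 hw))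

theorem exp_injOn_strip : InjOn Complex.exp strip := by
  have hpi := Real.pi_pos
  have key : ∀ w ∈ strip, Complex.log (Complex.exp w) = w := by
    intro w hw
    have h := abs_lt.1 (show |w.im| < Real.pi / 2 from hw)
    exact Complex.log_exp (by linarith) (by linarith)
  intro w hw z hz h
  rw [← key w hw, h, key z hz]

theorem mem_frontier_coe_iff (hΩ : IsOpen Ω) {P : OnePoint ℂ} :
    P ∈ frontier ((↑) '' Ω : Set (OnePoint ℂ)) ↔
      P ∈ closure ((↑) '' Ω : Set (OnePoint ℂ)) ∧ P ∉ ((↑) '' Ω : Set (OnePoint ℂ)) := by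
  rw [(OnePoint.isOpenEmbedding_coe.isOpenMap Ω hΩ).frontier_eq]
  rfl

theorem IsHalfPlanePair.mem_frontier_of_tendsto {ι : Type*} {l : Filter ι} [l.NeBot]
    (h : IsHalfPlanePair Ω F G) {u : ι → ℂ} {P : OnePoint ℂ} (hu : ∀ i, u i ∈ rightHalfPlane)
    (h0 : Tendsto u l (𝓝 0)) (hP : Tendsto (fun i => (F (u i) : OnePoint ℂ)) l (𝓝 P)) :
    P ∈ frontier ((↑) '' Ω : Set (OnePoint ℂ)) := by
  rw [mem_frontier_coe_iff h.isOpen]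
  refine ⟨mem_closure_of_tendsto hP (Eventually.of_forall fun i =>
    mem_image_of_mem _ (h.maps_F (hu i))), ?_⟩
  rintro ⟨a, ha, rfl⟩
  have hc : Tendsto (fun i => F (u i)) l (𝓝 a) :=
    (OnePoint.isOpenEmbedding_coe.isEmbedding.tendsto_nhds_iff).2 hP
  have h1 := ((h.diff_G.continuousOn.continuousAt (h.isOpen.mem_nhds ha)).tendsto.comp hc)
  have h2 : G a = 0 := by
    refine tendsto_nhds_unique (h1.congr fun i => ?_) h0
    exact h.left_inv (hu i)
  have h3 : 0 < (G a).re := h.maps_G ha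
  rw [h2] at h3
  simp at h3

theorem exists_log_of_mem_rightHalfPlane {r : ℝ} (hw : w ∈ rightHalfPlane)
    (hr : ‖w‖ = Real.exp r) :
    ∃ θ ∈ Ioo (-(Real.pi / 2)) (Real.pi / 2), Complex.exp (r + θ * Complex.I) = w := by
  have hw' : 0 < w.re := hw
  have hw0 : w ≠ 0 := by rintro rfl; simp at hw'
  refine ⟨w.arg, abs_lt.1 (Complex.abs_arg_lt_pi_div_two_iff.2 (Or.inl hw')), ?_⟩
  have : Complex.log w = r + w.arg * Complex.I := by
    rw [Complex.log, hr, Real.log_exp]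
  rw [← this, Complex.exp_log hw0]

/-- Crosscuts: there is a boundary point near which the images of arbitrarily small half
circles are concentrated. -/
theorem IsRiemannPair.exists_crosscut (h : IsRiemannPair Ω f g) (hξ : ‖ξ‖ = 1) :
    ∃ P ∈ frontier ((↑) '' Ω : Set (OnePoint ℂ)), ∀ N ∈ 𝓝 P, ∀ r₀ > 0, ∃ r > 0, r < r₀ ∧
      ∀ w ∈ rightHalfPlane, ‖w‖ = r → (f (cayley ξ w) : OnePoint ℂ) ∈ N := by
  obtain ⟨H, Φ, R, hd, hb, hΦ, hΦH⟩ := h.exists_bounded_model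
  set K : ℂ → ℂ := fun ζ => H (cayley ξ (Complex.exp ζ)) with hK
  have hmap : ∀ ζ ∈ strip, cayley ξ (Complex.exp ζ) ∈ ball (0 : ℂ) 1 := fun ζ hζ =>
    cayley_mem_ball hξ (exp_mem_rightHalfPlane hζ)
  have hKd : DifferentiableOn ℂ K strip :=
    hd.comp (differentiableOn_cayley.comp Complex.differentiable_exp.differentiableOn
      fun ζ hζ => exp_mem_rightHalfPlane hζ) hmap
  have hKi : InjOn K strip := by
    intro ζ hζ ζ' hζ' he
    have h1 : f (cayley ξ (Complex.exp ζ)) = f (cayley ξ (Complex.exp ζ')) := by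
      apply OnePoint.coe_injective
      rw [← hΦH _ (hmap ζ hζ), ← hΦH _ (hmap ζ' hζ')]
      exact congrArg Φ he
    have h2 := h.left_inv.injOn (hmap ζ hζ) (hmap ζ' hζ') h1
    have h3 := congrArg (cayleyInv ξ) h2
    rw [cayleyInv_cayley hξ (exp_mem_rightHalfPlane hζ),
      cayleyInv_cayley hξ (exp_mem_rightHalfPlane hζ')] at h3
    exact exp_injOn_strip hζ hζ' h3
  have hKb : ∀ ζ ∈ strip, ‖K ζ‖ ≤ R := fun ζ hζ => hb _ (hmap ζ hζ)
  have hex : ∀ n : ℕ, ∃ s : ℝ, s < -(n : ℝ) ∧ ∀ θ ∈ Ioo (-(Real.pi / 2)) (Real.pi / 2),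
      ‖K (s + θ * Complex.I) - K (s : ℂ)‖ ≤ 1 / ((n : ℝ) + 1) := fun n =>
    exists_short_crosscut hKd hKi hKb (by positivity) _
  choose s hs hshort using hex
  have hreal : ∀ t : ℝ, (t : ℂ) ∈ strip := by
    intro t
    simp only [strip, mem_ofPred_eq, Complex.ofReal_im, abs_zero]
    positivity
  obtain ⟨h0, -, φ, hφ, hlim⟩ := (isCompact_closedBall (0 : ℂ) R).tendsto_subseq
    (x := fun n => K (s n)) fun n => mem_closedBall_zero_iff.2 (hKb _ (hreal _))
  have hcross : ∀ N ∈ 𝓝 (Φ h0), ∀ r₀ > 0, ∃ r > 0, r < r₀ ∧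
      ∀ w ∈ rightHalfPlane, ‖w‖ = r → (f (cayley ξ w) : OnePoint ℂ) ∈ N := by
    intro N hN r₀ hr₀
    obtain ⟨δ, hδ, hball⟩ := Metric.mem_nhds_iff.1 (hΦ.continuousAt hN)
    have e1 : ∀ᶠ n in atTop, dist (K (s (φ n))) h0 < δ / 2 :=
      hlim (ball_mem_nhds h0 (half_pos hδ))
    have e2 : ∀ᶠ n in atTop, 1 / (((φ n : ℕ) : ℝ) + 1) < δ / 2 :=
      (tendsto_one_div_add_atTop_nhds_zero_nat.comp hφ.tendsto_atTop).eventually_lt_const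
        (half_pos hδ)
    have e3 : ∀ᶠ n in atTop, -Real.log r₀ < ((φ n : ℕ) : ℝ) :=
      (tendsto_natCast_atTop_atTop.comp hφ.tendsto_atTop).eventually_gt_atTop _
    obtain ⟨n, h1, h2, h3⟩ := (e1.and (e2.and e3)).exists
    refine ⟨Real.exp (s (φ n)), Real.exp_pos _, ?_, fun w hw hwr => ?_⟩
    · rw [← Real.lt_log_iff_exp_lt hr₀]
      linarith [hs (φ n)]
    · obtain ⟨θ, hθ, rfl⟩ := exists_log_of_mem_rightHalfPlane hw hwr
      rw [← hΦH _ (hmap _ (mem_strip_iff.2 hθ))]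
      refine hball (mem_ball.2 ?_)
      have h4 := hshort (φ n) θ hθ
      rw [← dist_eq_norm] at h4
      have := dist_triangle (K (s (φ n) + θ * Complex.I)) (K (s (φ n))) h0
      exact lt_of_le_of_lt this (by linarith)
  have hT : Tendsto (fun n => Complex.exp (s (φ n) : ℂ)) atTop (𝓝 0) := by
    rw [tendsto_zero_iff_norm_tendsto_zero]
    simp only [Complex.norm_exp, Complex.ofReal_re]
    refine Real.tendsto_exp_atBot.comp ?_
    have : Tendsto (fun n : ℕ => -((n : ℕ) : ℝ)) atTop atBot :=
      tendsto_neg_atTop_atBot.comp tendsto_natCast_atTop_atTop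
    exact (tendsto_atBot_mono (fun n => (hs n).le) this).comp hφ.tendsto_atTop
  refine ⟨Φ h0, ?_, hcross⟩
  refine (h.isHalfPlanePair hξ).mem_frontier_of_tendsto
    (fun n => exp_mem_rightHalfPlane (hreal (s (φ n)))) hT ?_
  refine (hΦ.continuousAt.tendsto.comp hlim).congr fun n => ?_
  exact hΦH _ (hmap _ (hreal _))

theorem tendsto_of_cayley (hξ : ‖ξ‖ = 1)
    {P : OnePoint ℂ}
    (hP : Tendsto (fun w => (f (cayley ξ w) : OnePoint ℂ)) (𝓝[rightHalfPlane] 0) (𝓝 P)) :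
    Tendsto (fun z => (f z : OnePoint ℂ)) (𝓝[ball 0 1] ξ) (𝓝 P) := by
  refine (hP.comp (tendsto_cayleyInv hξ)).congr' ?_
  filter_upwards [self_mem_nhdsWithin] with z hz
  rw [Function.comp_apply, cayley_cayleyInv hξ hz]

end

/-- Some compact subset of `Ω` meets every quasihyperbolic geodesic from `A` to `B`. -/
def QHSeparated (Ω A B : Set ℂ) : Prop :=
  ∃ K, IsCompact K ∧ K ⊆ Ω ∧ ∀ (γ : ℝ → ℂ) (a b : ℝ), a ≤ b → IsQHGeodesicOn Ω γ (Icc a b) →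
    γ a ∈ A → γ b ∈ B → ∃ t ∈ Icc a b, γ t ∈ K

section
variable {Ω A A' B B' : Set ℂ} {f g F G : ℂ → ℂ} {ξ w z p x : ℂ}

theorem QHSeparated.mono (h : QHSeparated Ω A B) (hA : A' ⊆ A) (hB : B' ⊆ B) :
    QHSeparated Ω A' B' := by
  obtain ⟨K, hK, hKΩ, hm⟩ := h
  exact ⟨K, hK, hKΩ, fun γ a b hab hγ ha hb => hm γ a b hab hγ (hA ha) (hB hb)⟩

theorem QHSeparated.symm (h : QHSeparated Ω A B) : QHSeparated Ω B A := by
  obtain ⟨K, hK, hKΩ, hm⟩ := h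
  refine ⟨K, hK, hKΩ, fun γ a b hab hγ ha hb => ?_⟩
  obtain ⟨t, ht, htK⟩ := hm (fun t => γ (b - t)) 0 (b - a) (by linarith) hγ.reverse
    (by simpa using hb) (by simpa using ha)
  exact ⟨b - t, ⟨by linarith [ht.2], by linarith [ht.1]⟩, htK⟩

theorem QHSeparated.union_right (h : QHSeparated Ω A B) (h' : QHSeparated Ω A B') :
    QHSeparated Ω A (B ∪ B') := by
  obtain ⟨K, hK, hKΩ, hm⟩ := h
  obtain ⟨K', hK', hKΩ', hm'⟩ := h'
  refine ⟨K ∪ K', hK.union hK', union_subset hKΩ hKΩ', fun γ a b hab hγ ha hb => ?_⟩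
  rcases hb with hb | hb
  · obtain ⟨t, ht, htK⟩ := hm γ a b hab hγ ha hb
    exact ⟨t, ht, Or.inl htK⟩
  · obtain ⟨t, ht, htK⟩ := hm' γ a b hab hγ ha hb
    exact ⟨t, ht, Or.inr htK⟩

theorem qhSeparated_empty_right : QHSeparated Ω A ∅ :=
  ⟨∅, isCompact_empty, empty_subset _, fun _ _ _ _ _ _ h => h.elim⟩

/-- Points off the boundary have neighbourhoods that are separated from everything. -/
theorem exists_qhSeparated_of_notMem_frontier (hΩ : IsOpen Ω) (hx : x ∉ frontier Ω) :
    ∃ V ∈ 𝓝 x, ∀ A, QHSeparated Ω A V := by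
  by_cases hxΩ : x ∈ Ω
  · obtain ⟨K, hK, hxK, hKΩ⟩ := exists_compact_subset hΩ hxΩ
    exact ⟨K, mem_interior_iff_mem_nhds.1 hxK, fun A =>
      ⟨K, hK, hKΩ, fun γ a b hab _ _ hb => ⟨b, right_mem_Icc.2 hab, hb⟩⟩⟩
  · have hxc : x ∉ closure Ω := fun h => hx (by rw [hΩ.frontier_eq]; exact ⟨h, hxΩ⟩)
    refine ⟨(closure Ω)ᶜ, isClosed_closure.isOpen_compl.mem_nhds hxc, fun A =>
      ⟨∅, isCompact_empty, empty_subset _, fun γ a b hab hγ _ hb => ?_⟩⟩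
    exact (hb (subset_closure (hγ.1 b (right_mem_Icc.2 hab)))).elim

theorem QHVisibilityDomain.exists_nhds_qhSeparated_point (hv : QHVisibilityDomain Ω)
    (hΩ : IsOpen Ω) (hp : p ∈ frontier Ω) (hx : x ≠ p) :
    ∃ U ∈ 𝓝 p, ∃ V ∈ 𝓝 x, QHSeparated Ω U V := by
  by_cases hxf : x ∈ frontier Ω
  · obtain ⟨U, V, hU, hV, hpU, hxV, -, K, hK, hKΩ, hm⟩ := hv p hp x hxf hx.symm
    refine ⟨U, hU.mem_nhds hpU, V, hV.mem_nhds hxV, K, hK, hKΩ, fun γ a b hab hγ ha hb => ?_⟩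
    obtain ⟨t, ht, htK⟩ := hm (fun t => γ (t + a)) (b - a) (by linarith) hγ.shift
      (by simpa using ha) (by simpa using hb)
    exact ⟨t + a, ⟨by linarith [ht.1], by linarith [ht.2]⟩, htK⟩
  · obtain ⟨V, hV, h⟩ := exists_qhSeparated_of_notMem_frontier hΩ hxf
    exact ⟨univ, univ_mem, V, hV, h univ⟩

theorem QHVisibilityDomain.exists_nhds_qhSeparated (hv : QHVisibilityDomain Ω)
    (hΩ : IsOpen Ω) (hp : p ∈ frontier Ω) (hB : IsCompact B) (hpB : p ∉ B) :
    ∃ U ∈ 𝓝 p, QHSeparated Ω U B := by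
  refine hB.induction_on (p := fun B => ∃ U ∈ 𝓝 p, QHSeparated Ω U B)
    ⟨univ, univ_mem, qhSeparated_empty_right⟩ ?_ ?_ ?_
  · rintro s t hst ⟨U, hU, h⟩
    exact ⟨U, hU, h.mono subset_rfl hst⟩
  · rintro s t ⟨U, hU, h⟩ ⟨V, hV, h'⟩
    exact ⟨U ∩ V, inter_mem hU hV, (h.mono inter_subset_left subset_rfl).union_right
      (h'.mono inter_subset_right subset_rfl)⟩
  · intro x hx
    obtain ⟨U, hU, V, hV, h⟩ := hv.exists_nhds_qhSeparated_point hΩ hp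
      (x := x) (fun h => hpB (h ▸ hx))
    exact ⟨V, mem_nhdsWithin_of_mem_nhds hV, U, hU, h⟩

/-- In a visibility domain disjoint compact sets are separated. -/
theorem QHVisibilityDomain.qhSeparated (hv : QHVisibilityDomain Ω)
    (hΩ : IsOpen Ω) (hA : IsCompact A) (hB : IsCompact B) (hAB : Disjoint A B) :
    QHSeparated Ω A B := by
  refine QHSeparated.symm ?_
  refine hA.induction_on (p := fun A => QHSeparated Ω B A) qhSeparated_empty_right
    (fun s t hst h => h.mono subset_rfl hst) (fun s t h h' => h.union_right h') fun x hx => ?_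
  by_cases hxf : x ∈ frontier Ω
  · obtain ⟨U, hU, h⟩ := hv.exists_nhds_qhSeparated hΩ hxf hB (disjoint_left.1 hAB hx)
    exact ⟨U, mem_nhdsWithin_of_mem_nhds hU, h.symm⟩
  · obtain ⟨V, hV, h⟩ := exists_qhSeparated_of_notMem_frontier hΩ hxf
    exact ⟨V, mem_nhdsWithin_of_mem_nhds hV, h B⟩

/-- If `P` is approached along small crosscuts but is not the limit of `F` at `0`, then there are
geodesics near the boundary going from near `P` to a fixed distance from `P`. -/
theorem IsHalfPlanePair.exists_escaping_geodesic (h : IsHalfPlanePair Ω F G) {P : OnePoint ℂ}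
    (hcross : ∀ N ∈ 𝓝 P, ∀ r₀ > 0, ∃ r > 0, r < r₀ ∧
      ∀ w ∈ rightHalfPlane, ‖w‖ = r → (F w : OnePoint ℂ) ∈ N)
    {N : Set (OnePoint ℂ)} (hN : ∃ᶠ w in 𝓝[rightHalfPlane] 0, (F w : OnePoint ℂ) ∉ N)
    {K : Set ℂ} (hK : IsCompact K) (hKΩ : K ⊆ Ω) {N' : Set (OnePoint ℂ)} (hN' : N' ∈ 𝓝 P) :
    ∃ (γ : ℝ → ℂ) (a b : ℝ), a ≤ b ∧ IsQHGeodesicOn Ω γ (Icc a b) ∧ (γ a : OnePoint ℂ) ∈ N' ∧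
      (γ b : OnePoint ℂ) ∉ N ∧ ∀ t ∈ Icc a b, γ t ∉ K := by
  obtain ⟨c, hc, hKc⟩ : ∃ c > 0, ∀ x ∈ K, c ≤ ‖G x‖ := by
    have hG0 : ∀ x ∈ K, 0 < ‖G x‖ := fun x hx => by
      have : 0 < (G x).re := h.maps_G (hKΩ hx)
      exact this.trans_le (Complex.re_le_norm _)
    rcases K.eq_empty_or_nonempty with rfl | hne
    · exact ⟨1, one_pos, fun x hx => hx.elim⟩
    · obtain ⟨x, hx, hmin⟩ := hK.exists_isMinOn hne (h.diff_G.continuousOn.mono hKΩ).norm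
      exact ⟨‖G x‖, hG0 x hx, fun y hy => hmin hy⟩
  obtain ⟨r, hr0, hrc, hr⟩ := hcross N' hN' (min c 1) (lt_min hc one_pos)
  rw [lt_min_iff] at hrc
  have h1 : (1 : ℂ) ∈ rightHalfPlane := by simp [rightHalfPlane]
  obtain ⟨w, hwN, hw, hwr⟩ := (hN.and_eventually (eventually_mem_nhdsWithin.and
    (eventually_mem_set.2 (mem_nhdsWithin_of_mem_nhds (ball_mem_nhds (0 : ℂ) hr0))))).exists
  rw [mem_ball_zero_iff] at hwr
  have ho := h.maps_F h1
  have hu := h.maps_F hw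
  obtain ⟨γ, hγ, hγ0, hγT⟩ := h.exists_geodesic ho hu
  set T := qhDist Ω (F 1) (F w) with hT
  have hT0 : 0 ≤ T := qhDist_nonneg
  have hcont : ContinuousOn (fun t => ‖G (γ t)‖) (Icc 0 T) :=
    (h.diff_G.continuousOn.comp (h.continuousOn_geodesic hγ) hγ.1).norm
  have hn0 : ‖G (γ 0)‖ = 1 := by rw [hγ0, h.left_inv h1, norm_one]
  have hnT : ‖G (γ T)‖ < r := by rw [hγT, h.left_inv hw]; exact hwr
  have hclosed : IsCompact {t | t ∈ Icc 0 T ∧ ‖G (γ t)‖ = r} := by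
    have := hcont.preimage_isClosed_of_isClosed isClosed_Icc (isClosed_singleton (x := r))
    exact isCompact_Icc.of_isClosed_subset this inter_subset_left
  obtain ⟨a, ⟨haI, har⟩, hamax⟩ := hclosed.exists_isGreatest (by
    obtain ⟨t, ht, htr⟩ := intermediate_value_Icc' hT0 hcont ⟨hnT.le, by rw [hn0]; exact hrc.2.le⟩
    exact ⟨t, ht, htr⟩)
  refine ⟨γ, a, T, haI.2, hγ.mono (Icc_subset_Icc_left haI.1), ?_, by rw [hγT]; exact hwN,
    fun t ht htK => ?_⟩
  · have := hr (G (γ a)) (h.maps_G (hγ.1 a haI)) har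
    rwa [h.right_inv (hγ.1 a haI)] at this
  · have htI : t ∈ Icc 0 T := ⟨haI.1.trans ht.1, ht.2⟩
    have hlt : r < ‖G (γ t)‖ := hrc.1.trans_le (hKc _ htK)
    obtain ⟨s, hs, hsr⟩ := intermediate_value_Icc' ht.2
      (hcont.mono (Icc_subset_Icc_left htI.1)) ⟨hnT.le, hlt.le⟩
    have hsa : s ≤ a := hamax ⟨⟨htI.1.trans hs.1, hs.2⟩, hsr⟩
    have : t = a := le_antisymm (hs.1.trans hsa) ht.1
    rw [this, har] at hlt
    exact lt_irrefl _ hlt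

theorem IsQHGeodesicOn.exists_dist_eq (h : IsQHDomain Ω) {γ : ℝ → ℂ} {a b r : ℝ} (hab : a ≤ b)
    (hγ : IsQHGeodesicOn Ω γ (Icc a b)) (ha : dist (γ a) p ≤ r) (hb : r ≤ dist (γ b) p) :
    ∃ t ∈ Icc a b, dist (γ t) p = r :=
  intermediate_value_Icc (f := fun t => dist (γ t) p) hab
    (by have := h.continuousOn_geodesic hγ; fun_prop) ⟨ha, hb⟩

theorem IsHalfPlanePair.tendsto_of_visible (h : IsHalfPlanePair Ω F G)
    (hv : QHVisibilityDomain Ω) {P : OnePoint ℂ}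
    (hcross : ∀ N ∈ 𝓝 P, ∀ r₀ > 0, ∃ r > 0, r < r₀ ∧
      ∀ w ∈ rightHalfPlane, ‖w‖ = r → (F w : OnePoint ℂ) ∈ N) :
    Tendsto (fun w => (F w : OnePoint ℂ)) (𝓝[rightHalfPlane] 0) (𝓝 P) := by
  by_contra hcon
  obtain ⟨N, hN, hfr⟩ := not_tendsto_iff_exists_frequently_notMem.1 hcon
  induction P using OnePoint.rec with
  | infty =>
    obtain ⟨R, hR⟩ : ∃ R : ℝ, ∀ x : ℂ, (x : OnePoint ℂ) ∉ N → ‖x‖ ≤ R := by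
      have h1 := (OnePoint.tendsto_coe_infty (X := ℂ)) hN
      rw [coclosedCompact_eq_cocompact, ← Metric.cobounded_eq_cocompact, mem_map,
        ← Bornology.isCobounded_def, ← Bornology.isBounded_compl_iff] at h1
      obtain ⟨R, hR⟩ := h1.exists_norm_le
      exact ⟨R, fun x hx => hR x hx⟩
    obtain ⟨K, hK, hKΩ, hm⟩ := hv.qhSeparated h.isOpen (isCompact_closedBall (0 : ℂ) R)
      (isCompact_sphere 0 (R + 1)) (disjoint_left.2 fun x hx hx' => by
        rw [mem_closedBall] at hx
        rw [mem_sphere] at hx'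
        linarith)
    obtain ⟨γ, a, b, hab, hγ, ha, hb, hKγ⟩ := h.exists_escaping_geodesic hcross hfr hK hKΩ
      (N' := ((↑) '' closedBall (0 : ℂ) (R + 1))ᶜ) (by
        refine IsOpen.mem_nhds ?_ (by simp)
        exact OnePoint.isOpen_compl_image_coe.2 ⟨isClosed_closedBall, isCompact_closedBall _ _⟩)
    have hb' := hR _ hb
    have ha' : R + 1 < ‖γ a‖ := by
      by_contra! hle
      exact ha (mem_image_of_mem _ (mem_closedBall_zero_iff.2 hle))
    have hr := hγ.reverse
    obtain ⟨t, ht, htr⟩ := hr.exists_dist_eq h.toIsQHDomain (p := 0) (r := R + 1) (by linarith)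
      (by rw [dist_zero_right, sub_zero]; linarith)
      (by rw [dist_zero_right, sub_sub_cancel]; exact ha'.le)
    obtain ⟨s, hs, hsK⟩ := hm _ 0 t ht.1 (hr.mono (Icc_subset_Icc_right ht.2))
      (by rw [mem_closedBall_zero_iff, sub_zero]; exact hb') htr
    exact hKγ _ ⟨by linarith [hs.2, ht.2], by linarith [hs.1]⟩ hsK
  | coe p =>
    obtain ⟨ε, hε, hball⟩ : ∃ ε > 0, ∀ x : ℂ, (x : OnePoint ℂ) ∉ N → ε ≤ dist x p := by
      obtain ⟨ε, hε, hball⟩ := Metric.mem_nhds_iff.1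
        (OnePoint.continuous_coe.continuousAt.preimage_mem_nhds hN)
      refine ⟨ε, hε, fun x hx => ?_⟩
      by_contra! hlt
      exact hx (hball hlt)
    obtain ⟨K, hK, hKΩ, hm⟩ := hv.qhSeparated h.isOpen (isCompact_closedBall p (ε / 2))
      (isCompact_sphere p ε) (disjoint_left.2 fun x hx hx' => by
        rw [mem_closedBall] at hx
        rw [mem_sphere] at hx'
        linarith)
    obtain ⟨γ, a, b, hab, hγ, ha, hb, hKγ⟩ := h.exists_escaping_geodesic hcross hfr hK hKΩ
      (N' := ((↑) '' closedBall p (ε / 2))) (OnePoint.isOpenEmbedding_coe.image_mem_nhds.2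
        (closedBall_mem_nhds p (half_pos hε)))
    obtain ⟨y, hy, hya⟩ := ha
    rw [OnePoint.coe_injective hya, mem_closedBall] at hy
    obtain ⟨t, ht, htr⟩ := hγ.exists_dist_eq h.toIsQHDomain hab (p := p) (r := ε) (by linarith)
      (hball _ hb)
    have hγt : IsQHGeodesicOn Ω γ (Icc a t) := hγ.mono (Icc_subset_Icc_right ht.2)
    obtain ⟨s, hs, hsK⟩ := hm _ a t ht.1 hγt hy htr
    exact hKγ _ ⟨hs.1, hs.2.trans ht.2⟩ hsK

end

section
variable {Ω : Set ℂ} {f g : ℂ → ℂ}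

theorem locallyConnectedSpace_circle : LocallyConnectedSpace Circle := by
  have h1 : LocallyConnectedSpace (AddCircle (2 * Real.pi)) :=
    (QuotientAddGroup.isQuotientMap_mk _).isCoinducing.locallyConnectedSpace
  exact (AddCircle.homeomorphCircle'.isQuotientMap).isCoinducing.locallyConnectedSpace

/-- If the Riemann map has limits everywhere on the circle, the boundary in the sphere is a
continuous image of the circle, hence locally connected. -/
theorem IsRiemannPair.locallyConnectedSpace (h : IsRiemannPair Ω f g)
    (hlim : ∀ ξ : ℂ, ‖ξ‖ = 1 → ∃ P : OnePoint ℂ,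
      Tendsto (fun z => (f z : OnePoint ℂ)) (𝓝[ball 0 1] ξ) (𝓝 P)) :
    LocallyConnectedSpace ↥(frontier ((↑) '' Ω : Set (OnePoint ℂ))) := by
  set φ : ℂ → OnePoint ℂ := fun z => (f z : OnePoint ℂ) with hφ
  have hcl : closure (ball (0 : ℂ) 1) = closedBall 0 1 := closure_ball 0 one_ne_zero
  have hφc : ContinuousOn φ (ball 0 1) :=
    OnePoint.continuous_coe.comp_continuousOn h.diff_f.continuousOn
  set Φ := extendFrom (ball (0 : ℂ) 1) φ with hΦ
  have hΦc : ContinuousOn Φ (closedBall 0 1) := by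
    refine continuousOn_extendFrom hcl.ge fun x hx => ?_
    rcases (mem_closedBall_zero_iff.1 hx).lt_or_eq with hlt | heq
    · exact ⟨_, hφc x (mem_ball_zero_iff.2 hlt)⟩
    · exact hlim x heq
  have hΦin : ∀ z ∈ ball (0 : ℂ) 1, Φ z = f z := extendFrom_extends hφc
  have hΦsph : ∀ ξ : ℂ, ‖ξ‖ = 1 → Φ ξ ∈ frontier ((↑) '' Ω : Set (OnePoint ℂ)) := by
    intro ξ hξ
    obtain ⟨P, hP⟩ := hlim ξ hξ
    have hmem : ξ ∈ closure (ball (0 : ℂ) 1) := by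
      rw [hcl, mem_closedBall_zero_iff, hξ]
    rw [hΦ, extendFrom_eq hmem hP]
    have hpos : ∀ n : ℕ, (0 : ℝ) < 1 / ((n : ℝ) + 1) := fun n => by positivity
    have h0 : Tendsto (fun n : ℕ => ((1 / ((n : ℝ) + 1) : ℝ) : ℂ)) atTop (𝓝 0) := by
      rw [← Complex.ofReal_zero]
      exact (Complex.continuous_ofReal.tendsto 0).comp tendsto_one_div_add_atTop_nhds_zero_nat
    have hu : ∀ n : ℕ, ((1 / ((n : ℝ) + 1) : ℝ) : ℂ) ∈ rightHalfPlane := fun n => by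
      simpa only [rightHalfPlane, mem_ofPred_eq, Complex.ofReal_re] using hpos n
    refine (h.isHalfPlanePair hξ).mem_frontier_of_tendsto hu h0 ?_
    exact hP.comp (tendsto_nhdsWithin_iff.2 ⟨tendsto_cayley.comp h0,
      Eventually.of_forall fun n => cayley_mem_ball hξ (hu n)⟩)
  let ψ : Circle → ↥(frontier ((↑) '' Ω : Set (OnePoint ℂ))) :=
    fun z => ⟨Φ z, hΦsph z (Circle.norm_coe z)⟩
  have hψ : Continuous ψ := by
    refine Continuous.subtype_mk (hΦc.comp_continuous continuous_subtype_val fun z => ?_) _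
    exact mem_closedBall_zero_iff.2 (Circle.norm_coe z).le
  have hsurj : Function.Surjective ψ := by
    rintro ⟨P, hP⟩
    obtain ⟨hPc, hPn⟩ := (mem_frontier_coe_iff h.isOpen).1 hP
    have hK : IsCompact (Φ '' closedBall 0 1) := (isCompact_closedBall 0 1).image_of_continuousOn hΦc
    have hsub : ((↑) '' Ω : Set (OnePoint ℂ)) ⊆ Φ '' closedBall 0 1 := by
      rintro _ ⟨w, hw, rfl⟩
      refine ⟨g w, ball_subset_closedBall (h.maps_g hw), ?_⟩
      rw [hΦin _ (h.maps_g hw), h.right_inv hw]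
    obtain ⟨z, hz, rfl⟩ := closure_minimal hsub hK.isClosed hPc
    rcases (mem_closedBall_zero_iff.1 hz).lt_or_eq with hlt | heq
    · refine (hPn ?_).elim
      have hz' := mem_ball_zero_iff.2 hlt
      rw [hΦin z hz']
      exact mem_image_of_mem _ (h.maps_f hz')
    · exact ⟨⟨z, mem_sphere_zero_iff_norm.2 heq⟩, rfl⟩
  have := locallyConnectedSpace_circle
  exact (IsQuotientMap.of_surjective_continuous hsurj hψ).isCoinducing.locallyConnectedSpace

end

theorem IsPreconnected.eq_of_exp_eq_one {X : Type*} [TopologicalSpace X] {S : Set X}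
    (hS : IsPreconnected S) {h : X → ℂ} (hc : ContinuousOn h S)
    (he : ∀ x ∈ S, Complex.exp (h x) = 1) {x y : X} (hx : x ∈ S) (hy : y ∈ S) : h x = h y := by
  have hπ := Real.pi_pos
  have hT : IsDiscrete (range ((↑) : ℤ → ℝ)) :=
    Int.isClosedEmbedding_coe_real.isEmbedding.isInducing.isDiscrete_range
  have key : ∀ z ∈ S, ∃ n : ℤ, h z = n * (2 * Real.pi * Complex.I) := fun z hz =>
    Complex.exp_eq_one_iff.1 (he z hz)
  have him : ∀ {z : X} {n : ℤ}, h z = n * (2 * Real.pi * Complex.I) →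
      (h z).im / (2 * Real.pi) = n := by
    intro z n hz
    rw [hz]
    have : (n : ℂ) * (2 * Real.pi * Complex.I) = ((n * (2 * Real.pi) : ℝ) : ℂ) * Complex.I := by
      push_cast; ring
    rw [this, Complex.im_ofReal_mul, Complex.I_im]
    field_simp
  have hm : MapsTo (fun z => (h z).im / (2 * Real.pi)) S (range ((↑) : ℤ → ℝ)) := by
    intro z hz
    obtain ⟨n, hn⟩ := key z hz
    exact ⟨n, (him hn).symm⟩
  have hcc : ContinuousOn (fun z => (h z).im / (2 * Real.pi)) S :=
    (Complex.continuous_im.comp_continuousOn hc).div_const _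
  have := hS.constant_of_mapsTo hT hcc hm hx hy
  obtain ⟨n, hn⟩ := key x hx
  obtain ⟨k, hk⟩ := key y hy
  rw [him hn, him hk] at this
  rw [hn, hk]
  have h2 : n = k := by exact_mod_cast this
  rw [h2]

/-- There is no continuous logarithm of `w - w₀` on a convex annulus around `w₀`. -/
theorem not_exists_log_sub {Q K : Set ℂ} (hQo : IsOpen Q) (hQc : Convex ℝ Q)
    (hQb : Bornology.IsBounded Q) (hK : IsCompact K) (hKQ : K ⊆ Q) {w₀ : ℂ} (hw₀ : w₀ ∈ Q)
    {m : ℂ → ℂ} (hm : ContinuousOn m (Q \ K)) (he : ∀ w ∈ Q \ K, Complex.exp (m w) = w - w₀) :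
    False := by
  set Q' : Set ℂ := (fun z => w₀ + z) ⁻¹' Q with hQ'
  set K' : Set ℂ := (fun z => w₀ + z) ⁻¹' K with hK'
  have ho : IsOpen Q' := hQo.preimage (by fun_prop)
  have h0 : (0 : ℂ) ∈ Q' := by simpa [hQ'] using hw₀
  have hn : Q' ∈ 𝓝 (0 : ℂ) := ho.mem_nhds h0
  have hc : Convex ℝ Q' := hQc.translate_preimage_right w₀
  have hb : Bornology.IsVonNBounded ℝ Q' := by
    rw [NormedSpace.isVonNBounded_iff]
    obtain ⟨R, hR⟩ := hQb.exists_norm_le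
    refine isBounded_iff_forall_norm_le.2 ⟨R + ‖w₀‖, fun z hz => ?_⟩
    have h1 := hR _ hz
    calc ‖z‖ = ‖(w₀ + z) - w₀‖ := by ring_nf
      _ ≤ _ := (norm_sub_le _ _).trans (by gcongr)
  have hg := continuous_gauge hc hn
  have hKc : IsCompact K' := (Homeomorph.addLeft w₀).isCompact_preimage.2 hK
  obtain ⟨c, hc0, hc1, hcK⟩ : ∃ c : ℝ, 0 < c ∧ c < 1 ∧ ∀ z ∈ K', gauge Q' z < c := by
    rcases K'.eq_empty_or_nonempty with h | h
    · exact ⟨1 / 2, by norm_num, by norm_num, fun z hz => by rw [h] at hz; exact hz.elim⟩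
    · obtain ⟨z, hz, hmax⟩ := hKc.exists_isMaxOn h hg.continuousOn
      have h1 : gauge Q' z < 1 := gauge_lt_one_of_mem_of_isOpen ho (hKQ hz)
      have h2 := gauge_nonneg (s := Q') z
      refine ⟨(gauge Q' z + 1) / 2, by linarith, by linarith, fun x hx => ?_⟩
      have : gauge Q' x ≤ gauge Q' z := hmax hx
      linarith
  have habs : Absorbent ℝ Q' := absorbent_nhds_zero hn
  set e : ℝ → ℂ := fun α => Complex.exp (α * Complex.I)
  have hec : Continuous e := by fun_prop
  have hge : ∀ α, 0 < gauge Q' (e α) := fun α => (gauge_pos habs hb).2 (Complex.exp_ne_zero _)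
  set ρ : ℝ → ℝ := fun α => c / gauge Q' (e α)
  have hρ : ∀ α, 0 < ρ α := fun α => div_pos hc0 (hge α)
  have hρc : Continuous ρ := continuous_const.div (hg.comp hec) fun α => (hge α).ne'
  have hgρ : ∀ α, gauge Q' (ρ α • e α) = c := by
    intro α
    rw [gauge_smul_of_nonneg (hρ α).le, smul_eq_mul, div_mul_cancel₀ _ (hge α).ne']
  have hmem : ∀ α, w₀ + ρ α • e α ∈ Q \ K := by
    intro α
    refine ⟨?_, fun h => (hcK _ h).ne (hgρ α)⟩
    have : ρ α • e α ∈ {x | gauge Q' x < 1} := by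
      change gauge Q' _ < 1
      rw [hgρ]
      exact hc1
    rw [setOfPred_gauge_lt_one_eq_self_of_isOpen hc h0 ho] at this
    exact this
  set H : ℝ → ℂ := fun α => m (w₀ + ρ α • e α) - Real.log (ρ α) - α * Complex.I
  have hHc : Continuous H := by
    refine (Continuous.sub ?_ ?_).sub (by fun_prop)
    · exact hm.comp_continuous (by fun_prop) hmem
    · exact Complex.continuous_ofReal.comp (hρc.log fun α => (hρ α).ne')
  have hH1 : ∀ α ∈ univ, Complex.exp (H α) = 1 := by
    intro α _
    have h1 : (ρ α : ℂ) ≠ 0 := by exact_mod_cast (hρ α).ne'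
    have h2 : e α ≠ 0 := Complex.exp_ne_zero _
    simp only [H]
    rw [Complex.exp_sub, Complex.exp_sub, he _ (hmem α), ← Complex.ofReal_exp,
      Real.exp_log (hρ α), add_sub_cancel_left, Complex.real_smul, mul_div_cancel_left₀ _ h1]
    exact div_self h2
  have hH := isPreconnected_univ.eq_of_exp_eq_one hHc.continuousOn hH1 (mem_univ 0)
    (mem_univ (2 * Real.pi))
  have h3 : e (2 * Real.pi) = e 0 := by
    simp [e, Complex.exp_two_pi_mul_I]
  have h4 : ρ (2 * Real.pi) = ρ 0 := by simp only [ρ, h3]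
  simp only [H, h3, h4] at hH
  have h5 : (2 * Real.pi : ℂ) * Complex.I = 0 := by
    push_cast at hH
    linear_combination hH
  simp [Real.pi_ne_zero] at h5

/-- The map `x ↦ (x - u) / (x - v)` of the Riemann sphere. -/
noncomputable def sphereRatio (u v : ℂ) (P : OnePoint ℂ) : ℂ := P.elim 1 fun x => (x - u) / (x - v)

section
variable {u v w x : ℂ} {P : OnePoint ℂ} {A N₀ : Set (OnePoint ℂ)} {U : Set ℂ}

theorem sphereRatio_infty : sphereRatio u v OnePoint.infty = 1 := rfl

theorem sphereRatio_coe : sphereRatio u v x = (x - u) / (x - v) := rfl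

theorem continuousAt_sphereRatio (h : P ≠ v) : ContinuousAt (sphereRatio u v) P := by
  induction P using OnePoint.rec with
  | infty =>
    rw [OnePoint.continuousAt_infty', coclosedCompact_eq_cocompact, ← Metric.cobounded_eq_cocompact]
    have h1 : Tendsto (fun x : ℂ => 1 - (u - v) * (x - v)⁻¹) (Bornology.cobounded ℂ)
        (𝓝 (1 - (u - v) * 0)) := by
      refine tendsto_const_nhds.sub (tendsto_const_nhds.mul ?_)
      refine tendsto_inv₀_cobounded.comp ?_
      exact tendsto_sub_const_cobounded v
    rw [mul_zero, sub_zero] at h1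
    refine h1.congr' ?_
    filter_upwards [Bornology.eventually_ne_cobounded v] with x hx
    have : x - v ≠ 0 := sub_ne_zero.2 hx
    simp only [Function.comp_apply, sphereRatio_coe]
    field_simp
    ring
  | coe x =>
    rw [OnePoint.continuousAt_coe]
    have hx : x - v ≠ 0 := sub_ne_zero.2 fun h' => h (by rw [h'])
    change ContinuousAt (fun x => (x - u) / (x - v)) x
    fun_prop (disch := assumption)

theorem sphereRatio_mul (h : P ≠ v) : sphereRatio u v P * sphereRatio v w P = sphereRatio u w P := by
  induction P using OnePoint.rec with
  | infty => simp [sphereRatio_infty]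
  | coe x =>
    have : x - v ≠ 0 := sub_ne_zero.2 fun e => h (by rw [e])
    simp only [sphereRatio_coe]
    field_simp

theorem sphereRatio_inv : (sphereRatio u v P)⁻¹ = sphereRatio v u P := by
  induction P using OnePoint.rec with
  | infty => simp [sphereRatio_infty]
  | coe x => simp [sphereRatio_coe]

/-- A continuous logarithm of `(x - u) / (x - v)` exists off any connected open set
containing `u` and `v`. -/
theorem exists_log_sphereRatio (hU : IsPreconnected U) (hUo : IsOpen U)
    (hA : ∀ x ∈ U, (x : OnePoint ℂ) ∉ A) (hu : u ∈ U) (hv : v ∈ U) :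
    ∃ ℓ : OnePoint ℂ → ℂ, ContinuousOn ℓ A ∧ ∀ P ∈ A, Complex.exp (ℓ P) = sphereRatio u v P := by
  have hne : ∀ x ∈ U, ∀ P ∈ A, P ≠ (x : OnePoint ℂ) := by
    rintro x hx P hP rfl
    exact hA x hx hP
  refine hU.induction₂ (fun u v => ∃ ℓ : OnePoint ℂ → ℂ, ContinuousOn ℓ A ∧
    ∀ P ∈ A, Complex.exp (ℓ P) = sphereRatio u v P) ?_ ?_ ?_ hu hv
  · intro u hu
    obtain ⟨ε, hε, hεU⟩ := Metric.isOpen_iff.1 hUo u hu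
    refine mem_nhdsWithin_of_mem_nhds ?_
    filter_upwards [ball_mem_nhds u (half_pos hε)] with v hv
    rw [mem_ball_iff_norm] at hv
    have hvU : v ∈ U := hεU (by rw [mem_ball_iff_norm]; linarith)
    have hslit : ∀ P ∈ A, sphereRatio u v P ∈ Complex.slitPlane := by
      intro P hP
      rw [← add_sub_cancel 1 (sphereRatio u v P)]
      refine Complex.mem_slitPlane_of_norm_lt_one ?_
      have hPv := hne v hvU P hP
      induction P using OnePoint.rec with
      | infty => simp [sphereRatio_infty]
      | coe x =>
        have hx : x - v ≠ 0 := sub_ne_zero.2 fun e => hPv (by rw [e])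
        have h1 : sphereRatio u v x - 1 = (v - u) / (x - v) := by
          rw [sphereRatio_coe]; field_simp; ring
        have h2 : ε ≤ ‖x - u‖ := by
          by_contra! h
          exact hA x (hεU (mem_ball_iff_norm.2 h)) hP
        rw [h1, norm_div, div_lt_one (norm_pos_iff.2 hx)]
        have := norm_sub_le_norm_sub_add_norm_sub x v u
        linarith
    exact ⟨fun P => Complex.log (sphereRatio u v P),
      ContinuousOn.clog (fun P hP => (continuousAt_sphereRatio (hne v hvU P hP)).continuousWithinAt)
        hslit, fun P hP => Complex.exp_log (Complex.slitPlane_ne_zero (hslit P hP))⟩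
  · rintro u v w hu hv hw ⟨ℓ, hℓ, he⟩ ⟨ℓ', hℓ', he'⟩
    exact ⟨fun P => ℓ P + ℓ' P, hℓ.add hℓ', fun P hP => by
      rw [Complex.exp_add, he P hP, he' P hP, sphereRatio_mul (hne v hv P hP)]⟩
  · rintro u v hu hv ⟨ℓ, hℓ, he⟩
    exact ⟨fun P => - ℓ P, hℓ.neg, fun P hP => by
      rw [Complex.exp_neg, he P hP, sphereRatio_inv]⟩

/-- Every point of the sphere has arbitrarily small closed neighbourhoods with connected
complement. -/
theorem exists_closed_nhds_isPreconnected_compl {o : ℂ} (hP : P ≠ o) (hN₀ : N₀ ∈ 𝓝 P) :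
    ∃ N ∈ 𝓝 P, N ⊆ N₀ ∧ IsClosed N ∧ IsPreconnected {x : ℂ | (x : OnePoint ℂ) ∉ N} ∧
      (o : OnePoint ℂ) ∉ N := by
  induction P using OnePoint.rec with
  | infty =>
    have h1 : Tendsto ((↑) : ℂ → OnePoint ℂ) (Bornology.cobounded ℂ) (𝓝 OnePoint.infty) := by
      rw [Metric.cobounded_eq_cocompact, ← coclosedCompact_eq_cocompact]
      exact OnePoint.tendsto_coe_infty
    obtain ⟨R, hR⟩ := (Filter.HasBasis.mem_iff (hasBasis_cobounded_compl_closedBall (0 : ℂ))).1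
      (h1 hN₀)
    set R' := max (R + 1) (‖o‖ + 1)
    have hR1 : R < R' := lt_of_lt_of_le (by linarith) (le_max_left _ _)
    have hR2 : ‖o‖ < R' := lt_of_lt_of_le (by linarith) (le_max_right _ _)
    have hmem : ∀ x : ℂ, (x : OnePoint ℂ) ∉ ((↑) '' ball (0 : ℂ) R' : Set (OnePoint ℂ))ᶜ ↔
        x ∈ ball (0 : ℂ) R' := by
      intro x
      rw [notMem_compl_iff, OnePoint.coe_injective.mem_set_image]
    refine ⟨((↑) '' ball (0 : ℂ) R')ᶜ, ?_, ?_, ?_, ?_, ?_⟩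
    · have : ((↑) '' closedBall (0 : ℂ) R' : Set (OnePoint ℂ))ᶜ ∈ 𝓝 (OnePoint.infty : OnePoint ℂ) :=
        (OnePoint.isOpen_compl_image_coe.2 ⟨isClosed_closedBall, isCompact_closedBall 0 R'⟩).mem_nhds
          (by simp)
      exact mem_of_superset this (compl_subset_compl.2 (image_mono ball_subset_closedBall))
    · intro P hP
      induction P using OnePoint.rec with
      | infty => exact mem_of_mem_nhds hN₀
      | coe x =>
        refine hR.2 fun hx => ?_
        rw [mem_compl_iff, OnePoint.coe_injective.mem_set_image] at hP
        exact hP (closedBall_subset_ball hR1 hx)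
    · exact (OnePoint.isOpenEmbedding_coe.isOpenMap _ isOpen_ball).isClosed_compl
    · simp only [hmem]
      exact (convex_ball (0 : ℂ) R').isPreconnected
    · rw [hmem]
      simpa using hR2
  | coe p =>
    have hop : 0 < ‖o - p‖ := norm_pos_iff.2 (sub_ne_zero.2 fun e => hP (by rw [e]))
    obtain ⟨ε₀, hε₀, hεN⟩ := Metric.nhds_basis_closedBall.mem_iff.1
      (OnePoint.continuous_coe.continuousAt.preimage_mem_nhds hN₀ : _ ∈ 𝓝 p)
    obtain ⟨ε, hε, hlt⟩ : ∃ ε, 0 < ε ∧ ε < min ε₀ ‖o - p‖ := exists_between (lt_min hε₀ hop)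
    have hmem : ∀ x : ℂ, (x : OnePoint ℂ) ∉ ((↑) '' closedBall p ε : Set (OnePoint ℂ)) ↔
        ε < ‖x - p‖ := by
      intro x
      rw [OnePoint.coe_injective.mem_set_image, mem_closedBall_iff_norm, not_le]
    refine ⟨(↑) '' closedBall p ε, ?_, ?_, ?_, ?_, ?_⟩
    · exact OnePoint.isOpenEmbedding_coe.isOpenMap.image_mem_nhds (closedBall_mem_nhds p hε)
    · rw [image_subset_iff]
      exact (closedBall_subset_closedBall (hlt.le.trans (min_le_left _ _))).trans hεN
    · exact ((isCompact_closedBall p ε).image OnePoint.continuous_coe).isClosed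
    · simp only [hmem]
      have : {x : ℂ | ε < ‖x - p‖} =
          (fun q : ℝ × ℝ => p + q.1 * Complex.exp (q.2 * Complex.I)) '' (Ioi ε ×ˢ univ) := by
        ext x
        constructor
        · intro hx
          exact ⟨(‖x - p‖, Complex.arg (x - p)), ⟨hx, mem_univ _⟩, by
            simp only [Complex.norm_mul_exp_arg_mul_I]; ring⟩
        · rintro ⟨⟨s, t⟩, ⟨hs, -⟩, rfl⟩
          have hs' : ε < s := hs
          change ε < ‖_‖
          simp [Complex.norm_exp_ofReal_mul_I, abs_of_pos (hε.trans hs'), hs']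
      rw [this]
      exact (isPreconnected_Ioi.prod isPreconnected_univ).image _ (by fun_prop)
    · rw [hmem]
      exact hlt.trans_le (min_le_right _ _)

end

/-- Logarithms on two closed sets with connected intersection glue to a logarithm on a
neighbourhood of the union. -/
theorem exists_log_nhds_union {Y : Type*} [TopologicalSpace Y] [NormalSpace Y] {X B W : Set Y}
    {φ ℓ₁ ℓ₂ : Y → ℂ} (hX : IsClosed X) (hB : IsClosed B) (hXB : IsPreconnected (X ∩ B))
    (hXBne : (X ∩ B).Nonempty)
    (hW : IsOpen W) (hφ : ContinuousOn φ W) (hXW : X ⊆ W) (hBW : B ⊆ W)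
    (hℓ₁ : ContinuousOn ℓ₁ X) (he₁ : ∀ P ∈ X, Complex.exp (ℓ₁ P) = φ P)
    (hℓ₂ : ContinuousOn ℓ₂ B) (he₂ : ∀ P ∈ B, Complex.exp (ℓ₂ P) = φ P) :
    ∃ O, IsOpen O ∧ X ⊆ O ∧ B ⊆ O ∧ ∃ ℓ : Y → ℂ, ContinuousOn ℓ O ∧
      ∀ P ∈ O, Complex.exp (ℓ P) = φ P := by
  classical
  obtain ⟨P₀, hP₀⟩ := hXBne
  set c := ℓ₁ P₀ - ℓ₂ P₀ with hcdef
  have hc : ∀ P ∈ X ∩ B, ℓ₁ P = ℓ₂ P + c := fun P hP => by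
    have := hXB.eq_of_exp_eq_one (h := fun P => ℓ₁ P - ℓ₂ P)
      ((hℓ₁.mono inter_subset_left).sub (hℓ₂.mono inter_subset_right))
      (fun P hP => by
        rw [Complex.exp_sub, he₁ P hP.1, he₂ P hP.2, div_self]
        rw [← he₁ P hP.1]
        exact Complex.exp_ne_zero _) hP hP₀
    linear_combination this
  have hec : Complex.exp c = 1 := by
    rw [hcdef, Complex.exp_sub, he₁ P₀ hP₀.1, he₂ P₀ hP₀.2, div_self]
    rw [← he₁ P₀ hP₀.1]
    exact Complex.exp_ne_zero _
  set ℓ : Y → ℂ := fun P => if P ∈ X then ℓ₁ P else ℓ₂ P + c with hℓ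
  have hℓX : EqOn ℓ ℓ₁ X := fun P hP => if_pos hP
  have hℓB : EqOn ℓ (fun P => ℓ₂ P + c) B := fun P hP => by
    by_cases h : P ∈ X
    · rw [hℓX h, hc P ⟨h, hP⟩]
    · exact if_neg h
  have hcont : ContinuousOn ℓ (X ∪ B) :=
    (hℓ₁.congr hℓX).union_of_isClosed ((hℓ₂.add continuousOn_const).congr hℓB) hX hB
  have he : ∀ P ∈ X ∪ B, Complex.exp (ℓ P) = φ P := by
    rintro P (hP | hP)
    · rw [hℓX hP, he₁ P hP]
    · rw [hℓB hP, Complex.exp_add, hec, mul_one, he₂ P hP]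
  obtain ⟨t, ht⟩ := ContinuousMap.exists_restrict_eq (hX.union hB)
    (⟨_, continuousOn_iff_continuous_domRestrict.1 hcont⟩ : C(↥(X ∪ B), ℂ))
  have hteq : ∀ P ∈ X ∪ B, t P = ℓ P := fun P hP => congrArg (fun q => q ⟨P, hP⟩) ht
  have hψ : ContinuousOn (fun P => φ P * Complex.exp (-t P)) W :=
    hφ.mul (Continuous.continuousOn (by fun_prop))
  have hXBO : ∀ P ∈ X ∪ B, φ P * Complex.exp (-t P) = 1 := fun P hP => by
    rw [hteq P hP, ← he P hP, ← Complex.exp_add, add_neg_cancel, Complex.exp_zero]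
  refine ⟨W ∩ (fun P => φ P * Complex.exp (-t P)) ⁻¹' Complex.slitPlane,
    hψ.isOpen_inter_preimage hW Complex.isOpen_slitPlane, ?_, ?_,
    fun P => t P + Complex.log (φ P * Complex.exp (-t P)), ?_, ?_⟩
  · refine fun P hP => ⟨hXW hP, ?_⟩
    rw [mem_preimage, hXBO P (Or.inl hP)]
    exact Complex.one_mem_slitPlane
  · refine fun P hP => ⟨hBW hP, ?_⟩
    rw [mem_preimage, hXBO P (Or.inr hP)]
    exact Complex.one_mem_slitPlane
  · exact t.continuous.continuousOn.add ((hψ.mono inter_subset_left).clog fun P hP => hP.2)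
  · intro P hP
    rw [Complex.exp_add, Complex.exp_log (Complex.slitPlane_ne_zero hP.2)]
    change _ * (φ P * _) = _
    rw [mul_comm (φ P), ← mul_assoc, ← Complex.exp_add, add_neg_cancel, Complex.exp_zero, one_mul]

section
variable {Ω : Set ℂ} {F G : ℂ → ℂ} {w₀ : ℂ} {P : OnePoint ℂ}

theorem convex_rightHalfPlane : Convex ℝ rightHalfPlane := convex_halfSpace_re_gt 0

theorem IsHalfPlanePair.injOn (h : IsHalfPlanePair Ω F G) : InjOn F rightHalfPlane :=
  h.left_inv.injOn

theorem IsHalfPlanePair.deriv_ne_zero (h : IsHalfPlanePair Ω F G) (hw : w₀ ∈ rightHalfPlane) :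
    deriv F w₀ ≠ 0 := by
  intro h0
  have hF := (h.diff_F.differentiableAt (isOpen_rightHalfPlane.mem_nhds hw)).hasDerivAt
  have hG := (h.diff_G.differentiableAt (h.isOpen.mem_nhds (h.maps_F hw))).hasDerivAt
  have h1 := hG.comp w₀ hF
  have h2 : HasDerivAt (G ∘ F) 1 w₀ := (hasDerivAt_id w₀).congr_of_eventuallyEq <| by
    filter_upwards [isOpen_rightHalfPlane.mem_nhds hw] with w hw using h.left_inv hw
  have := h1.unique h2
  rw [h0, mul_zero] at this
  exact zero_ne_one this

theorem IsHalfPlanePair.exists_log_sub (h : IsHalfPlanePair Ω F G) (hw₀ : w₀ ∈ rightHalfPlane) :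
    ∃ a : ℂ → ℂ, ContinuousOn a rightHalfPlane ∧
      ∀ w ∈ rightHalfPlane, F w - F w₀ = (w - w₀) * Complex.exp (a w) := by
  have hsc : IsSimplyConnected rightHalfPlane := by
    have := convex_rightHalfPlane.contractibleSpace ⟨w₀, hw₀⟩
    have h' : SimplyConnectedSpace rightHalfPlane := SimplyConnectedSpace.ofContractible _
    exact h'
  have hd : ContinuousOn (dslope F w₀) rightHalfPlane := by
    rw [continuousOn_dslope (isOpen_rightHalfPlane.mem_nhds hw₀)]
    exact ⟨h.diff_F.continuousOn,
      h.diff_F.differentiableAt (isOpen_rightHalfPlane.mem_nhds hw₀)⟩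
  have h0 : (0 : ℂ) ∉ dslope F w₀ '' rightHalfPlane := by
    rintro ⟨w, hw, hz⟩
    by_cases hww : w = w₀
    · rw [hww, dslope_same] at hz
      exact h.deriv_ne_zero hw₀ hz
    · have h1 := sub_smul_dslope F w₀ w
      rw [hz, smul_zero] at h1
      exact hww (h.injOn hw hw₀ (sub_eq_zero.1 h1.symm))
  obtain ⟨a, ha, he⟩ := Complex.exists_continuousOn_eqOn_exp_comp hsc isOpen_rightHalfPlane hd h0
  refine ⟨a, ha, fun w hw => ?_⟩
  have h1 : Complex.exp (a w) = dslope F w₀ w := he hw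
  rw [h1, ← smul_eq_mul, sub_smul_dslope]

/-- The function `(F w - F w₀) / (F w - F 1)` has no logarithm near the boundary of the half disc
of radius `r ≤ 1`, if `w₀` lies in that half disc. -/
theorem IsHalfPlanePair.not_exists_log (h : IsHalfPlanePair Ω F G) {r : ℝ} (hr : r ≤ 1)
    (hw₀ : w₀ ∈ rightHalfPlane) (hw₀r : ‖w₀‖ < r) {K : Set ℂ} (hK : IsCompact K)
    (hKQ : K ⊆ rightHalfPlane ∩ ball 0 r) {Λ : ℂ → ℂ}
    (hΛ : ContinuousOn Λ ((rightHalfPlane ∩ ball 0 r) \ K))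
    (he : ∀ w ∈ (rightHalfPlane ∩ ball 0 r) \ K,
      Complex.exp (Λ w) = (F w - F w₀) / (F w - F 1)) : False := by
  have h1 : (1 : ℂ) ∈ rightHalfPlane := by change 0 < (1 : ℂ).re; simp
  obtain ⟨a, ha, hea⟩ := h.exists_log_sub hw₀
  obtain ⟨b, hb, heb⟩ := h.exists_log_sub h1
  have hsub : (rightHalfPlane ∩ ball 0 r) \ K ⊆ rightHalfPlane := fun w hw => hw.1.1
  have hlt : ∀ w ∈ (rightHalfPlane ∩ ball 0 r) \ K, 1 - w ∈ Complex.slitPlane := by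
    intro w hw
    rw [sub_eq_add_neg]
    refine Complex.mem_slitPlane_of_norm_lt_one ?_
    rw [norm_neg]
    exact (mem_ball_zero_iff.1 hw.1.2).trans_le hr
  refine not_exists_log_sub (isOpen_rightHalfPlane.inter isOpen_ball)
    (convex_rightHalfPlane.inter (convex_ball 0 r)) (isBounded_ball.subset inter_subset_right)
    hK hKQ ⟨hw₀, mem_ball_zero_iff.2 hw₀r⟩
    (m := fun w => Λ w - a w + b w + (Complex.log (1 - w) + Real.pi * Complex.I)) ?_ ?_
  · exact ((hΛ.sub (ha.mono hsub)).add (hb.mono hsub)).add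
      ((ContinuousOn.clog (by fun_prop) hlt).add continuousOn_const)
  · intro w hw
    have h2 : 1 - w ≠ 0 := Complex.slitPlane_ne_zero (hlt w hw)
    have h3 : w - 1 ≠ 0 := by rw [← neg_sub]; exact neg_ne_zero.2 h2
    have h4 := Complex.exp_ne_zero (a w)
    have h5 := Complex.exp_ne_zero (b w)
    rw [Complex.exp_add, Complex.exp_add, Complex.exp_add, Complex.exp_sub, he w hw,
      hea w hw.1.1, heb w hw.1.1, Complex.exp_log h2, Complex.exp_pi_mul_I]
    field_simp
    ring

theorem IsHalfPlanePair.not_exists_log_sphereRatio (h : IsHalfPlanePair Ω F G) {r : ℝ}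
    (hr : r ≤ 1) (hw₀ : w₀ ∈ rightHalfPlane) (hw₀r : ‖w₀‖ < r) {O : Set (OnePoint ℂ)}
    (hO : IsOpen O) (hXO : frontier ((↑) '' Ω : Set (OnePoint ℂ)) ⊆ O)
    (hcO : ∀ w ∈ rightHalfPlane, ‖w‖ = r → (F w : OnePoint ℂ) ∈ O) {ℓ : OnePoint ℂ → ℂ}
    (hℓ : ContinuousOn ℓ O) (he : ∀ P ∈ O, Complex.exp (ℓ P) = sphereRatio (F w₀) (F 1) P) :
    False := by
  set C : Set ℂ := {x | x ∈ Ω ∧ (x : OnePoint ℂ) ∉ O}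
  have hCimg : ((↑) '' C : Set (OnePoint ℂ)) = closure ((↑) '' Ω) ∩ Oᶜ := by
    ext P
    constructor
    · rintro ⟨x, hx, rfl⟩
      exact ⟨subset_closure (mem_image_of_mem _ hx.1), hx.2⟩
    · rintro ⟨hP, hPO⟩
      by_contra hPC
      refine hPO (hXO ((mem_frontier_coe_iff h.isOpen).2 ⟨hP, ?_⟩))
      rintro ⟨x, hx, rfl⟩
      exact hPC ⟨x, ⟨hx, hPO⟩, rfl⟩
  have hC : IsCompact C := by
    rw [OnePoint.isOpenEmbedding_coe.isInducing.isCompact_iff, hCimg]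
    exact (isClosed_closure.inter hO.isClosed_compl).isCompact
  have hCΩ : C ⊆ Ω := fun x hx => hx.1
  have hK : IsCompact (G '' C ∩ closedBall 0 r) :=
    (hC.image_of_continuousOn (h.diff_G.continuousOn.mono hCΩ)).inter_right isClosed_closedBall
  refine h.not_exists_log hr hw₀ hw₀r hK ?_ (Λ := fun w => ℓ (F w)) ?_ ?_
  · rintro _ ⟨⟨x, hx, rfl⟩, hxr⟩
    refine ⟨h.maps_G hx.1, mem_ball_zero_iff.2 ?_⟩
    refine lt_of_le_of_ne (mem_closedBall_zero_iff.1 hxr) fun hn => hx.2 ?_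
    have := hcO (G x) (h.maps_G hx.1) hn
    rwa [h.right_inv hx.1] at this
  all_goals
    have hm : ∀ w ∈ (rightHalfPlane ∩ ball 0 r) \ (G '' C ∩ closedBall 0 r),
        (F w : OnePoint ℂ) ∈ O := by
      intro w hw
      by_contra hwO
      exact hw.2 ⟨⟨F w, ⟨h.maps_F hw.1.1, hwO⟩, h.left_inv hw.1.1⟩, ball_subset_closedBall hw.1.2⟩
  · exact hℓ.comp (OnePoint.continuous_coe.comp_continuousOn
      (h.diff_F.continuousOn.mono fun w hw => hw.1.1)) hm
  · intro w hw
    rw [he _ (hm w hw), sphereRatio_coe]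

/-- If the boundary in the sphere is locally connected, then shrinking crosscuts force a
boundary limit. -/
theorem IsHalfPlanePair.tendsto_of_locallyConnectedSpace (h : IsHalfPlanePair Ω F G)
    (hlc : LocallyConnectedSpace ↥(frontier ((↑) '' Ω : Set (OnePoint ℂ))))
    (hΩc : IsPreconnected Ω) (hPX : P ∈ frontier ((↑) '' Ω : Set (OnePoint ℂ)))
    (hcross : ∀ N ∈ 𝓝 P, ∀ r₀ > 0, ∃ r > 0, r < r₀ ∧
      ∀ w ∈ rightHalfPlane, ‖w‖ = r → (F w : OnePoint ℂ) ∈ N) :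
    Tendsto (fun w => (F w : OnePoint ℂ)) (𝓝[rightHalfPlane] 0) (𝓝 P) := by
  by_contra hnot
  obtain ⟨N₀, hN₀, hfreq⟩ := not_tendsto_iff_exists_frequently_notMem.1 hnot
  have h1 : (1 : ℂ) ∈ rightHalfPlane := by change 0 < (1 : ℂ).re; simp
  have hXΩ : ∀ x ∈ Ω, (x : OnePoint ℂ) ∉ frontier ((↑) '' Ω : Set (OnePoint ℂ)) := fun x hx hxX =>
    ((mem_frontier_coe_iff h.isOpen).1 hxX).2 (mem_image_of_mem _ hx)
  have hoΩ : F 1 ∈ Ω := h.maps_F h1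
  have hPo : P ≠ (F 1 : ℂ) := by
    rintro rfl
    exact hXΩ _ hoΩ hPX
  obtain ⟨N, hN, hNN₀, hNc, hNconn, hoN⟩ := exists_closed_nhds_isPreconnected_compl hPo hN₀
  obtain ⟨V, hV, hVconn, hVN⟩ := locallyConnectedSpace_iff_connected_subsets.1 hlc ⟨P, hPX⟩
    (Subtype.val ⁻¹' N) (continuous_subtype_val.continuousAt.preimage_mem_nhds hN)
  obtain ⟨N', hN', hN'V⟩ := mem_nhds_subtype _ _ _ |>.1 hV
  set L : Set (OnePoint ℂ) := closure (Subtype.val '' V)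
  have hLconn : IsPreconnected L := (hVconn.image _ continuous_subtype_val.continuousOn).closure
  have hLX : L ⊆ frontier ((↑) '' Ω : Set (OnePoint ℂ)) :=
    closure_minimal (by rintro _ ⟨x, -, rfl⟩; exact x.2) isClosed_frontier
  have hLN : L ⊆ N := closure_minimal (by rintro _ ⟨x, hx, rfl⟩; exact hVN hx) hNc
  obtain ⟨M, hM, hMc, hMN⟩ := exists_mem_nhds_isClosed_subset (inter_mem hN hN')
  obtain ⟨r, hr, hr1, hcr⟩ := hcross M hM 1 one_pos
  obtain ⟨w₀, hw₀N, hw₀, hw₀r⟩ : ∃ w₀, (F w₀ : OnePoint ℂ) ∉ N₀ ∧ w₀ ∈ rightHalfPlane ∧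
      ‖w₀‖ < r := by
    have hev : ∀ᶠ w in 𝓝[rightHalfPlane] 0, w ∈ rightHalfPlane ∧ w ∈ ball (0 : ℂ) r :=
      inter_mem self_mem_nhdsWithin (mem_nhdsWithin_of_mem_nhds (ball_mem_nhds (0 : ℂ) hr))
    obtain ⟨w, hw, hw', hw''⟩ := (hfreq.and_eventually hev).exists
    exact ⟨w, hw, hw', mem_ball_zero_iff.1 hw''⟩
  have hBN : L ∪ M ⊆ N := union_subset hLN (hMN.trans inter_subset_left)
  have hXB : frontier ((↑) '' Ω : Set (OnePoint ℂ)) ∩ (L ∪ M) = L := by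
    refine Subset.antisymm ?_ fun Q hQ => ⟨hLX hQ, Or.inl hQ⟩
    rintro Q ⟨hQX, hQ | hQ⟩
    · exact hQ
    · exact subset_closure ⟨⟨Q, hQX⟩, hN'V (hMN hQ).2, rfl⟩
  have hPL : P ∈ L := by
    rw [← hXB]
    exact ⟨hPX, Or.inr (mem_of_mem_nhds hM)⟩
  obtain ⟨ℓ₁, hℓ₁, he₁⟩ := exists_log_sphereRatio hΩc h.isOpen hXΩ (h.maps_F hw₀) hoΩ
  obtain ⟨ℓ₂, hℓ₂, he₂⟩ := exists_log_sphereRatio (A := L ∪ M) hNconn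
    (hNc.isOpen_compl.preimage OnePoint.continuous_coe) (fun x hx hxB => hx (hBN hxB))
    (u := F w₀) (v := F 1) (fun hx => hw₀N (hNN₀ hx)) hoN
  obtain ⟨O, hO, hXO, hBO, ℓ, hℓ, he⟩ := exists_log_nhds_union isClosed_frontier
    (isClosed_closure.union hMc) (by rw [hXB]; exact hLconn) (by rw [hXB]; exact ⟨P, hPL⟩)
    (isOpen_compl_singleton (x := ((F 1 : ℂ) : OnePoint ℂ)))
    (fun Q hQ => (continuousAt_sphereRatio hQ).continuousWithinAt)
    (fun Q hQ hQo => hXΩ _ hoΩ (hQo ▸ hQ)) (fun Q hQ hQo => hoN (hBN (hQo ▸ hQ))) hℓ₁ he₁ hℓ₂ he₂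
  exact h.not_exists_log_sphereRatio hr1.le hw₀ hw₀r hO hXO
    (fun w hw hwr => hBO (Or.inr (hcr w hw hwr))) hℓ he

end

/-- A (possibly unbounded) simply connected domain `Ω ⊊ ℂ` is a
QH-visibility domain if and only if its boundary `∂^∞Ω = ∂Ω ∪ {∞}` taken in the Riemann
sphere (the one-point compactification of `ℂ`) is locally connected. -/
theorem statement17 (Ω : Set ℂ)
    (hOpen : IsOpen Ω) (hConn : IsConnected Ω) (hProper : Ω ≠ univ)
    (hSC : SimplyConnectedSpace ↥Ω) :
    QHVisibilityDomain Ω ↔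
      LocallyConnectedSpace ↥(frontier (OnePoint.some '' Ω : Set (OnePoint ℂ))) := by
  have hs : IsSimplyConnected Ω := hSC
  obtain ⟨o, ho⟩ := hConn.nonempty
  obtain ⟨f, g, hf, hg, hmf, hmg, hl, hr, -⟩ :=
    riemann_mapping hOpen hs hProper hConn.isPreconnected ho
  have h : IsRiemannPair Ω f g :=
    { toIsQHDomain := hConn.isPreconnected.isQHDomain hOpen hProper
      diff_f := hf
      diff_g := hg
      maps_f := hmf
      maps_g := hmg
      left_inv := hl
      right_inv := hr }
  constructor
  · refine fun hv => h.locallyConnectedSpace fun ξ hξ => ?_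
    obtain ⟨P, -, hcross⟩ := h.exists_crosscut hξ
    exact ⟨P, tendsto_of_cayley hξ ((h.isHalfPlanePair hξ).tendsto_of_visible hv hcross)⟩
  · refine fun hlc => h.qhVisibilityDomain fun ξ hξ => ?_
    obtain ⟨P, hP, hcross⟩ := h.exists_crosscut hξ
    exact ⟨P, tendsto_of_cayley hξ ((h.isHalfPlanePair hξ).tendsto_of_locallyConnectedSpace hlc
      hConn.isPreconnected hP hcross)⟩

end
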